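/- arXiv:2111.08802 — 2 statements merged into one kernel-verified Lean document; each statement's English description precedes it below -/
import Mathlib

section
/- Let n ≥ 1, let U ⊆ ℂⁿ be an open neighbourhood of the origin, and let F : U → F(U) ⊆ ℂⁿ be a biholomorphism (injective holomorphic with holomorphic inverse on the open image) with F(0) = 0 such that every eigenvalue λ of the derivative dF₀ satisfies 0 < |λ| < 1. Then there exist an open neighbourhood V of 0 with V ⊆ U and F(V) ⊆ U, an injective holomorphic map ψ : V → ℂⁿ with ψ(0) = 0 whose inverse is holomorphic on the open set ψ(V), an invertible lower-triangular matrix A ∈ GLₙ(ℂ), and polynomials g₂,…,gₙ, where each g_j depends only on the variables z₁,…,z_{j−1} and has no constant or linear terms, such that the polynomial map G(z) = Az + (0, g₂(z), …, gₙ(z)) is a holomorphic (polynomial) automorphism of ℂⁿ and ψ(F(z)) = G(ψ(z)) for all z ∈ V. -/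
noncomputable section

/-- A holomorphic automorphism of ℂⁿ: a bijective entire map with entire inverse. -/
def IsHolomorphicAutomorphism {n : ℕ}
    (F : EuclideanSpace ℂ (Fin n) → EuclideanSpace ℂ (Fin n)) : Prop :=
  Differentiable ℂ F ∧ ∃ G : EuclideanSpace ℂ (Fin n) → EuclideanSpace ℂ (Fin n),
    Differentiable ℂ G ∧ (∀ z, G (F z) = z) ∧ (∀ z, F (G z) = z)

section Holomorphic
open Filter Topology Metric Set

variable {E F : Type*} [NormedAddCommGroup E] [NormedSpace ℂ E]
  [NormedAddCommGroup F] [NormedSpace ℂ F]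

/-- A locally bounded-by-`C` holomorphic map satisfies Cauchy's estimate. -/
theorem norm_fderiv_le_of_norm_le_on_ball {f : E → F} {c : E} {r C : ℝ} (hr : 0 < r)
    (hd : DifferentiableOn ℂ f (ball c r)) (hC : ∀ z ∈ ball c r, ‖f z‖ ≤ C) :
    ‖fderiv ℂ f c‖ ≤ 2 * C / r := by
  refine Complex.norm_fderiv_le_div_of_mapsTo_ball hd (fun z hz => ?_) hr
  rw [mem_closedBall, dist_eq_norm]
  linarith [norm_sub_le (f z) (f c), hC z hz, hC c (mem_ball_self hr)]

/-- A uniform limit of holomorphic maps on an open set is holomorphic. -/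
theorem TendstoUniformlyOn.differentiableOn_complex [CompleteSpace F] {f : ℕ → E → F} {g : E → F}
    {U : Set E} (hU : IsOpen U) (hf : ∀ k, DifferentiableOn ℂ (f k) U)
    (hg : TendstoUniformlyOn f g atTop U) : DifferentiableOn ℂ g U := by
  intro z hz
  obtain ⟨r, hr, hrU⟩ := Metric.isOpen_iff.1 hU z hz
  have hsub : ∀ w ∈ ball z (r / 2), ball w (r / 2) ⊆ U := fun w hw =>
    (ball_subset_ball' (by linarith [mem_ball.1 hw])).trans hrU
  have hcau : UniformCauchySeqOn (fun k => fderiv ℂ (f k)) atTop (ball z (r / 2)) := by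
    rw [Metric.uniformCauchySeqOn_iff]
    intro ε hε
    obtain ⟨N, hN⟩ := Metric.uniformCauchySeqOn_iff.1 hg.uniformCauchySeqOn (ε * r / 8)
      (by positivity)
    refine ⟨N, fun m hm n hn w hw => ?_⟩
    have hwU : U ∈ 𝓝 w := hU.mem_nhds (hsub w hw (mem_ball_self (by positivity)))
    rw [dist_eq_norm, ← fderiv_sub ((hf m).differentiableAt hwU) ((hf n).differentiableAt hwU)]
    refine (norm_fderiv_le_of_norm_le_on_ball (r := r / 2) (C := ε * r / 8) (by positivity)
      (((hf m).sub (hf n)).mono (hsub w hw)) fun y hy => ?_).trans_lt ?_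
    · rw [Pi.sub_apply, ← dist_eq_norm]
      exact (hN m hm n hn y (hsub w hw hy)).le
    · field_simp
      linarith
  have hlim : ∀ w ∈ ball z (r / 2), ∃ L, Tendsto (fun k => fderiv ℂ (f k) w) atTop (𝓝 L) :=
    fun w hw => cauchySeq_tendsto_of_complete (hcau.cauchySeq hw)
  choose! g' hg' using hlim
  have hballU : ball z (r / 2) ⊆ U := hsub z (mem_ball_self (by positivity))
  refine (hasFDerivAt_of_tendstoUniformlyOn isOpen_ball (hcau.tendstoUniformlyOn_of_tendsto hg')
    (fun k w hw => ((hf k).differentiableAt (hU.mem_nhds (hballU hw))).hasFDerivAt)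
    (fun w hw => hg.tendsto_at (hballU hw))
    (mem_ball_self (by positivity))).differentiableAt.differentiableWithinAt

/-- The directional derivatives of a holomorphic map are holomorphic. -/
theorem DifferentiableOn.fderiv_apply_complex [CompleteSpace F] {f : E → F} {U : Set E}
    (hU : IsOpen U) (hf : DifferentiableOn ℂ f U) (v : E) :
    DifferentiableOn ℂ (fun z => fderiv ℂ f z v) U := by
  intro z hz
  obtain ⟨r₀, hr₀, hr₀U⟩ := Metric.isOpen_iff.1 hU z hz
  have hcont : ∀ᶠ w in 𝓝 z, ‖f w‖ < ‖f z‖ + 1 :=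
    (hf.continuousOn.continuousAt (hU.mem_nhds hz)).norm.eventually_lt_const (by simp)
  obtain ⟨r₁, hr₁, hb⟩ := Metric.eventually_nhds_iff_ball.1 hcont
  set M := ‖f z‖ + 1
  obtain ⟨r, hr, hrr₀, hrr₁⟩ : ∃ r > 0, 2 * r ≤ r₀ ∧ 2 * r ≤ r₁ :=
    ⟨min r₀ r₁ / 2, by positivity, by linarith [min_le_left r₀ r₁],
      by linarith [min_le_right r₀ r₁]⟩
  have hsub : ∀ w ∈ ball z r, ball w r ⊆ ball z (2 * r) := fun w hw =>
    ball_subset_ball' (by linarith [mem_ball.1 hw])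
  have hsubU : ball z (2 * r) ⊆ U := (ball_subset_ball hrr₀).trans hr₀U
  have hM : ∀ w ∈ ball z (2 * r), ‖f w‖ ≤ M := fun w hw => (hb w (ball_subset_ball hrr₁ hw)).le
  have hM0 : 0 < M := by positivity
  -- second order estimate
  have hest : ∀ w ∈ ball z r, ∀ y : E, ‖y‖ < r →
      ‖f (w + y) - f w - fderiv ℂ f w y‖ ≤ 4 * M * (‖y‖ / r) ^ 2 := by
    intro w hw y hy
    have hwU : DifferentiableAt ℂ f w := hf.differentiableAt
      (hU.mem_nhds (hsubU (hsub w hw (mem_ball_self hr))))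
    have hD : ‖fderiv ℂ f w‖ ≤ 2 * M / r := norm_fderiv_le_of_norm_le_on_ball hr
      (hf.mono ((hsub w hw).trans hsubU)) fun x hx => hM x (hsub w hw hx)
    set h : E → F := fun x => f x - fderiv ℂ f w (x - w) with hh
    have hhw : h w = f w := by simp [hh]
    have hmem : w + y ∈ ball w r := by simpa [mem_ball, dist_eq_norm] using hy
    have := Complex.dist_le_mul_div_pow_of_mapsTo_ball_of_isLittleO (f := h) (c := w) (z := w + y)
      (R₁ := r) (R₂ := 4 * M) (n := 1) ?_ ?_ ?_ hmem
    · simpa [hh, dist_eq_norm, sub_right_comm] using this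
    · exact (hf.mono ((hsub w hw).trans hsubU)).sub (by fun_prop)
    · intro x hx
      rw [mem_closedBall, hhw, dist_eq_norm]
      have h1 : ‖fderiv ℂ f w (x - w)‖ ≤ 2 * M := by
        refine ((fderiv ℂ f w).le_of_opNorm_le hD _).trans ?_
        have : ‖x - w‖ ≤ r := by rw [← dist_eq_norm]; exact (mem_ball.1 hx).le
        rw [div_mul_eq_mul_div, div_le_iff₀ hr]
        gcongr
      have h2 := hM x (hsub w hw hx)
      have h3 := hM w (hsub w hw (mem_ball_self hr))
      calc ‖h x - f w‖ = ‖f x - fderiv ℂ f w (x - w) - f w‖ := rfl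
        _ ≤ ‖f x‖ + ‖fderiv ℂ f w (x - w)‖ + ‖f w‖ :=
          (norm_sub_le _ _).trans (by gcongr; exact norm_sub_le _ _)
        _ ≤ 4 * M := by linarith
    · have := hwU.hasFDerivAt.isLittleO
      simpa [hh, sub_right_comm] using this
  -- difference quotients converge uniformly
  obtain ⟨K, hK⟩ : ∃ K : ℕ, ‖v‖ / r < K := exists_nat_gt _
  have hKpos : (0 : ℝ) < K := lt_of_le_of_lt (by positivity) hK
  set q : ℕ → E → F := fun k w =>
    ((k + K : ℕ) : ℂ) • (f (w + ((k + K : ℕ) : ℂ)⁻¹ • v) - f w) with hq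
  have hsmall : ∀ k : ℕ, ‖((k + K : ℕ) : ℂ)⁻¹ • v‖ < r := by
    intro k
    rw [norm_smul, norm_inv, Complex.norm_natCast, inv_mul_lt_iff₀ (by push_cast; positivity)]
    rw [div_lt_iff₀ hr] at hK
    push_cast
    nlinarith [(Nat.cast_nonneg k : (0 : ℝ) ≤ k)]
  have hqd : ∀ k, DifferentiableOn ℂ (q k) (ball z r) := by
    intro k
    refine DifferentiableOn.const_smul (DifferentiableOn.sub ?_ (hf.mono fun w hw => ?_)) _
    · refine hf.comp (by fun_prop) fun w hw => hsubU (hsub w hw ?_)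
      simpa [mem_ball, dist_eq_norm] using hsmall k
    · exact hsubU (hsub w hw (mem_ball_self hr))
  have hlim : TendstoUniformlyOn q (fun w => fderiv ℂ f w v) atTop (ball z r) := by
    rw [Metric.tendstoUniformlyOn_iff]
    intro ε hε
    have ht : Tendsto (fun k : ℕ => 4 * M * (‖v‖ / r) ^ 2 / ((k + K : ℕ) : ℝ)) atTop (𝓝 0) :=
      (tendsto_const_div_atTop_nhds_zero_nat _).comp (tendsto_add_atTop_nat K)
    filter_upwards [ht.eventually_lt_const hε] with k hk w hw
    refine lt_of_le_of_lt ?_ hk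
    have hpos : (0 : ℝ) < ((k + K : ℕ) : ℝ) := by push_cast; positivity
    have hne : (((k + K : ℕ) : ℂ)) ≠ 0 := by
      have : (((k + K : ℕ) : ℝ)) ≠ 0 := hpos.ne'
      exact_mod_cast this
    have h1 := hest w hw _ (hsmall k)
    have h2 : q k w - fderiv ℂ f w v = ((k + K : ℕ) : ℂ) •
        (f (w + ((k + K : ℕ) : ℂ)⁻¹ • v) - f w - fderiv ℂ f w (((k + K : ℕ) : ℂ)⁻¹ • v)) := by
      rw [map_smul, smul_sub, smul_inv_smul₀ hne]
    rw [dist_comm, dist_eq_norm, h2, norm_smul, Complex.norm_natCast]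
    refine (mul_le_mul_of_nonneg_left h1 hpos.le).trans_eq ?_
    rw [norm_smul, norm_inv, Complex.norm_natCast]
    field_simp
  exact ((hlim.differentiableOn_complex isOpen_ball hqd).differentiableAt
    (isOpen_ball.mem_nhds (mem_ball_self hr))).differentiableWithinAt

/-- A holomorphic map on a finite-dimensional space is continuously differentiable. -/
theorem DifferentiableOn.contDiffOn_complex_one [FiniteDimensional ℂ E] [CompleteSpace F]
    {f : E → F} {U : Set E} (hU : IsOpen U) (hf : DifferentiableOn ℂ f U) :
    ContDiffOn ℂ 1 f U := by
  rw [show (1 : WithTop ℕ∞) = 0 + 1 by simp, contDiffOn_succ_iff_fderiv_of_isOpen hU]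
  refine ⟨hf, by simp, ?_⟩
  rw [contDiffOn_zero]
  refine continuousOn_clm_apply.2 fun v => (hf.fderiv_apply_complex hU v).continuousOn

end Holomorphic

section Taylor
open Filter Topology Metric Set

variable {n : ℕ}

/-- Integration of the monomials of a polynomial along rays. -/
theorem exists_radial_primitive (i : Fin n) (P : MvPolynomial (Fin n) ℂ) :
    ∃ Q : MvPolynomial (Fin n) ℂ, MvPolynomial.eval 0 Q = 0 ∧ ∀ (w : Fin n → ℂ) (t : ℂ),
      HasDerivAt (fun t : ℂ => MvPolynomial.eval (t • w) Q)
        (w i * MvPolynomial.eval (t • w) P) t := by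
  induction P using MvPolynomial.induction_on' with
  | monomial u a =>
    have hray : ∀ (d : Fin n →₀ ℕ) (c : ℂ) (w : Fin n → ℂ) (t : ℂ),
        MvPolynomial.eval (t • w) (MvPolynomial.monomial d c) =
          t ^ d.degree * MvPolynomial.eval w (MvPolynomial.monomial d c) := by
      intro d c w t
      simp only [MvPolynomial.eval_monomial, Pi.smul_apply, smul_eq_mul, mul_pow, Finsupp.prod,
        Finset.prod_mul_distrib, Finset.prod_pow_eq_pow_sum, Finsupp.degree_apply]
      ring
    have hdeg : (u + Finsupp.single i 1).degree = u.degree + 1 := by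
      rw [map_add, Finsupp.degree_single]
    refine ⟨MvPolynomial.monomial (u + Finsupp.single i 1) (a / (u.degree + 1)), ?_, ?_⟩
    · have := hray (u + Finsupp.single i 1) (a / (u.degree + 1)) 0 0
      rwa [hdeg, smul_zero, pow_succ, mul_zero, zero_mul] at this
    · intro w t
      simp only [hray, hdeg]
      have hne : ((u.degree : ℂ) + 1) ≠ 0 := by exact_mod_cast Nat.succ_ne_zero u.degree
      have h := (hasDerivAt_pow (u.degree + 1) t).mul_const
        (MvPolynomial.eval w (MvPolynomial.monomial (u + Finsupp.single i 1) (a / (u.degree + 1))))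
      refine h.congr_deriv ?_
      rw [MvPolynomial.eval_monomial, MvPolynomial.eval_monomial,
        Finsupp.prod_add_index' (by simp) (by simp [pow_add]), Finsupp.prod_single_index (by simp)]
      push_cast
      field_simp
  | add p q hp hq =>
    obtain ⟨P, hP0, hP⟩ := hp
    obtain ⟨Q, hQ0, hQ⟩ := hq
    refine ⟨P + Q, by rw [map_add, hP0, hQ0, add_zero], fun w t => ?_⟩
    simp only [map_add, mul_add]
    exact (hP w t).add (hQ w t)

theorem differentiable_mvPolynomial_eval (p : MvPolynomial (Fin n) ℂ) :
    Differentiable ℂ fun w : EuclideanSpace ℂ (Fin n) => MvPolynomial.eval w.ofLp p := by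
  have h : Differentiable ℂ fun w : Fin n → ℂ => MvPolynomial.eval w p := fun w =>
    (AnalyticOnNhd.eval_mvPolynomial p w (mem_univ w)).differentiableAt
  exact h.comp (PiLp.continuousLinearEquiv 2 ℂ fun _ : Fin n => ℂ).differentiable

/-- Taylor expansion of a holomorphic germ to any order. -/
theorem exists_mvPolynomial_sub_isBigO (m : ℕ) (f : EuclideanSpace ℂ (Fin n) → ℂ)
    (hf : ∀ᶠ z in 𝓝 0, DifferentiableAt ℂ f z) :
    ∃ p : MvPolynomial (Fin n) ℂ,
      (fun w => f w - MvPolynomial.eval w.ofLp p) =O[𝓝 0] fun w => ‖w‖ ^ m := by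
  induction m generalizing f with
  | zero =>
    refine ⟨0, ?_⟩
    simpa using (hf.self_of_nhds.continuousAt).norm.isBoundedUnder_le.isBigO_one ℝ
  | succ m ih =>
    obtain ⟨r₀, hr₀, hd⟩ := Metric.eventually_nhds_iff_ball.1 hf
    set e : Fin n → EuclideanSpace ℂ (Fin n) := fun i => EuclideanSpace.basisFun (Fin n) ℂ i
    have hpart : ∀ i, ∃ p : MvPolynomial (Fin n) ℂ,
        (fun w => fderiv ℂ f w (e i) - MvPolynomial.eval w.ofLp p) =O[𝓝 0] fun w => ‖w‖ ^ m := by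
      refine fun i => ih _ ?_
      have := DifferentiableOn.fderiv_apply_complex isOpen_ball
        (fun z hz => (hd z hz).differentiableWithinAt) (e i)
      filter_upwards [ball_mem_nhds _ hr₀] with z hz
      exact this.differentiableAt (isOpen_ball.mem_nhds hz)
    choose p hp using hpart
    choose K hK using fun i => (hp i).bound
    choose Q hQ0 hQ using fun i => exists_radial_primitive i (p i)
    obtain ⟨r, hr, hb⟩ := Metric.eventually_nhds_iff_ball.1 (hf.and (eventually_all.2 hK))
    refine ⟨MvPolynomial.C (f 0) + ∑ i, Q i, Asymptotics.IsBigO.of_bound (∑ i, |K i|) ?_⟩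
    filter_upwards [ball_mem_nhds _ hr] with w hw
    set φ : ℂ → ℂ := fun t => f (t • w) -
      MvPolynomial.eval (t • w.ofLp) (MvPolynomial.C (f 0) + ∑ i, Q i)
    have hmem : ∀ t ∈ closedBall (0 : ℂ) 1, t • w ∈ ball (0 : EuclideanSpace ℂ (Fin n)) r := by
      intro t ht
      rw [mem_closedBall_zero_iff] at ht
      rw [mem_ball_zero_iff] at hw ⊢
      rw [norm_smul]
      nlinarith [norm_nonneg w]
    have hφ' : ∀ t ∈ closedBall (0 : ℂ) 1, HasDerivWithinAt φ
        (∑ i, w i * (fderiv ℂ f (t • w) (e i) - MvPolynomial.eval (t • w).ofLp (p i)))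
        (closedBall 0 1) t := by
      intro t ht
      refine HasDerivAt.hasDerivWithinAt ?_
      have h1 : HasDerivAt (fun t : ℂ => f (t • w)) (fderiv ℂ f (t • w) w) t := by
        have := (hb _ (hmem t ht)).1.hasFDerivAt.comp_hasDerivAt t ((hasDerivAt_id t).smul_const w)
        exact this.congr_deriv (by simp)
      have h2 : HasDerivAt (fun t : ℂ => MvPolynomial.eval (t • w.ofLp)
          (MvPolynomial.C (f 0) + ∑ i, Q i))
          (∑ i, w i * MvPolynomial.eval (t • w.ofLp) (p i)) t := by
        simp only [map_add, map_sum, MvPolynomial.eval_C]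
        exact (HasDerivAt.fun_sum fun i _ => hQ i w.ofLp t).const_add _
      have h3 : fderiv ℂ f (t • w) w = ∑ i, w i * fderiv ℂ f (t • w) (e i) := by
        have hw := congrArg (fderiv ℂ f (t • w)) ((EuclideanSpace.basisFun (Fin n) ℂ).sum_repr w)
        rw [map_sum] at hw
        simpa only [map_smul, smul_eq_mul, EuclideanSpace.basisFun_repr] using hw.symm
      refine (h1.sub h2).congr_deriv ?_
      rw [h3, ← Finset.sum_sub_distrib]
      simp [mul_sub]
    have hbound : ∀ t ∈ closedBall (0 : ℂ) 1,
        ‖∑ i, w i * (fderiv ℂ f (t • w) (e i) - MvPolynomial.eval (t • w).ofLp (p i))‖ ≤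
          (∑ i, |K i|) * ‖w‖ ^ (m + 1) := by
      intro t ht
      rw [Finset.sum_mul]
      refine norm_sum_le_of_le _ fun i _ => ?_
      have h1 := (hb _ (hmem t ht)).2 i
      have h2 : ‖t • w‖ ≤ ‖w‖ := by
        rw [norm_smul]
        exact mul_le_of_le_one_left (norm_nonneg _) (mem_closedBall_zero_iff.1 ht)
      rw [norm_mul, pow_succ, ← mul_assoc, mul_comm]
      refine mul_le_mul (h1.trans ?_) (PiLp.norm_apply_le w i) (norm_nonneg _) (by positivity)
      rw [Real.norm_of_nonneg (by positivity)]
      gcongr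
      exact le_abs_self _
    have := Convex.norm_image_sub_le_of_norm_hasDerivWithin_le hφ' hbound
      (convex_closedBall (0 : ℂ) 1) (x := 0) (y := 1) (by simp) (by simp)
    have h0 : φ 0 = 0 := by
      simp only [φ, zero_smul, map_add, map_sum, MvPolynomial.eval_C, hQ0]
      simp
    have h1 : φ 1 = f w - MvPolynomial.eval w.ofLp (MvPolynomial.C (f 0) + ∑ i, Q i) := by
      simp only [φ, one_smul]
    rw [h0, h1] at this
    simpa only [sub_zero, norm_one, mul_one, norm_pow, norm_norm] using this

end Taylor

section LinearAlgebra
open Polynomial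

/-- Simultaneous triangularization and splitting: over `ℂ` there is a basis of generalized
eigenvectors, ordered by decreasing modulus of the eigenvalues, in which `S` is triangular. -/
theorem exists_triangularizing_family {W : Type*} [AddCommGroup W] [Module ℂ W]
    [FiniteDimensional ℂ W] (S : Module.End ℂ W) (d : ℕ) (hd : Module.finrank ℂ W = d) :
    ∃ (b : Fin d → W) (μ : Fin d → ℂ), LinearIndependent ℂ b ∧
      (∀ j, b j ∈ S.maxGenEigenspace (μ j)) ∧
      (∀ j, S (b j) - μ j • b j ∈ Submodule.span ℂ (b '' Set.Iio j)) ∧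
      (∀ j k, j ≤ k → ‖μ k‖ ≤ ‖μ j‖) ∧ ∀ j, S.HasEigenvalue (μ j) := by
  induction d generalizing W with
  | zero =>
    exact ⟨Fin.elim0, Fin.elim0, linearIndependent_empty_type, fun j => j.elim0, fun j => j.elim0,
      fun j => j.elim0, fun j => j.elim0⟩
  | succ d ih =>
    have : Nontrivial W := Module.nontrivial_of_finrank_pos (R := ℂ) (by omega)
    obtain ⟨ν, hν, hmin⟩ := Set.exists_min_image {ν : ℂ | S.HasEigenvalue ν} (fun ν => ‖ν‖)
      (Module.End.finite_hasEigenvalue S) (Module.End.exists_eigenvalue S)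
    have hrange : LinearMap.range (S - algebraMap ℂ _ ν) < ⊤ := by
      rw [lt_top_iff_ne_top, Ne, LinearMap.range_eq_top, ← LinearMap.injective_iff_surjective,
        ← LinearMap.ker_eq_bot]
      rwa [Set.mem_ofPred_eq, Module.End.hasEigenvalue_iff, Module.End.eigenspace_def] at hν
    obtain ⟨φ, hφ, hle⟩ := Submodule.exists_le_ker_of_lt_top _ hrange
    have hker : ∀ x, φ (S x) = ν * φ x := by
      intro x
      have : φ ((S - algebraMap ℂ _ ν) x) = 0 := hle (LinearMap.mem_range_self _ x)
      simpa [sub_eq_zero, Module.algebraMap_end_apply] using this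
    have hinv : ∀ x ∈ LinearMap.ker φ, S x ∈ LinearMap.ker φ := by
      intro x hx
      rw [LinearMap.mem_ker] at hx ⊢
      rw [hker, hx, mul_zero]
    obtain ⟨v, hv, hvφ⟩ : ∃ v ∈ S.maxGenEigenspace ν, φ v ≠ 0 := by
      by_contra! h
      refine hφ (LinearMap.ext fun x => ?_)
      suffices (⊤ : Submodule ℂ W) ≤ LinearMap.ker φ from this trivial
      rw [← Module.End.iSup_maxGenEigenspace_eq_top S, iSup_le_iff]
      intro μ y hy
      rcases eq_or_ne μ ν with rfl | hne
      · exact h y hy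
      · obtain ⟨k, hk⟩ := (Module.End.mem_maxGenEigenspace S μ y).1 hy
        have hpow : ∀ k, φ (((S - μ • (1 : Module.End ℂ W)) ^ k) y) = (ν - μ) ^ k * φ y := by
          intro k
          induction k with
          | zero => simp
          | succ k ihk =>
            rw [pow_succ', Module.End.mul_apply, LinearMap.sub_apply, map_sub, hker,
              LinearMap.smul_apply, Module.End.one_apply, map_smul, smul_eq_mul, ihk]
            ring
        have := hpow k
        rw [hk, map_zero, eq_comm, mul_eq_zero] at this
        exact this.resolve_left (pow_ne_zero _ (sub_ne_zero.2 hne.symm))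
    have hfin : Module.finrank ℂ (LinearMap.ker φ) = d := by
      have := Module.Dual.finrank_ker_add_one_of_ne_zero hφ
      omega
    obtain ⟨b, μ, hb, hgen, htri, hanti, heig⟩ := ih (S.restrict hinv) hfin
    have hb' : LinearIndependent ℂ fun j => (b j : W) :=
      hb.map' (LinearMap.ker φ).subtype (Submodule.ker_subtype _)
    have hspan : Submodule.span ℂ (Set.range fun j => (b j : W)) = LinearMap.ker φ := by
      refine Submodule.eq_of_le_of_finrank_eq (Submodule.span_le.2 ?_) ?_
      · rintro _ ⟨j, rfl⟩
        exact (b j).2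
      · rw [finrank_span_eq_card hb', hfin, Fintype.card_fin]
    have heig' : ∀ j, S.HasEigenvalue (μ j) := by
      intro j
      obtain ⟨x, hx⟩ := (heig j).exists_hasEigenvector
      refine Module.End.hasEigenvalue_of_hasEigenvector (x := (x : W))
        ⟨Module.End.mem_eigenspace_iff.2 ?_, fun h0 => hx.2 (Subtype.ext h0)⟩
      exact congrArg Subtype.val hx.apply_eq_smul
    refine ⟨Fin.snoc (fun j => (b j : W)) v, Fin.snoc μ ν, ?_, ?_, ?_, ?_, ?_⟩
    · refine linearIndependent_finSnoc.2 ⟨hb', ?_⟩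
      rw [hspan]
      exact hvφ
    · intro j
      refine Fin.lastCases ?_ (fun j => ?_) j
      · simpa using hv
      · have h := hgen j
        rw [Module.End.maxGenEigenspace, Module.End.genEigenspace_restrict] at h
        simpa using h
    · intro j
      refine Fin.lastCases ?_ (fun j => ?_) j
      · simp only [Fin.snoc_last]
        have himg : (Fin.snoc (fun j => (b j : W)) v : Fin (d + 1) → W) '' Set.Iio (Fin.last d) =
            Set.range fun j => (b j : W) := by
          ext x
          constructor
          · rintro ⟨j, hj, rfl⟩
            refine ⟨j.castPred (ne_of_lt hj), ?_⟩
            conv_rhs => rw [← Fin.castSucc_castPred j (ne_of_lt hj), Fin.snoc_castSucc]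
          · rintro ⟨j, rfl⟩
            exact ⟨j.castSucc, Fin.castSucc_lt_last j, by simp⟩
        rw [himg, hspan, LinearMap.mem_ker, map_sub, hker, map_smul, smul_eq_mul, sub_self]
      · simp only [Fin.snoc_castSucc]
        have h := Submodule.mem_map_of_mem (f := (LinearMap.ker φ).subtype) (htri j)
        rw [Submodule.map_span] at h
        refine Submodule.span_mono ?_ h
        rintro _ ⟨_, ⟨k, hk, rfl⟩, rfl⟩
        exact ⟨k.castSucc, Fin.castSucc_lt_castSucc_iff.2 hk, by simp⟩
    · intro j k
      refine Fin.lastCases ?_ (fun k => ?_) k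
      · intro _
        refine Fin.lastCases ?_ (fun j => ?_) j
        · simp
        · simpa using hmin _ (heig' j)
      · refine Fin.lastCases ?_ (fun j => ?_) j
        · intro h
          exact absurd (Fin.castSucc_lt_last k) (not_lt.2 h)
        · intro h
          simpa using hanti j k (Fin.castSucc_le_castSucc_iff.1 h)
    · intro j
      refine Fin.lastCases ?_ (fun j => ?_) j
      · simpa using hν
      · simpa using heig' j

variable {A : Type*} [AddCommGroup A] [Module ℂ A] {T : Module.End ℂ A} {P : Submodule ℂ A}

theorem aeval_apply_mem_of_invariant (hP : ∀ f ∈ P, T f ∈ P) (p : ℂ[X]) {f : A} (hf : f ∈ P) :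
    aeval T p f ∈ P := by
  induction p using Polynomial.induction_on' with
  | add p q hp hq =>
    rw [map_add, LinearMap.add_apply]
    exact P.add_mem hp hq
  | monomial k a =>
    rw [aeval_monomial, Module.End.mul_apply, Module.algebraMap_end_apply]
    refine P.smul_mem _ ?_
    induction k with
    | zero => simpa using hf
    | succ k ih =>
      rw [pow_succ', Module.End.mul_apply]
      exact hP _ ih

theorem mem_of_isCoprime_aeval_mem (hP : ∀ f ∈ P, T f ∈ P) {p q : ℂ[X]} (hpq : IsCoprime p q)
    {f : A} (hp : aeval T p f ∈ P) (hq : aeval T q f ∈ P) : f ∈ P := by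
  obtain ⟨a, b, hab⟩ := hpq
  have h : aeval T (a * p + b * q) f = f := by rw [hab, map_one, Module.End.one_apply]
  rw [← h, map_add, map_mul, map_mul, LinearMap.add_apply, Module.End.mul_apply,
    Module.End.mul_apply]
  exact P.add_mem (aeval_apply_mem_of_invariant hP a hp) (aeval_apply_mem_of_invariant hP b hq)

end LinearAlgebra

section GeneralizedEigenvectors
open Polynomial

variable {R : Type*} [CommRing R] [Algebra ℂ R]

/-- `f` is a generalized eigenvector of `T` for the eigenvalue `μ` modulo the subspace `Z`. -/
def IsGenEigenvectorMod (T : Module.End ℂ R) (Z : Submodule ℂ R) (μ : ℂ) (f : R) : Prop :=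
  ∃ N : ℕ, aeval T ((X - C μ) ^ N) f ∈ Z

variable {T : Module.End ℂ R} {Z : Submodule ℂ R}

theorem aeval_X_sub_C_apply (μ : ℂ) (f : R) : aeval T (X - C μ) f = T f - μ • f := by
  simp [Module.algebraMap_end_apply]

theorem aeval_X_sub_C_pow_succ_apply (μ : ℂ) (N : ℕ) (f : R) :
    aeval T ((X - C μ) ^ (N + 1)) f = aeval T ((X - C μ) ^ N) (T f - μ • f) := by
  rw [pow_succ, map_mul, Module.End.mul_apply, aeval_X_sub_C_apply]

theorem aeval_apply_comm (p : ℂ[X]) (f : R) : aeval T p (T f) = T (aeval T p f) := by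
  have h := (Commute.all p X).map (aeval T)
  rw [aeval_X] at h
  exact LinearMap.congr_fun h.eq f

theorem aeval_X_sub_C_pow_mul_mem (hT : ∀ f g, T (f * g) = T f * T g) (hZT : ∀ f ∈ Z, T f ∈ Z)
    (hZ : ∀ f ∈ Z, ∀ g, f * g ∈ Z) (μ ν : ℂ) (s : ℕ) :
    ∀ (N M : ℕ) (f g : R), N + M = s → aeval T ((X - C μ) ^ N) f ∈ Z →
      aeval T ((X - C ν) ^ M) g ∈ Z → aeval T ((X - C (μ * ν)) ^ (N + M)) (f * g) ∈ Z := by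
  induction s with
  | zero =>
    intro N M f g h hf hg
    obtain ⟨rfl, rfl⟩ : N = 0 ∧ M = 0 := by omega
    simp only [add_zero, pow_zero, map_one, Module.End.one_apply] at hf ⊢
    exact hZ f hf g
  | succ s ih =>
    intro N M f g h hf hg
    rcases N with _ | N
    · simp only [pow_zero, map_one, Module.End.one_apply] at hf
      exact aeval_apply_mem_of_invariant hZT _ (hZ f hf g)
    rcases M with _ | M
    · simp only [pow_zero, map_one, Module.End.one_apply] at hg
      refine aeval_apply_mem_of_invariant hZT _ ?_
      rw [mul_comm]
      exact hZ g hg f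
    have hsplit : T (f * g) - (μ * ν) • (f * g) =
        (T f - μ • f) * T g + μ • (f * (T g - ν • g)) := by
      rw [hT, sub_mul, mul_sub, smul_sub, mul_smul, mul_smul_comm, smul_mul_assoc]
      abel
    rw [show N + 1 + (M + 1) = (N + 1 + M) + 1 by omega, aeval_X_sub_C_pow_succ_apply, hsplit,
      map_add, map_smul]
    refine Z.add_mem ?_ (Z.smul_mem _ ?_)
    · have := ih N (M + 1) (T f - μ • f) (T g) (by omega)
        (by rwa [← aeval_X_sub_C_pow_succ_apply]) (by rw [aeval_apply_comm]; exact hZT _ hg)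
      rwa [show N + 1 + M = N + (M + 1) by omega]
    · exact ih (N + 1) M f (T g - ν • g) (by omega) hf (by rwa [← aeval_X_sub_C_pow_succ_apply])

namespace IsGenEigenvectorMod

theorem mul (hT : ∀ f g, T (f * g) = T f * T g) (hZT : ∀ f ∈ Z, T f ∈ Z)
    (hZ : ∀ f ∈ Z, ∀ g, f * g ∈ Z) {μ ν : ℂ} {f g : R} (hf : IsGenEigenvectorMod T Z μ f)
    (hg : IsGenEigenvectorMod T Z ν g) : IsGenEigenvectorMod T Z (μ * ν) (f * g) := by
  obtain ⟨N, hN⟩ := hf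
  obtain ⟨M, hM⟩ := hg
  exact ⟨N + M, aeval_X_sub_C_pow_mul_mem hT hZT hZ μ ν _ N M f g rfl hN hM⟩

theorem one (hT1 : T 1 = 1) : IsGenEigenvectorMod T Z 1 1 :=
  ⟨1, by simp [hT1]⟩

theorem pow (hT1 : T 1 = 1) (hT : ∀ f g, T (f * g) = T f * T g) (hZT : ∀ f ∈ Z, T f ∈ Z)
    (hZ : ∀ f ∈ Z, ∀ g, f * g ∈ Z) {μ : ℂ} {f : R} (hf : IsGenEigenvectorMod T Z μ f) (k : ℕ) :
    IsGenEigenvectorMod T Z (μ ^ k) (f ^ k) := by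
  induction k with
  | zero => simpa using one hT1
  | succ k ih =>
    rw [pow_succ, pow_succ]
    exact ih.mul hT hZT hZ hf

theorem prod (hT1 : T 1 = 1) (hT : ∀ f g, T (f * g) = T f * T g) (hZT : ∀ f ∈ Z, T f ∈ Z)
    (hZ : ∀ f ∈ Z, ∀ g, f * g ∈ Z) {ι : Type*} (s : Finset ι) (μ : ι → ℂ) (f : ι → R)
    (hf : ∀ i, IsGenEigenvectorMod T Z (μ i) (f i)) :
    IsGenEigenvectorMod T Z (∏ i ∈ s, μ i) (∏ i ∈ s, f i) := by
  classical
  induction s using Finset.induction_on with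
  | empty => simpa using one hT1
  | insert i s hi ih =>
    rw [Finset.prod_insert hi, Finset.prod_insert hi]
    exact (hf i).mul hT hZT hZ ih

theorem apply (hZT : ∀ f ∈ Z, T f ∈ Z) {μ : ℂ} {f : R} (hf : IsGenEigenvectorMod T Z μ f) :
    IsGenEigenvectorMod T Z μ (T f) := by
  obtain ⟨N, hN⟩ := hf
  exact ⟨N, by rw [aeval_apply_comm]; exact hZT _ hN⟩

theorem smul {μ : ℂ} {f : R} (c : ℂ) (hf : IsGenEigenvectorMod T Z μ f) :
    IsGenEigenvectorMod T Z μ (c • f) := by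
  obtain ⟨N, hN⟩ := hf
  exact ⟨N, by rw [map_smul]; exact Z.smul_mem _ hN⟩

theorem sub (hZT : ∀ f ∈ Z, T f ∈ Z) {μ : ℂ} {f g : R} (hf : IsGenEigenvectorMod T Z μ f)
    (hg : IsGenEigenvectorMod T Z μ g) : IsGenEigenvectorMod T Z μ (f - g) := by
  obtain ⟨N, hN⟩ := hf
  obtain ⟨M, hM⟩ := hg
  refine ⟨N + M, ?_⟩
  rw [map_sub]
  refine Z.sub_mem ?_ ?_
  · rw [pow_add, mul_comm, map_mul, Module.End.mul_apply]
    exact aeval_apply_mem_of_invariant hZT _ hN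
  · rw [pow_add, map_mul, Module.End.mul_apply]
    exact aeval_apply_mem_of_invariant hZT _ hM

theorem sum (hZT : ∀ f ∈ Z, T f ∈ Z) {ι : Type*} (s : Finset ι) {μ : ℂ} (f : ι → R)
    (hf : ∀ i ∈ s, IsGenEigenvectorMod T Z μ (f i)) :
    IsGenEigenvectorMod T Z μ (∑ i ∈ s, f i) := by
  classical
  induction s using Finset.induction_on with
  | empty => exact ⟨0, by simp⟩
  | insert i s hi ih =>
    rw [Finset.sum_insert hi]
    have h := ih fun k hk => hf k (Finset.mem_insert_of_mem hk)
    have := (hf i (Finset.mem_insert_self i s)).sub hZT (h.smul (-1))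
    simpa using this

/-- A sum of generalized eigenvectors for eigenvalues other than `ν` is annihilated, modulo `Z`,
by a polynomial of `T` prime to every power of `X - ν`. -/
theorem exists_isCoprime_aeval_sum_mem (hZT : ∀ f ∈ Z, T f ∈ Z) {ι : Type*} (s : Finset ι)
    (μ : ι → ℂ) (f : ι → R) (hf : ∀ i ∈ s, IsGenEigenvectorMod T Z (μ i) (f i)) (ν : ℂ)
    (hν : ∀ i ∈ s, μ i ≠ ν) :
    ∃ q : ℂ[X], (∀ N, IsCoprime q ((X - C ν) ^ N)) ∧ aeval T q (∑ i ∈ s, f i) ∈ Z := by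
  classical
  induction s using Finset.induction_on with
  | empty => exact ⟨1, fun N => isCoprime_one_left, by simp⟩
  | insert i s hi ih =>
    obtain ⟨q, hq, hqs⟩ := ih (fun k hk => hf k (Finset.mem_insert_of_mem hk))
      fun k hk => hν k (Finset.mem_insert_of_mem hk)
    obtain ⟨N, hN⟩ := hf i (Finset.mem_insert_self i s)
    refine ⟨(X - C (μ i)) ^ N * q, fun M => IsCoprime.mul_left ?_ (hq M), ?_⟩
    · exact (isCoprime_X_sub_C_of_isUnit_sub
        (sub_ne_zero.2 (hν i (Finset.mem_insert_self i s))).isUnit).pow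
    · rw [Finset.sum_insert hi, map_add]
      refine Z.add_mem ?_ ?_
      · rw [mul_comm, map_mul, Module.End.mul_apply]
        exact aeval_apply_mem_of_invariant hZT _ hN
      · rw [map_mul, Module.End.mul_apply]
        exact aeval_apply_mem_of_invariant hZT _ hqs

end IsGenEigenvectorMod

end GeneralizedEigenvectors

section Attraction
open Filter Topology Set

variable {E : Type*} [NormedAddCommGroup E] [NormedSpace ℂ E]

theorem exists_norm_pow_le_pow [CompleteSpace E] [Nontrivial E] (L : E →L[ℂ] E)
    (hL : ∀ μ ∈ spectrum ℂ L, ‖μ‖ < 1) :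
    ∃ (p : ℕ) (c : ℝ), 0 < p ∧ 0 < c ∧ c < 1 ∧ ‖L ^ p‖ ≤ c ^ p := by
  have hr : spectralRadius ℂ L < ((1 : NNReal) : ENNReal) :=
    spectrum.spectralRadius_lt_of_forall_lt L fun μ hμ => by
      rw [← NNReal.coe_lt_coe]
      simpa using hL μ hμ
  obtain ⟨c, hc0, hc, hc1⟩ := ENNReal.lt_iff_exists_real_btwn.1 hr
  have h := (spectrum.pow_norm_pow_one_div_tendsto_nhds_spectralRadius L).eventually_lt_const hc
  obtain ⟨p, hp, hp0⟩ := (h.and (eventually_gt_atTop 0)).exists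
  have hlt := (ENNReal.ofReal_lt_ofReal_iff_of_nonneg (by positivity)).1 hp
  have hcpos : 0 < c := lt_of_le_of_lt (by positivity) hlt
  refine ⟨p, c, hp0, hcpos, ?_, ?_⟩
  · have : ENNReal.ofReal c < ENNReal.ofReal 1 := by simpa using hc1
    exact (ENNReal.ofReal_lt_ofReal_iff_of_nonneg hc0).1 this
  · have := pow_le_pow_left₀ (by positivity) hlt.le p
    rwa [← Real.rpow_natCast, ← Real.rpow_mul (norm_nonneg _), one_div,
      inv_mul_cancel₀ (by positivity), Real.rpow_one] at this

/-- A norm-like function contracted by `L`, built from finitely many iterates. -/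
theorem exists_adapted_gauge (L : E →L[ℂ] E) {p : ℕ} {c : ℝ} (hp : 0 < p) (hc : 0 < c)
    (hLp : ‖L ^ p‖ ≤ c ^ p) :
    ∃ (N : E → ℝ) (K : ℝ), 0 < K ∧ Continuous N ∧ (∀ z, ‖z‖ ≤ N z) ∧ (∀ z, N z ≤ K * ‖z‖) ∧
      (∀ z w, N (z + w) ≤ N z + N w) ∧ ∀ z, N (L z) ≤ c * N z := by
  refine ⟨fun z => ∑ k ∈ Finset.range p, c⁻¹ ^ k * ‖(L ^ k) z‖,
    ∑ k ∈ Finset.range p, c⁻¹ ^ k * ‖L ^ k‖ + 1, by positivity, ?_, ?_, ?_, ?_, ?_⟩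
  · exact continuous_finsetSum _ fun k _ => ((L ^ k).continuous.norm).const_mul _
  · intro z
    have := Finset.single_le_sum (f := fun k => c⁻¹ ^ k * ‖(L ^ k) z‖)
      (fun k _ => by positivity) (Finset.mem_range.2 hp)
    simpa using this
  · intro z
    rw [add_mul, Finset.sum_mul]
    refine le_add_of_le_of_nonneg (Finset.sum_le_sum fun k _ => ?_) (by positivity)
    rw [mul_assoc]
    exact mul_le_mul_of_nonneg_left ((L ^ k).le_opNorm z) (by positivity)
  · intro z w
    rw [← Finset.sum_add_distrib]
    refine Finset.sum_le_sum fun k _ => ?_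
    rw [map_add, ← mul_add]
    exact mul_le_mul_of_nonneg_left (norm_add_le _ _) (by positivity)
  · intro z
    have hstep : ∀ k, c⁻¹ ^ k * ‖(L ^ k) (L z)‖ = c * (c⁻¹ ^ (k + 1) * ‖(L ^ (k + 1)) z‖) := by
      intro k
      rw [pow_succ L, mul_apply_eq_comp, pow_succ c⁻¹]
      field_simp
    simp only [hstep, ← Finset.mul_sum]
    refine mul_le_mul_of_nonneg_left ?_ hc.le
    have h1 := Finset.sum_range_succ (fun k => c⁻¹ ^ k * ‖(L ^ k) z‖) p
    have h2 := Finset.sum_range_succ' (fun k => c⁻¹ ^ k * ‖(L ^ k) z‖) p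
    have h3 : c⁻¹ ^ p * ‖(L ^ p) z‖ ≤ ‖z‖ := by
      calc c⁻¹ ^ p * ‖(L ^ p) z‖ ≤ c⁻¹ ^ p * (c ^ p * ‖z‖) := by
            gcongr
            exact (L ^ p).le_of_opNorm_le hLp z
        _ = ‖z‖ := by rw [← mul_assoc, ← mul_pow, inv_mul_cancel₀ hc.ne', one_pow, one_mul]
    simp only [pow_zero, one_mul, one_apply_eq_self] at h2
    linarith

/-- Near an attracting fixed point the iterates converge geometrically on arbitrarily small
forward-invariant neighbourhoods. -/
theorem exists_attracting_nhds [CompleteSpace E] [Nontrivial E] {F : E → E} {L : E →L[ℂ] E}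
    (hF0 : F 0 = 0) (hF : HasFDerivAt F L 0) (hL : ∀ μ ∈ spectrum ℂ L, ‖μ‖ < 1) :
    ∃ α C : ℝ, 0 < α ∧ α < 1 ∧ 0 < C ∧ ∀ W ∈ 𝓝 (0 : E), ∃ V : Set E, IsOpen V ∧ 0 ∈ V ∧ V ⊆ W ∧
      MapsTo F V V ∧ ∀ z ∈ V, ∀ k, ‖F^[k] z‖ ≤ C * α ^ k * ‖z‖ := by
  obtain ⟨p, c, hp, hc, hc1, hLp⟩ := exists_norm_pow_le_pow L hL
  obtain ⟨N, K, hK, hNc, hle, hNK, hadd, hNL⟩ := exists_adapted_gauge L hp hc hLp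
  have hlin : ∀ᶠ z in 𝓝 (0 : E), ‖F z - L z‖ ≤ (1 - c) / (2 * K) * ‖z‖ := by
    have := hF.isLittleO.def (c := (1 - c) / (2 * K)) (by have := sub_pos.2 hc1; positivity)
    simpa [hF0] using this
  refine ⟨(1 + c) / 2, K, by positivity, by linarith, hK, fun W hW => ?_⟩
  obtain ⟨ε, hε, hball⟩ := Metric.mem_nhds_iff.1 (inter_mem hlin hW)
  have hsub : ∀ z, N z < ε → z ∈ Metric.ball (0 : E) ε := fun z hz => by
    rw [mem_ball_zero_iff]
    exact (hle z).trans_lt hz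
  have hstep : ∀ z, N z < ε → N (F z) ≤ (1 + c) / 2 * N z := by
    intro z hz
    have h1 : ‖F z - L z‖ ≤ (1 - c) / (2 * K) * ‖z‖ := (hball (hsub z hz)).1
    calc N (F z) = N (L z + (F z - L z)) := by rw [add_sub_cancel]
      _ ≤ N (L z) + N (F z - L z) := hadd _ _
      _ ≤ c * N z + K * ((1 - c) / (2 * K) * N z) := by
          refine add_le_add (hNL z) ((hNK _).trans (mul_le_mul_of_nonneg_left (h1.trans ?_) hK.le))
          exact mul_le_mul_of_nonneg_left (hle z) (by have := sub_pos.2 hc1; positivity)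
      _ = (1 + c) / 2 * N z := by field_simp; ring
  have hN0 : ∀ z, 0 ≤ N z := fun z => (norm_nonneg z).trans (hle z)
  have hmaps : MapsTo F {z | N z < ε} {z | N z < ε} := fun z hz =>
    (hstep z hz).trans_lt ((mul_le_of_le_one_left (hN0 z) (by linarith)).trans_lt hz)
  refine ⟨{z | N z < ε}, isOpen_lt hNc continuous_const, ?_, fun z hz => (hball (hsub z hz)).2,
    hmaps, fun z hz k => ?_⟩
  · refine (hNK 0).trans_lt ?_
    rwa [norm_zero, mul_zero]
  · have hk : N (F^[k] z) ≤ ((1 + c) / 2) ^ k * N z := by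
      induction k with
      | zero => simp
      | succ k ih =>
        rw [Function.iterate_succ_apply', pow_succ']
        refine (hstep _ (hmaps.iterate k hz)).trans ?_
        rw [mul_assoc]
        exact mul_le_mul_of_nonneg_left ih (by positivity)
    calc ‖F^[k] z‖ ≤ ((1 + c) / 2) ^ k * N z := (hle _).trans hk
      _ ≤ ((1 + c) / 2) ^ k * (K * ‖z‖) := by gcongr; exact hNK z
      _ = K * ((1 + c) / 2) ^ k * ‖z‖ := by ring

end Attraction

section CompositionOperator
open Filter Topology Set Asymptotics

variable {E : Type*} [NormedAddCommGroup E]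

variable (E) in
/-- Functions vanishing near the origin. -/
def zeroNearOrigin : Submodule ℂ (E → ℂ) where
  carrier := {f | ∀ᶠ z in 𝓝 0, f z = 0}
  zero_mem' := Eventually.of_forall fun _ => rfl
  add_mem' {f g} hf hg := by
    filter_upwards [hf, hg] with z h1 h2
    rw [Pi.add_apply, h1, h2, add_zero]
  smul_mem' c f hf := by
    filter_upwards [hf] with z h
    rw [Pi.smul_apply, h, smul_zero]

theorem mem_zeroNearOrigin {f : E → ℂ} : f ∈ zeroNearOrigin E ↔ ∀ᶠ z in 𝓝 0, f z = 0 := Iff.rfl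

theorem mul_mem_zeroNearOrigin (f : E → ℂ) (hf : f ∈ zeroNearOrigin E) (g : E → ℂ) :
    f * g ∈ zeroNearOrigin E := by
  filter_upwards [hf] with z h
  rw [Pi.mul_apply, h, zero_mul]

theorem isBigO_norm_pow_of_le {k m : ℕ} (h : k ≤ m) :
    (fun z : E => ‖z‖ ^ m) =O[𝓝 0] fun z => ‖z‖ ^ k := by
  refine IsBigO.of_bound 1 ?_
  filter_upwards [Metric.ball_mem_nhds (0 : E) one_pos] with z hz
  rw [mem_ball_zero_iff] at hz
  rw [one_mul, Real.norm_of_nonneg (by positivity), Real.norm_of_nonneg (by positivity)]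
  exact pow_le_pow_of_le_one (norm_nonneg z) hz.le h

/-- Composition with `F`, as an operator on functions. -/
abbrev compositionOperator (F : E → E) : Module.End ℂ (E → ℂ) := LinearMap.funLeft ℂ ℂ F

theorem compositionOperator_mem_zeroNearOrigin {F : E → E} (hF0 : F 0 = 0) (hF : ContinuousAt F 0) :
    ∀ f ∈ zeroNearOrigin E, compositionOperator F f ∈ zeroNearOrigin E := by
  intro f hf
  have ht : Tendsto F (𝓝 0) (𝓝 0) := by simpa [ContinuousAt, hF0] using hF
  exact ht.eventually hf

variable [NormedSpace ℂ E]

variable (E) in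
/-- Functions holomorphic near the origin. -/
def holomorphicNearOrigin : Submodule ℂ (E → ℂ) where
  carrier := {f | ∀ᶠ z in 𝓝 0, DifferentiableAt ℂ f z}
  zero_mem' := Eventually.of_forall fun _ => differentiableAt_const _
  add_mem' {f g} hf hg := by
    filter_upwards [hf, hg] with z h1 h2
    exact h1.add h2
  smul_mem' c f hf := by
    filter_upwards [hf] with z h
    exact h.const_smul c

variable (E) in
/-- Functions holomorphic near the origin and vanishing there to order at least `m`. -/
def vanishingToOrder (m : ℕ) : Submodule ℂ (E → ℂ) where
  carrier := {f | f ∈ holomorphicNearOrigin E ∧ f =O[𝓝 0] fun z => ‖z‖ ^ m}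
  zero_mem' := ⟨Submodule.zero_mem _, isBigO_zero _ _⟩
  add_mem' hf hg := ⟨Submodule.add_mem _ hf.1 hg.1, hf.2.add hg.2⟩
  smul_mem' c _ hf := ⟨Submodule.smul_mem _ c hf.1, hf.2.const_smul_left c⟩

theorem mem_holomorphicNearOrigin {f : E → ℂ} :
    f ∈ holomorphicNearOrigin E ↔ ∀ᶠ z in 𝓝 0, DifferentiableAt ℂ f z := Iff.rfl

theorem zeroNearOrigin_le_vanishingToOrder (m : ℕ) :
    zeroNearOrigin E ≤ vanishingToOrder E m := by
  intro f hf
  have h0 : f =ᶠ[𝓝 0] fun _ => (0 : ℂ) := hf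
  refine ⟨?_, h0.trans_isBigO (isBigO_zero _ _)⟩
  filter_upwards [h0.eventuallyEq_nhds] with z hz
  exact (differentiableAt_const (0 : ℂ)).congr_of_eventuallyEq hz

theorem vanishingToOrder_anti {k m : ℕ} (h : k ≤ m) :
    vanishingToOrder E m ≤ vanishingToOrder E k :=
  fun _ hf => ⟨hf.1, hf.2.trans (isBigO_norm_pow_of_le h)⟩

variable {F : E → E}

theorem compositionOperator_mem_holomorphicNearOrigin (hF0 : F 0 = 0)
    (hF : ∀ᶠ z in 𝓝 0, DifferentiableAt ℂ F z) :
    ∀ f ∈ holomorphicNearOrigin E, compositionOperator F f ∈ holomorphicNearOrigin E := by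
  intro f hf
  have ht : Tendsto F (𝓝 0) (𝓝 0) := by
    simpa [ContinuousAt, hF0] using hF.self_of_nhds.continuousAt
  filter_upwards [hF, ht.eventually hf] with z h1 h2
  exact h2.comp z h1

theorem isBigO_norm_of_differentiableAt {G : Type*} [NormedAddCommGroup G] [NormedSpace ℂ G]
    {f : E → G} (hf : DifferentiableAt ℂ f 0) (hf0 : f 0 = 0) : f =O[𝓝 0] fun z => ‖z‖ := by
  have := hf.hasFDerivAt.isBigO_sub
  simp only [hf0, sub_zero] at this
  exact this.norm_right

theorem compositionOperator_mem_vanishingToOrder (hF0 : F 0 = 0)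
    (hF : ∀ᶠ z in 𝓝 0, DifferentiableAt ℂ F z) (m : ℕ) :
    ∀ f ∈ vanishingToOrder E m, compositionOperator F f ∈ vanishingToOrder E m := by
  intro f hf
  refine ⟨compositionOperator_mem_holomorphicNearOrigin hF0 hF f hf.1, ?_⟩
  have ht : Tendsto F (𝓝 0) (𝓝 0) := by
    simpa [ContinuousAt, hF0] using hF.self_of_nhds.continuousAt
  exact (hf.2.comp_tendsto ht).trans
    ((isBigO_norm_of_differentiableAt hF.self_of_nhds hF0).norm_left.pow m)

/-- The origin has arbitrarily small forward-invariant neighbourhoods on which the iterates of `F`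
converge to it at the geometric rate `α`. -/
def IsAttractingAtRate (F : E → E) (α C : ℝ) : Prop :=
  ∀ W ∈ 𝓝 (0 : E), ∃ V : Set E, IsOpen V ∧ 0 ∈ V ∧ V ⊆ W ∧
    MapsTo F V V ∧ ∀ z ∈ V, ∀ k, ‖F^[k] z‖ ≤ C * α ^ k * ‖z‖

namespace IsAttractingAtRate

variable {α C : ℝ} {m : ℕ} {ν : ℂ}

/-- The basic estimate along orbits for a function vanishing to order `m`. -/
theorem exists_bound (hC : 0 < C) (hF : IsAttractingAtRate F α C) {f : E → ℂ}
    (hf : f ∈ vanishingToOrder E m) {W : Set E} (hW : W ∈ 𝓝 0) :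
    ∃ (V : Set E) (B : ℝ), IsOpen V ∧ 0 ∈ V ∧ V ⊆ W ∧ MapsTo F V V ∧ 0 < B ∧
      ∀ z ∈ V, ∀ k, ‖f (F^[k] z)‖ ≤ B * (α ^ m) ^ k * ‖z‖ ^ m := by
  obtain ⟨B, hB, hbound⟩ := hf.2.exists_pos
  obtain ⟨V, hVo, hV0, hVW, hmaps, hit⟩ := hF _ (inter_mem hW hbound.bound)
  refine ⟨V, B * C ^ m, hVo, hV0, fun z hz => (hVW hz).1, hmaps, by positivity, fun z hz k => ?_⟩
  have h1 : ‖f (F^[k] z)‖ ≤ B * ‖‖F^[k] z‖ ^ m‖ := (hVW (hmaps.iterate k hz)).2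
  rw [Real.norm_of_nonneg (by positivity)] at h1
  calc ‖f (F^[k] z)‖ ≤ B * ‖F^[k] z‖ ^ m := h1
    _ ≤ B * (C * α ^ k * ‖z‖) ^ m := by gcongr; exact hit z hz k
    _ = B * C ^ m * (α ^ m) ^ k * ‖z‖ ^ m := by
        rw [mul_pow, mul_pow, ← pow_mul, ← pow_mul, mul_comm k m]; ring

theorem mem_zeroNearOrigin_of_sub_smul_mem (hα : 0 < α) (hC : 0 < C)
    (hF : IsAttractingAtRate F α C) (hν : α ^ m < ‖ν‖) {f : E → ℂ}
    (hf : f ∈ vanishingToOrder E m)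
    (h : compositionOperator F f - ν • f ∈ zeroNearOrigin E) : f ∈ zeroNearOrigin E := by
  obtain ⟨V, B, hVo, hV0, hVW, hmaps, hB, hbound⟩ := hF.exists_bound hC hf h
  have hν0 : 0 < ‖ν‖ := lt_trans (by positivity) hν
  filter_upwards [hVo.mem_nhds hV0] with z hz
  have hiter : ∀ k, f (F^[k] z) = ν ^ k * f z := by
    intro k
    induction k with
    | zero => simp
    | succ k ih =>
      have : f (F (F^[k] z)) - ν * f (F^[k] z) = 0 := hVW (hmaps.iterate k hz)
      rw [Function.iterate_succ_apply', sub_eq_zero.1 this, ih, pow_succ']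
      ring
  have hle : ∀ k, ‖f z‖ ≤ B * ‖z‖ ^ m * (α ^ m / ‖ν‖) ^ k := by
    intro k
    have := hbound z hz k
    rw [hiter, norm_mul, norm_pow] at this
    rw [div_pow, mul_div_assoc', le_div_iff₀ (by positivity)]
    linarith
  have hlim : Tendsto (fun k : ℕ => B * ‖z‖ ^ m * (α ^ m / ‖ν‖) ^ k) atTop (𝓝 0) := by
    simpa using (tendsto_pow_atTop_nhds_zero_of_lt_one (by positivity)
      ((div_lt_one hν0).2 hν)).const_mul (B * ‖z‖ ^ m)
  exact norm_le_zero_iff.1 (ge_of_tendsto' hlim hle)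

theorem exists_sub_smul_sub_mem [FiniteDimensional ℂ E] (hα : 0 < α) (hC : 0 < C)
    (hF : IsAttractingAtRate F α C) (hFd : ∀ᶠ z in 𝓝 0, DifferentiableAt ℂ F z)
    (hν : α ^ m < ‖ν‖) {f : E → ℂ} (hf : f ∈ vanishingToOrder E m) :
    ∃ h ∈ vanishingToOrder E m, compositionOperator F h - ν • h - f ∈ zeroNearOrigin E := by
  have hν0 : 0 < ‖ν‖ := lt_trans (by positivity) hν
  have hν1 : ν ≠ 0 := norm_pos_iff.1 hν0
  set ρ : ℝ := α ^ m / ‖ν‖ with hρ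
  have hρ0 : 0 ≤ ρ := by positivity
  have hρ1 : ρ < 1 := (div_lt_one hν0).2 hν
  obtain ⟨V, B, hVo, hV0, hVW, hmaps, hB, hbound⟩ := hF.exists_bound hC hf
    (inter_mem (inter_mem hf.1 hFd) (Metric.ball_mem_nhds (0 : E) one_pos))
  set t : ℕ → E → ℂ := fun k z => (ν ^ (k + 1))⁻¹ * f (F^[k] z) with ht
  have htb : ∀ k, ∀ z ∈ V, ‖t k z‖ ≤ B * ‖ν‖⁻¹ * ρ ^ k * ‖z‖ ^ m := by
    intro k z hz
    calc ‖t k z‖ = (‖ν‖ ^ (k + 1))⁻¹ * ‖f (F^[k] z)‖ := by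
          rw [ht, norm_mul, norm_inv, norm_pow]
      _ ≤ (‖ν‖ ^ (k + 1))⁻¹ * (B * (α ^ m) ^ k * ‖z‖ ^ m) := by gcongr; exact hbound z hz k
      _ = B * ‖ν‖⁻¹ * ρ ^ k * ‖z‖ ^ m := by
          rw [hρ, div_pow, pow_succ, mul_inv]; ring
  have hsum : ∀ c d : ℝ, Summable fun k : ℕ => c * ρ ^ k * d := fun c d =>
    ((summable_geometric_of_lt_one hρ0 hρ1).mul_left c).mul_right d
  have htb1 : ∀ k, ∀ z ∈ V, ‖t k z‖ ≤ B * ‖ν‖⁻¹ * ρ ^ k * 1 := by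
    intro k z hz
    have hz1 : ‖z‖ < 1 := mem_ball_zero_iff.1 (hVW hz).2
    refine (htb k z hz).trans ?_
    gcongr
    exact pow_le_one₀ (norm_nonneg z) hz1.le
  have hdiff : DifferentiableOn ℂ F V := fun z hz => (hVW hz).1.2.differentiableWithinAt
  have hfd : DifferentiableOn ℂ f V := fun z hz => (hVW hz).1.1.differentiableWithinAt
  have htd : ∀ k, DifferentiableOn ℂ (t k) V := fun k =>
    (hfd.comp (hdiff.iterate hmaps k) (hmaps.iterate k)).const_mul _
  have hunif := tendstoUniformlyOn_tsum_nat (hsum (B * ‖ν‖⁻¹) 1) htb1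
  have hsumd : DifferentiableOn ℂ (fun z => ∑' k, t k z) V :=
    hunif.differentiableOn_complex hVo fun N => DifferentiableOn.fun_sum fun k _ => htd k
  have hts : ∀ z ∈ V, Summable fun k => t k z := fun z hz =>
    Summable.of_norm_bounded (hsum (B * ‖ν‖⁻¹) 1) fun k => htb1 k z hz
  refine ⟨-fun z => ∑' k, t k z, Submodule.neg_mem _ ⟨?_, ?_⟩, ?_⟩
  · filter_upwards [hVo.mem_nhds hV0] with z hz
    exact hsumd.differentiableAt (hVo.mem_nhds hz)
  · refine IsBigO.of_bound (∑' k, B * ‖ν‖⁻¹ * ρ ^ k) ?_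
    filter_upwards [hVo.mem_nhds hV0] with z hz
    rw [Real.norm_of_nonneg (by positivity), ← tsum_mul_right]
    exact tsum_of_norm_bounded (hsum _ _).hasSum fun k => htb k z hz
  · filter_upwards [hVo.mem_nhds hV0] with z hz
    have hshift : ∀ k, t k (F z) = ν * t (k + 1) z := by
      intro k
      simp only [ht]
      rw [← Function.iterate_succ_apply, pow_succ' ν (k + 1)]
      field_simp
    have h0 := (hts z hz).tsum_eq_zero_add
    have h1 : ν * t 0 z = f z := by
      simp only [ht, zero_add, pow_one, Function.iterate_zero_apply]
      field_simp
    have h2 : ∑' k, t k (F z) = ν * ∑' k, t (k + 1) z := by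
      simp only [hshift, tsum_mul_left]
    simp only [Pi.sub_apply, Pi.smul_apply, Pi.neg_apply, LinearMap.funLeft_apply, smul_eq_mul]
    rw [h2, h0, ← h1]
    ring

end IsAttractingAtRate

end CompositionOperator

section GeneralizedEigenfunctions
open Filter Topology Set Asymptotics Polynomial

theorem mem_vanishingToOrder_two {E : Type*} [NormedAddCommGroup E] [NormedSpace ℂ E]
    {f : E → ℂ} (hf : f ∈ holomorphicNearOrigin E) (hf0 : f 0 = 0)
    (hf' : HasFDerivAt f (0 : E →L[ℂ] ℂ) 0) : f ∈ vanishingToOrder E 2 := by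
  refine ⟨hf, ?_⟩
  have hsmall : ∀ᶠ z in 𝓝 (0 : E), ‖f z‖ < 1 :=
    hf'.continuousAt.norm.eventually_lt_const (by simp [hf0])
  obtain ⟨r, hr, hball⟩ := Metric.eventually_nhds_iff_ball.1
    ((mem_holomorphicNearOrigin.1 hf).and hsmall)
  have hd : DifferentiableOn ℂ f (Metric.ball 0 r) := fun z hz =>
    (hball z hz).1.differentiableWithinAt
  refine IsBigO.of_bound (1 / r ^ 2) ?_
  filter_upwards [Metric.ball_mem_nhds (0 : E) hr] with z hz
  have := Complex.dist_le_mul_div_pow_of_mapsTo_ball_of_isLittleO (n := 1) (R₂ := 1) hd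
    (fun w hw => by simpa [hf0] using (hball w hw).2.le)
    (by simpa [hf0] using hf'.isLittleO.norm_right) hz
  rw [hf0, dist_zero_right, dist_zero_right] at this
  rw [Real.norm_of_nonneg (by positivity)]
  exact this.trans_eq (by rw [div_pow]; ring)

theorem apply_zero_of_mem_vanishingToOrder {E : Type*} [NormedAddCommGroup E] [NormedSpace ℂ E]
    {m : ℕ} (hm : m ≠ 0) {f : E → ℂ} (hf : f ∈ vanishingToOrder E m) : f 0 = 0 :=
  IsBigO.eq_zero_of_norm_pow (x₀ := (0 : E)) (n := m) (by simpa using hf.2) hm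

theorem hasFDerivAt_of_mem_vanishingToOrder_two {E : Type*} [NormedAddCommGroup E]
    [NormedSpace ℂ E] {f : E → ℂ} (hf : f ∈ vanishingToOrder E 2) :
    HasFDerivAt f (0 : E →L[ℂ] ℂ) 0 :=
  IsBigO.hasFDerivAt (x₀ := (0 : E)) (n := 2) (by simpa using hf.2) one_lt_two

namespace IsAttractingAtRate

variable {E : Type*} [NormedAddCommGroup E] [NormedSpace ℂ E] {F : E → E} {α C : ℝ} {m : ℕ} {ν : ℂ}

theorem mem_zeroNearOrigin_of_aeval_mem (hα : 0 < α) (hC : 0 < C)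
    (hF : IsAttractingAtRate F α C) (hF0 : F 0 = 0) (hFd : ∀ᶠ z in 𝓝 0, DifferentiableAt ℂ F z)
    (hν : α ^ m < ‖ν‖) (N : ℕ) {f : E → ℂ} (hf : f ∈ vanishingToOrder E m)
    (h : aeval (compositionOperator F) ((X - Polynomial.C ν) ^ N) f ∈ zeroNearOrigin E) :
    f ∈ zeroNearOrigin E := by
  induction N generalizing f with
  | zero => simpa using h
  | succ N ih =>
    rw [aeval_X_sub_C_pow_succ_apply] at h
    refine hF.mem_zeroNearOrigin_of_sub_smul_mem hα hC hν hf (ih ?_ h)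
    exact Submodule.sub_mem _ (compositionOperator_mem_vanishingToOrder hF0 hFd m f hf)
      (Submodule.smul_mem _ _ hf)

theorem exists_aeval_sub_mem [FiniteDimensional ℂ E] (hα : 0 < α) (hC : 0 < C)
    (hF : IsAttractingAtRate F α C) (hF0 : F 0 = 0) (hFd : ∀ᶠ z in 𝓝 0, DifferentiableAt ℂ F z)
    (hν : α ^ m < ‖ν‖) (N : ℕ) {f : E → ℂ} (hf : f ∈ vanishingToOrder E m) :
    ∃ h ∈ vanishingToOrder E m,
      aeval (compositionOperator F) ((X - Polynomial.C ν) ^ N) h - f ∈ zeroNearOrigin E := by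
  induction N with
  | zero => exact ⟨f, hf, by simp⟩
  | succ N ih =>
    obtain ⟨g, hg, hgf⟩ := ih
    obtain ⟨h, hh, hhg⟩ := hF.exists_sub_smul_sub_mem hα hC hFd hν hg
    refine ⟨h, hh, ?_⟩
    have hZT := compositionOperator_mem_zeroNearOrigin hF0 hFd.self_of_nhds.continuousAt
    have := Submodule.add_mem _
      (aeval_apply_mem_of_invariant hZT ((X - Polynomial.C ν) ^ N) hhg) hgf
    rwa [map_sub, sub_add_sub_cancel, ← aeval_X_sub_C_pow_succ_apply] at this

end IsAttractingAtRate

theorem mem_spectrum_of_hasEigenvalue_dualMap {E : Type*} [NormedAddCommGroup E] [NormedSpace ℂ E]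
    (L : E →L[ℂ] E) {ν : ℂ}
    (hν : Module.End.HasEigenvalue ((L : E →ₗ[ℂ] E).dualMap : Module.End ℂ (Module.Dual ℂ E)) ν) :
    ν ∈ spectrum ℂ L := by
  intro hunit
  obtain ⟨x, hx⟩ := hν.exists_hasEigenvector
  refine hx.2 (LinearMap.ext fun z => ?_)
  obtain ⟨u, hu⟩ := hunit
  have hz : (algebraMap ℂ (E →L[ℂ] E) ν - L) ((↑u⁻¹ : E →L[ℂ] E) z) = z := by
    rw [← hu, ← mul_apply_eq_comp, Units.mul_inv, one_apply_eq_self]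
  have happ := LinearMap.congr_fun hx.apply_eq_smul ((↑u⁻¹ : E →L[ℂ] E) z)
  rw [LinearMap.zero_apply, ← hz, sub_apply, map_sub, sub_eq_zero, Algebra.algebraMap_eq_smul_one,
    smul_apply, one_apply_eq_self, map_smul]
  exact happ.symm

section Linear

variable {E : Type*} [NormedAddCommGroup E] [NormedSpace ℂ E] [FiniteDimensional ℂ E] {F : E → E}

/-- Modulo quadratic terms, composition with `F` acts on linear forms as the transpose of `dF₀`. -/
theorem compositionOperator_sub_dualMap_mem (hF0 : F 0 = 0)
    (hFd : ∀ᶠ z in 𝓝 0, DifferentiableAt ℂ F z) (l : Module.Dual ℂ E) :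
    compositionOperator F l - ⇑((fderiv ℂ F 0 : E →ₗ[ℂ] E).dualMap l) ∈ vanishingToOrder E 2 := by
  let l' : E →L[ℂ] ℂ := LinearMap.toContinuousLinearMap l
  have hl : HasFDerivAt (fun z => l' (F z) - l' (fderiv ℂ F 0 z)) (0 : E →L[ℂ] ℂ) 0 := by
    have h := (l'.hasFDerivAt.comp (0 : E) hFd.self_of_nhds.hasFDerivAt).sub
      (l'.comp (fderiv ℂ F 0)).hasFDerivAt
    rw [sub_self] at h
    exact h
  refine mem_vanishingToOrder_two ?_ ?_ hl
  · filter_upwards [hFd] with z hz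
    exact (l'.differentiableAt.comp z hz).sub (l'.comp (fderiv ℂ F 0)).differentiableAt
  · simp [LinearMap.funLeft_apply, hF0]

theorem aeval_compositionOperator_mem_of_dualMap_pow_eq_zero (hF0 : F 0 = 0)
    (hFd : ∀ᶠ z in 𝓝 0, DifferentiableAt ℂ F z) (ν : ℂ) (N : ℕ) (l : Module.Dual ℂ E)
    (hl : (((fderiv ℂ F 0 : E →ₗ[ℂ] E).dualMap - ν • (1 : Module.End ℂ (Module.Dual ℂ E))) ^ N) l
      = 0) :
    aeval (compositionOperator F) ((X - Polynomial.C ν) ^ N) (l : E → ℂ) ∈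
      vanishingToOrder E 2 := by
  induction N generalizing l with
  | zero =>
    have : l = 0 := by simpa using hl
    rw [this]
    exact aeval_apply_mem_of_invariant
      (compositionOperator_mem_vanishingToOrder hF0 hFd 2) _ (Submodule.zero_mem _)
  | succ N ih =>
    rw [pow_succ, Module.End.mul_apply] at hl
    have h := Submodule.add_mem _ (ih _ hl) (aeval_apply_mem_of_invariant
      (compositionOperator_mem_vanishingToOrder hF0 hFd 2) ((X - Polynomial.C ν) ^ N)
      (compositionOperator_sub_dualMap_mem hF0 hFd l))
    rw [← map_add] at h
    rw [aeval_X_sub_C_pow_succ_apply]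
    convert h using 2
    ext z
    simp

end Linear

section Euclidean

variable {n : ℕ}

theorem norm_prod_pow_le (w : EuclideanSpace ℂ (Fin n)) (d : Fin n →₀ ℕ) :
    ‖∏ i, w i ^ d i‖ ≤ ‖w‖ ^ d.degree := by
  rw [Finsupp.degree_eq_sum, ← Finset.prod_pow_eq_pow_sum, norm_prod]
  refine Finset.prod_le_prod (fun i _ => norm_nonneg _) fun i _ => ?_
  rw [norm_pow]
  exact pow_le_pow_left₀ (norm_nonneg _) (PiLp.norm_apply_le w i) _

theorem prod_pow_mem_vanishingToOrder (d : Fin n →₀ ℕ) :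
    (fun w : EuclideanSpace ℂ (Fin n) => ∏ i, w i ^ d i) ∈
      vanishingToOrder (EuclideanSpace ℂ (Fin n)) d.degree := by
  refine ⟨Eventually.of_forall fun w => ?_, IsBigO.of_bound 1 (Eventually.of_forall fun w => ?_)⟩
  · have := differentiable_mvPolynomial_eval (MvPolynomial.monomial d 1) w
    simpa [MvPolynomial.eval_monomial, Finsupp.prod_fintype] using this
  · rw [one_mul, Real.norm_of_nonneg (by positivity)]
    exact norm_prod_pow_le w d

/-- Modulo functions vanishing to order `m`, the iterated images of a holomorphic germ span a
finite-dimensional space. -/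
theorem exists_aeval_mem_vanishingToOrder
    {F : EuclideanSpace ℂ (Fin n) → EuclideanSpace ℂ (Fin n)} (hF0 : F 0 = 0)
    (hFd : ∀ᶠ z in 𝓝 0, DifferentiableAt ℂ F z) (m : ℕ) {f : EuclideanSpace ℂ (Fin n) → ℂ}
    (hf : f ∈ holomorphicNearOrigin (EuclideanSpace ℂ (Fin n))) :
    ∃ q : ℂ[X], q ≠ 0 ∧ aeval (compositionOperator F) q f ∈ vanishingToOrder _ m := by
  set Y := vanishingToOrder (EuclideanSpace ℂ (Fin n)) m with hY
  set D : Set (Fin n →₀ ℕ) := {d | d.degree ≤ m}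
  let mon : (Fin n →₀ ℕ) → (_ ⧸ Y) := fun d =>
    Y.mkQ fun w : EuclideanSpace ℂ (Fin n) => ∏ i, w i ^ d i
  have hfin : FiniteDimensional ℂ (Submodule.span ℂ (mon '' D)) :=
    FiniteDimensional.span_of_finite ℂ ((Finsupp.finite_of_degree_le m).image _)
  have hspan : ∀ g ∈ holomorphicNearOrigin (EuclideanSpace ℂ (Fin n)),
      Y.mkQ g ∈ Submodule.span ℂ (mon '' D) := by
    intro g hg
    obtain ⟨p, hp⟩ := exists_mvPolynomial_sub_isBigO m g hg
    have hgp : Y.mkQ g = Y.mkQ fun w => MvPolynomial.eval w.ofLp p := by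
      rw [← sub_eq_zero, ← map_sub, Submodule.mkQ_apply, Submodule.Quotient.mk_eq_zero]
      exact ⟨Submodule.sub_mem _ hg
        (Eventually.of_forall (differentiable_mvPolynomial_eval p)), hp⟩
    have hsum : (fun w : EuclideanSpace ℂ (Fin n) => MvPolynomial.eval w.ofLp p) =
        ∑ d ∈ p.support, MvPolynomial.coeff d p •
          fun w : EuclideanSpace ℂ (Fin n) => ∏ i, w i ^ d i := by
      ext w
      simp [MvPolynomial.eval_eq', Finset.sum_apply]
    rw [hgp, hsum, map_sum]
    refine Submodule.sum_mem _ fun d _ => ?_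
    rw [map_smul]
    refine Submodule.smul_mem _ _ ?_
    by_cases hd : d.degree ≤ m
    · exact Submodule.subset_span ⟨d, hd, rfl⟩
    · have : Y.mkQ (fun w : EuclideanSpace ℂ (Fin n) => ∏ i, w i ^ d i) = 0 := by
        rw [Submodule.mkQ_apply, Submodule.Quotient.mk_eq_zero]
        exact vanishingToOrder_anti (not_le.1 hd).le (prod_pow_mem_vanishingToOrder d)
      rw [this]
      exact Submodule.zero_mem _
  let Φ : ℂ[X] →ₗ[ℂ] Submodule.span ℂ (mon '' D) :=
    (Y.mkQ ∘ₗ (LinearMap.applyₗ f) ∘ₗ (aeval (compositionOperator F)).toLinearMap).codRestrict _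
      fun q => hspan _ (aeval_apply_mem_of_invariant
        (compositionOperator_mem_holomorphicNearOrigin hF0 hFd) q hf)
  have hΦ : ¬ Function.Injective Φ := fun h =>
    Polynomial.not_finite (R := ℂ) (FiniteDimensional.of_injective Φ h)
  rw [injective_iff_map_eq_zero] at hΦ
  push Not at hΦ
  obtain ⟨q, hq, hq0⟩ := hΦ
  refine ⟨q, hq0, ?_⟩
  have : Y.mkQ (aeval (compositionOperator F) q f) = 0 := congrArg Subtype.val hq
  rwa [Submodule.mkQ_apply, Submodule.Quotient.mk_eq_zero] at this

/-- A generalized eigenfunction modulo quadratic terms can be corrected to a genuine one. -/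
theorem IsAttractingAtRate.exists_isGenEigenvectorMod
    {F : EuclideanSpace ℂ (Fin n) → EuclideanSpace ℂ (Fin n)} {α C : ℝ} (hα : 0 < α) (hC : 0 < C)
    (hF : IsAttractingAtRate F α C) (hF0 : F 0 = 0) (hFd : ∀ᶠ z in 𝓝 0, DifferentiableAt ℂ F z)
    {m : ℕ} (hm : 2 ≤ m) {ν : ℂ} (hν : α ^ m < ‖ν‖) {f : EuclideanSpace ℂ (Fin n) → ℂ}
    (hf : f ∈ holomorphicNearOrigin _)
    (hgen : IsGenEigenvectorMod (compositionOperator F) (vanishingToOrder _ 2) ν f) :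
    ∃ g, g - f ∈ vanishingToOrder _ 2 ∧
      IsGenEigenvectorMod (compositionOperator F) (zeroNearOrigin _) ν g := by
  obtain ⟨N, hN⟩ := hgen
  obtain ⟨q, hq0, hq⟩ := exists_aeval_mem_vanishingToOrder hF0 hFd m hf
  obtain ⟨r, hqr, hr⟩ := exists_eq_pow_rootMultiplicity_mul_and_not_dvd q hq0 ν
  set M := rootMultiplicity ν q
  obtain ⟨a, b, hab⟩ : IsCoprime r ((X - Polynomial.C ν) ^ N) :=
    (((irreducible_X_sub_C ν).coprime_iff_not_dvd.2 hr).symm).pow_right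
  have hY2 := compositionOperator_mem_vanishingToOrder hF0 hFd 2
  have hYm := compositionOperator_mem_vanishingToOrder hF0 hFd m
  have hfa : aeval (compositionOperator F) ((X - Polynomial.C ν) ^ M)
      (aeval (compositionOperator F) (a * r) f) ∈ vanishingToOrder _ m := by
    rw [← Module.End.mul_apply, ← map_mul,
      show (X - Polynomial.C ν) ^ M * (a * r) = a * q by rw [hqr]; ring, map_mul,
      Module.End.mul_apply]
    exact aeval_apply_mem_of_invariant hYm a hq
  obtain ⟨h, hh, hhf⟩ := hF.exists_aeval_sub_mem hα hC hF0 hFd hν M hfa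
  refine ⟨aeval (compositionOperator F) (a * r) f - h, ?_, M, ?_⟩
  · have hfsplit : f = aeval (compositionOperator F) (a * r) f +
        aeval (compositionOperator F) (b * (X - Polynomial.C ν) ^ N) f := by
      rw [← LinearMap.add_apply, ← map_add, hab, map_one, Module.End.one_apply]
    have h2 : aeval (compositionOperator F) (b * (X - Polynomial.C ν) ^ N) f ∈
        vanishingToOrder _ 2 := by
      rw [map_mul, Module.End.mul_apply]
      exact aeval_apply_mem_of_invariant hY2 b hN
    have h3 := Submodule.neg_mem _ (Submodule.add_mem _ h2 (vanishingToOrder_anti hm hh))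
    convert h3 using 1
    nth_rewrite 2 [hfsplit]
    abel
  · rw [map_sub, ← neg_sub]
    exact Submodule.neg_mem _ hhf

end Euclidean

end GeneralizedEigenfunctions

section LocalCoordinates
open Filter Topology Set Asymptotics

/-- The holomorphic inverse function theorem, with holomorphy of both directions. -/
theorem exists_openPartialHomeomorph_of_bijective {E : Type*} [NormedAddCommGroup E]
    [NormedSpace ℂ E] [FiniteDimensional ℂ E] {f : E → E} {a : E}
    (hf : ∀ᶠ z in 𝓝 a, DifferentiableAt ℂ f z) (hinj : Function.Injective (fderiv ℂ f a)) :
    ∃ e : OpenPartialHomeomorph E E, ⇑e = f ∧ a ∈ e.source ∧ DifferentiableOn ℂ f e.source ∧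
      DifferentiableOn ℂ e.symm e.target := by
  have : CompleteSpace E := FiniteDimensional.complete ℂ E
  obtain ⟨O, hO, hOo, haO⟩ := eventually_nhds_iff.1 hf
  have hdO : DifferentiableOn ℂ f O := fun z hz => (hO z hz).differentiableWithinAt
  have hC1 : ContDiffAt ℂ 1 f a :=
    (hdO.contDiffOn_complex_one hOo).contDiffAt (hOo.mem_nhds haO)
  let L : E ≃L[ℂ] E := (LinearEquiv.ofInjectiveEndo (fderiv ℂ f a : E →ₗ[ℂ] E)
    hinj).toContinuousLinearEquiv
  have hL : HasFDerivAt f (L : E →L[ℂ] E) a := by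
    have : (L : E →L[ℂ] E) = fderiv ℂ f a := by
      ext v
      rfl
    rw [this]
    exact hf.self_of_nhds.hasFDerivAt
  set e := hC1.toOpenPartialHomeomorph f hL one_ne_zero with he
  have hef : ⇑e = f := hC1.toOpenPartialHomeomorph_coe hL one_ne_zero
  have hsymm : ContDiffAt ℂ 1 e.symm (f a) := hC1.to_localInverse hL one_ne_zero
  have hsd : ∀ᶠ w in 𝓝 (f a), DifferentiableAt ℂ e.symm w := by
    filter_upwards [hsymm.eventually (by simp)] with w hw
    exact hw.differentiableAt one_ne_zero
  obtain ⟨O', hO', hOo', haO'⟩ := eventually_nhds_iff.1 hsd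
  have hae : a ∈ e.source := hC1.mem_toOpenPartialHomeomorph_source hL one_ne_zero
  have hpre : IsOpen (e.source ∩ f ⁻¹' O') := by
    rw [← hef]
    exact e.isOpen_inter_preimage hOo'
  refine ⟨e.restrOpen (O ∩ (e.source ∩ f ⁻¹' O')) (hOo.inter hpre), hef, ?_, ?_, ?_⟩
  · exact ⟨hae, haO, hae, haO'⟩
  · exact hdO.mono fun z hz => hz.2.1
  · intro w hw
    have h1 : w ∈ e.target := hw.1
    have h2 : f (e.symm w) ∈ O' := hw.2.2.2
    rw [← hef, e.right_inv h1] at h2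
    exact (hO' w h2).differentiableWithinAt

variable {n : ℕ}

theorem eventually_differentiableAt_toLp {ψ : Fin n → EuclideanSpace ℂ (Fin n) → ℂ}
    (hψ : ∀ j, ψ j ∈ holomorphicNearOrigin (EuclideanSpace ℂ (Fin n))) :
    ∀ᶠ z in 𝓝 0, DifferentiableAt ℂ
      (fun z => (WithLp.toLp 2 fun j => ψ j z : EuclideanSpace ℂ (Fin n))) z := by
  filter_upwards [eventually_all.2 hψ] with z hz
  exact differentiableAt_euclidean.2 hz

theorem injective_fderiv_toLp {ψ : Fin n → EuclideanSpace ℂ (Fin n) → ℂ}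
    (hψ : ∀ j, ψ j ∈ holomorphicNearOrigin (EuclideanSpace ℂ (Fin n)))
    {l : Fin n → Module.Dual ℂ (EuclideanSpace ℂ (Fin n))} (hl : LinearIndependent ℂ l)
    (hd : ∀ j, HasFDerivAt (ψ j) (LinearMap.toContinuousLinearMap (l j)) 0) :
    Function.Injective (fderiv ℂ
      (fun z => (WithLp.toLp 2 fun j => ψ j z : EuclideanSpace ℂ (Fin n))) 0) := by
  rw [injective_iff_map_eq_zero]
  intro v hv
  have hcoord : ∀ j, l j v = 0 := by
    intro j
    have h1 := ((EuclideanSpace.proj j : EuclideanSpace ℂ (Fin n) →L[ℂ] ℂ).hasFDerivAt).comp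
      (0 : EuclideanSpace ℂ (Fin n))
      (eventually_differentiableAt_toLp hψ).self_of_nhds.hasFDerivAt
    have h2 := ContinuousLinearMap.ext_iff.1 ((hd j).unique h1) v
    rw [ContinuousLinearMap.comp_apply, hv, map_zero] at h2
    exact h2
  refine (Module.forall_dual_apply_eq_zero_iff ℂ v).1 fun φ => ?_
  have hspan := hl.span_eq_top_of_card_eq_finrank' (by
    rw [Subspace.dual_finrank_eq, finrank_euclideanSpace])
  have hφ : φ ∈ Submodule.span ℂ (range l) := by
    rw [hspan]
    trivial
  induction hφ using Submodule.span_induction with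
  | mem x hx =>
    obtain ⟨j, rfl⟩ := hx
    exact hcoord j
  | zero => rfl
  | add x y _ _ hx hy => rw [LinearMap.add_apply, hx, hy, add_zero]
  | smul c x _ hx => rw [LinearMap.smul_apply, hx, smul_zero]

end LocalCoordinates

section ResonantPolynomials
open Filter Topology Set Asymptotics Polynomial

variable {n : ℕ}

/-- In coordinates `ψ` made of generalized eigenfunctions, a generalized eigenfunction is a
polynomial all of whose monomials are resonant. -/
theorem IsAttractingAtRate.exists_resonant_mvPolynomial
    {F : EuclideanSpace ℂ (Fin n) → EuclideanSpace ℂ (Fin n)} {α C : ℝ} (hα : 0 < α) (hC : 0 < C)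
    (hF : IsAttractingAtRate F α C) (hF0 : F 0 = 0) (hFd : ∀ᶠ z in 𝓝 0, DifferentiableAt ℂ F z)
    {m : ℕ} {ψ : Fin n → EuclideanSpace ℂ (Fin n) → ℂ} {μ : Fin n → ℂ}
    (hψ : ∀ j, IsGenEigenvectorMod (compositionOperator F) (zeroNearOrigin _) (μ j) (ψ j))
    (e : OpenPartialHomeomorph (EuclideanSpace ℂ (Fin n)) (EuclideanSpace ℂ (Fin n)))
    (he : ∀ z j, e z j = ψ j z) (he0 : e 0 = 0) (he0s : 0 ∈ e.source)
    (hed : DifferentiableOn ℂ e e.source) (hesd : DifferentiableOn ℂ e.symm e.target)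
    {ν : ℂ} (hν : α ^ m < ‖ν‖) {f : EuclideanSpace ℂ (Fin n) → ℂ}
    (hf : f ∈ holomorphicNearOrigin _)
    (hfν : IsGenEigenvectorMod (compositionOperator F) (zeroNearOrigin _) ν f) :
    ∃ p : MvPolynomial (Fin n) ℂ, (∀ d ∈ p.support, ∏ i, μ i ^ d i = ν) ∧
      ∀ᶠ z in 𝓝 0, f z = MvPolynomial.eval (fun j => ψ j z) p := by
  classical
  have hFc := hFd.self_of_nhds.continuousAt
  have hZT := compositionOperator_mem_zeroNearOrigin hF0 hFc
  have hYT := compositionOperator_mem_vanishingToOrder hF0 hFd m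
  have hT : ∀ f g : EuclideanSpace ℂ (Fin n) → ℂ, compositionOperator F (f * g) =
      compositionOperator F f * compositionOperator F g := fun f g => rfl
  have hT1 : compositionOperator F (1 : EuclideanSpace ℂ (Fin n) → ℂ) = 1 := rfl
  have hed0 : ∀ᶠ z in 𝓝 0, DifferentiableAt ℂ e z := by
    filter_upwards [e.open_source.mem_nhds he0s] with z hz
    exact hed.differentiableAt (e.open_source.mem_nhds hz)
  have he0t : (0 : EuclideanSpace ℂ (Fin n)) ∈ e.target := he0 ▸ e.map_source he0s
  have hs0 : e.symm 0 = 0 := by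
    conv_lhs => rw [← he0, e.left_inv he0s]
  have hsc : Tendsto e.symm (𝓝 0) (𝓝 0) := by
    simpa [ContinuousAt, hs0] using e.symm.continuousAt he0t
  have hec : Tendsto e (𝓝 0) (𝓝 0) := by
    simpa [ContinuousAt, he0] using e.continuousAt he0s
  obtain ⟨p, hp⟩ := exists_mvPolynomial_sub_isBigO m (f ∘ e.symm) (by
    filter_upwards [e.open_target.mem_nhds he0t, hsc.eventually hf] with w hw hfw
    exact hfw.comp w (hesd.differentiableAt (e.open_target.mem_nhds hw)))
  let mon : (Fin n →₀ ℕ) → EuclideanSpace ℂ (Fin n) → ℂ := fun d => ∏ i, ψ i ^ d i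
  have hmon : ∀ d, IsGenEigenvectorMod (compositionOperator F) (zeroNearOrigin _)
      (∏ i, μ i ^ d i) (MvPolynomial.coeff d p • mon d) := fun d =>
    (IsGenEigenvectorMod.prod hT1 hT hZT mul_mem_zeroNearOrigin _ _ _ fun i =>
      (hψ i).pow hT1 hT hZT mul_mem_zeroNearOrigin _).smul _
  have heval : ∀ z, MvPolynomial.eval (e z).ofLp p =
      ∑ d ∈ p.support, (MvPolynomial.coeff d p • mon d) z := by
    intro z
    simp [MvPolynomial.eval_eq', mon, he, Finset.prod_apply]
  have hrem : f - ∑ d ∈ p.support, MvPolynomial.coeff d p • mon d ∈ vanishingToOrder _ m := by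
    have hfun : f - ∑ d ∈ p.support, MvPolynomial.coeff d p • mon d =
        fun z => f z - MvPolynomial.eval (e z).ofLp p := by
      ext z
      rw [heval, Pi.sub_apply, Finset.sum_apply]
    rw [hfun]
    refine ⟨?_, ?_⟩
    · filter_upwards [hf, hed0] with z h1 h2
      exact h1.sub ((differentiable_mvPolynomial_eval p _).comp z h2)
    · have h1 := hp.comp_tendsto hec
      have h2 : (fun z => ‖e z‖ ^ m) =O[𝓝 0] fun z => ‖z‖ ^ m :=
        (isBigO_norm_of_differentiableAt hed0.self_of_nhds he0).norm_left.pow m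
      refine (h1.trans h2).congr' ?_ EventuallyEq.rfl
      filter_upwards [e.eventually_left_inverse he0s] with z hz
      simp only [Function.comp_apply, hz]
  set u := f - ∑ d ∈ p.support with ∏ i, μ i ^ d i = ν, MvPolynomial.coeff d p • mon d with hu
  set v := ∑ d ∈ p.support with ¬ ∏ i, μ i ^ d i = ν, MvPolynomial.coeff d p • mon d with hv
  have huv : u - v ∈ vanishingToOrder _ m := by
    rw [hu, hv, sub_sub, Finset.sum_filter_add_sum_filter_not]
    exact hrem
  obtain ⟨q, hq, hqv⟩ := IsGenEigenvectorMod.exists_isCoprime_aeval_sum_mem hZT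
    (p.support.filter fun d => ¬ ∏ i, μ i ^ d i = ν) _ _ (fun d _ => hmon d) ν
    fun d hd => (Finset.mem_filter.1 hd).2
  obtain ⟨N, hN⟩ : IsGenEigenvectorMod (compositionOperator F) (zeroNearOrigin _) ν u :=
    hfν.sub hZT (IsGenEigenvectorMod.sum hZT _ _ fun d hd => by
      rw [← (Finset.mem_filter.1 hd).2]
      exact hmon d)
  have hqu : aeval (compositionOperator F) q u ∈ vanishingToOrder _ m := by
    have := Submodule.add_mem _ (aeval_apply_mem_of_invariant hYT q huv)
      (zeroNearOrigin_le_vanishingToOrder m hqv)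
    rwa [map_sub, sub_add_cancel] at this
  have huZ := hF.mem_zeroNearOrigin_of_aeval_mem hα hC hF0 hFd hν N
    (mem_of_isCoprime_aeval_mem hYT (hq N) hqu (zeroNearOrigin_le_vanishingToOrder m hN)) hN
  refine ⟨∑ d ∈ p.support with ∏ i, μ i ^ d i = ν,
    MvPolynomial.monomial d (MvPolynomial.coeff d p), ?_, ?_⟩
  · intro d hd
    obtain ⟨d', hd', hdd'⟩ := Finset.mem_biUnion.1 (MvPolynomial.support_sum hd)
    rw [Finset.mem_singleton.1 (MvPolynomial.support_monomial_subset hdd')]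
    exact (Finset.mem_filter.1 hd').2
  · filter_upwards [mem_zeroNearOrigin.1 huZ] with z hz
    rw [hu, Pi.sub_apply, sub_eq_zero] at hz
    rw [hz]
    simp [MvPolynomial.eval_monomial, Finsupp.prod_fintype, mon, Finset.prod_apply]

end ResonantPolynomials

section TriangularAutomorphisms

variable {n : ℕ}

/-- Triangular holomorphic maps with nonzero diagonal are automorphisms. -/
theorem isHolomorphicAutomorphism_of_triangular (a : Fin n → ℂ) (ha : ∀ j, a j ≠ 0)
    (r : Fin n → EuclideanSpace ℂ (Fin n) → ℂ) (hr : ∀ j, Differentiable ℂ (r j))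
    (hdep : ∀ j z w, (∀ k < j, z k = w k) → r j z = r j w)
    (G : EuclideanSpace ℂ (Fin n) → EuclideanSpace ℂ (Fin n))
    (hG : ∀ z j, G z j = a j * z j + r j z) : IsHolomorphicAutomorphism G := by
  let K : EuclideanSpace ℂ (Fin n) → EuclideanSpace ℂ (Fin n) → EuclideanSpace ℂ (Fin n) :=
    fun w z => WithLp.toLp 2 fun j => (w j - r j z) / a j
  have hK : ∀ w z j, K w z j = (w j - r j z) / a j := fun _ _ _ => rfl
  have hfix : ∀ w z, K w z = z ↔ G z = w := by
    intro w z
    rw [WithLp.ext_iff, WithLp.ext_iff, funext_iff, funext_iff]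
    refine forall_congr' fun j => ?_
    rw [hK, hG, div_eq_iff (ha j)]
    constructor <;> intro h <;> linear_combination -h
  have hconst : ∀ w z z' k, ∀ j : Fin n, (j : ℕ) < k → (K w)^[k] z j = (K w)^[k] z' j := by
    intro w z z' k
    induction k with
    | zero => exact fun j hj => absurd hj (Nat.not_lt_zero _)
    | succ k ih =>
      intro j hj
      rw [Function.iterate_succ_apply', Function.iterate_succ_apply', hK, hK,
        hdep j _ _ fun i hi => ih i (by omega)]
  have hconst' : ∀ w z z', (K w)^[n] z = (K w)^[n] z' := by
    intro w z z'
    ext j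
    exact hconst w z z' n j j.2
  refine ⟨differentiable_euclidean.2 fun j => ?_, fun w => (K w)^[n] 0, ?_, ?_, ?_⟩
  · simp only [hG]
    exact ((differentiable_euclidean.1 differentiable_id j).const_mul _).add (hr j)
  · have : ∀ k, Differentiable ℂ fun w => (K w)^[k] 0 := by
      intro k
      induction k with
      | zero => exact differentiable_const _
      | succ k ih =>
        refine differentiable_euclidean.2 fun j => ?_
        simp only [Function.iterate_succ_apply', hK, div_eq_mul_inv]
        exact ((differentiable_euclidean.1 differentiable_id j).fun_sub
          ((hr j).fun_comp ih)).mul_const _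
    exact this n
  · intro z
    refine (hconst' _ 0 z).trans ?_
    exact Function.iterate_fixed ((hfix _ _).2 rfl) n
  · intro w
    rw [← hfix, ← Function.iterate_succ_apply' (K w), Function.iterate_succ_apply]
    exact hconst' w _ _

end TriangularAutomorphisms

section NormalFormCoefficients

variable {n : ℕ}

theorem exists_eq_single_of_degree_eq_one {d : Fin n →₀ ℕ} (hd : d.degree = 1) :
    ∃ k, d = Finsupp.single k 1 := by
  have hne : d ≠ 0 := by
    rintro rfl
    simp at hd
  obtain ⟨k, hk⟩ := Finsupp.ne_iff.1 hne
  obtain ⟨d', rfl⟩ := le_iff_exists_add.1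
    (Finsupp.single_le_iff.2 (Nat.one_le_iff_ne_zero.2 hk) : Finsupp.single k 1 ≤ d)
  rw [map_add, Finsupp.degree_single, Nat.add_eq_left, Finsupp.degree_eq_zero_iff] at hd
  exact ⟨k, by rw [hd, add_zero]⟩

/-- Splitting off the linear part of a polynomial without constant term. -/
theorem exists_eval_eq_linear_add (p : MvPolynomial (Fin n) ℂ) (hp : MvPolynomial.coeff 0 p = 0) :
    ∃ g : MvPolynomial (Fin n) ℂ, (∀ d ∈ g.support, 2 ≤ d.degree ∧ d ∈ p.support) ∧
      ∀ z, MvPolynomial.eval z p =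
        ∑ k, MvPolynomial.coeff (Finsupp.single k 1) p * z k + MvPolynomial.eval z g := by
  classical
  refine ⟨p - ∑ k, MvPolynomial.monomial (Finsupp.single k 1)
    (MvPolynomial.coeff (Finsupp.single k 1) p), fun d hd => ?_, fun z => ?_⟩
  · rw [MvPolynomial.mem_support_iff, MvPolynomial.coeff_sub, MvPolynomial.coeff_sum] at hd
    simp only [MvPolynomial.coeff_monomial] at hd
    have hdeg : 2 ≤ d.degree := by
      by_contra! h
      refine hd ?_
      obtain h0 | h1 : d.degree = 0 ∨ d.degree = 1 := by omega
      · obtain rfl := (Finsupp.degree_eq_zero_iff d).1 h0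
        simp [hp]
      · obtain ⟨k, rfl⟩ := exists_eq_single_of_degree_eq_one h1
        rw [Finset.sum_eq_single k]
        · simp
        · intro i _ hi
          rw [if_neg fun h => hi ((Finsupp.single_left_inj one_ne_zero).1 h)]
        · simp
    refine ⟨hdeg, MvPolynomial.mem_support_iff.2 fun h => hd ?_⟩
    rw [h, zero_sub, neg_eq_zero]
    refine Finset.sum_eq_zero fun k _ => if_neg ?_
    rintro rfl
    simp at hdeg
  · simp [MvPolynomial.eval_monomial]

/-- A resonant monomial of degree at least two only involves variables of larger multiplier. -/
theorem lt_norm_of_resonant {μ : Fin n → ℂ} (h0 : ∀ j, 0 < ‖μ j‖) (h1 : ∀ j, ‖μ j‖ < 1)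
    {d : Fin n →₀ ℕ} (hd : 2 ≤ d.degree) {k : Fin n} (hk : d k ≠ 0) :
    ‖∏ i, μ i ^ d i‖ < ‖μ k‖ := by
  classical
  obtain ⟨d', rfl⟩ : ∃ d', d = Finsupp.single k 1 + d' := by
    refine le_iff_exists_add.1 (Finsupp.single_le_iff.2 ?_)
    omega
  have hsplit : ∏ i, μ i ^ (Finsupp.single k 1 + d' : Fin n →₀ ℕ) i = μ k * ∏ i, μ i ^ d' i := by
    simp only [Finsupp.add_apply, pow_add, Finset.prod_mul_distrib]
    congr 1
    rw [Finset.prod_eq_single k] <;> simp +contextual [eq_comm]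
  have hd' : d' ≠ 0 := by
    rintro rfl
    simp at hd
  obtain ⟨i, hi⟩ := Finsupp.ne_iff.1 hd'
  have hlt : ∏ i, ‖μ i‖ ^ d' i < ∏ i : Fin n, (1 : ℝ) :=
    Finset.prod_lt_prod (fun i _ => pow_pos (h0 i) _)
      (fun i _ => pow_le_one₀ (h0 i).le (h1 i).le)
      ⟨i, Finset.mem_univ i, pow_lt_one₀ (h0 i).le (h1 i) hi⟩
  rw [hsplit, norm_mul, norm_prod]
  simp only [norm_pow]
  rw [Finset.prod_const_one] at hlt
  exact mul_lt_of_lt_one_right (h0 k) hlt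

/-- Coefficients of a triangular linear relation in a linearly independent family. -/
theorem coeff_of_sub_smul_mem_span {W : Type*} [AddCommGroup W] [Module ℂ W] {l : Fin n → W}
    (hl : LinearIndependent ℂ l) (c : Fin n → ℂ) (ν : ℂ) (j : Fin n)
    (h : ∑ k, c k • l k - ν • l j ∈ Submodule.span ℂ (l '' Set.Iio j)) :
    c j = ν ∧ ∀ k, j < k → c k = 0 := by
  classical
  obtain ⟨b, hb, hbl⟩ := (Finsupp.mem_span_image_iff_linearCombination ℂ).1 h
  have hb0 : ∀ k, ¬ k < j → b k = 0 := fun k hk =>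
    Finsupp.notMem_support_iff.1 fun hks => hk ((Finsupp.mem_supported ℂ b).1 hb hks)
  rw [Finsupp.linearCombination_apply,
    Finsupp.sum_fintype b (fun i a => a • l i) fun i => zero_smul ℂ (l i), eq_comm,
    sub_eq_iff_eq_add] at hbl
  have hsingle : ν • l j = ∑ k, (if k = j then ν else 0) • l k := by simp
  rw [hsingle, ← Finset.sum_add_distrib] at hbl
  simp only [← add_smul] at hbl
  have hc := Fintype.linearIndependent_iff.1 hl (fun k => c k - (b k + if k = j then ν else 0))
    (by simp only [sub_smul, Finset.sum_sub_distrib, hbl, sub_self])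
  constructor
  · have := hc j
    rw [hb0 j (lt_irrefl j), if_pos rfl] at this
    linear_combination this
  · intro k hk
    have := hc k
    rw [hb0 k hk.le.not_gt, if_neg hk.ne'] at this
    linear_combination this

end NormalFormCoefficients

section NormalForm
open Filter Topology Set

variable {n : ℕ}

theorem eval_mem_vanishingToOrder_two {g : MvPolynomial (Fin n) ℂ}
    (hg : ∀ d ∈ g.support, 2 ≤ d.degree) :
    (fun w : EuclideanSpace ℂ (Fin n) => MvPolynomial.eval w.ofLp g) ∈
      vanishingToOrder (EuclideanSpace ℂ (Fin n)) 2 := by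
  have h : (fun w : EuclideanSpace ℂ (Fin n) => MvPolynomial.eval w.ofLp g) =
      ∑ d ∈ g.support, MvPolynomial.coeff d g •
        fun w : EuclideanSpace ℂ (Fin n) => ∏ i, w i ^ d i := by
    ext w
    simp [MvPolynomial.eval_eq']
  rw [h]
  exact Submodule.sum_mem _ fun d hd => Submodule.smul_mem _ _
    (vanishingToOrder_anti (hg d hd) (prod_pow_mem_vanishingToOrder d))

/-- The linear part of a local normal form is the transpose of the derivative. -/
theorem dualMap_eq_sum_of_eventually_eq {F : EuclideanSpace ℂ (Fin n) → EuclideanSpace ℂ (Fin n)}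
    (hF0 : F 0 = 0) (hFd : ∀ᶠ z in 𝓝 0, DifferentiableAt ℂ F z)
    {ψ : EuclideanSpace ℂ (Fin n) → EuclideanSpace ℂ (Fin n)} (hψ0 : ψ 0 = 0)
    (hψd : ∀ᶠ z in 𝓝 0, DifferentiableAt ℂ ψ z)
    {l : Fin n → Module.Dual ℂ (EuclideanSpace ℂ (Fin n))}
    (hl : ∀ j, (fun z => ψ z j) - ⇑(l j) ∈ vanishingToOrder (EuclideanSpace ℂ (Fin n)) 2)
    {g : MvPolynomial (Fin n) ℂ} (hg : ∀ d ∈ g.support, 2 ≤ d.degree) (a : Fin n → ℂ) (j : Fin n)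
    (h : ∀ᶠ z in 𝓝 0, ψ (F z) j = ∑ k, a k * ψ z k + MvPolynomial.eval (ψ z).ofLp g) :
    (fderiv ℂ F 0 : EuclideanSpace ℂ (Fin n) →ₗ[ℂ] EuclideanSpace ℂ (Fin n)).dualMap (l j) =
      ∑ k, a k • l k := by
  set S := (fderiv ℂ F 0 : EuclideanSpace ℂ (Fin n) →ₗ[ℂ] EuclideanSpace ℂ (Fin n)).dualMap
  have h1 := compositionOperator_mem_vanishingToOrder hF0 hFd 2 _ (hl j)
  have h2 := compositionOperator_sub_dualMap_mem hF0 hFd (l j)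
  have h3 := compositionOperator_mem_vanishingToOrder hψ0 hψd 2 _
    (eval_mem_vanishingToOrder_two hg)
  have h4 : ∑ k, a k • ((fun z => ψ z k) - ⇑(l k)) ∈
      vanishingToOrder (EuclideanSpace ℂ (Fin n)) 2 :=
    Submodule.sum_mem _ fun k _ => Submodule.smul_mem _ _ (hl k)
  have h5 : (fun z => ψ (F z) j - (∑ k, a k * ψ z k + MvPolynomial.eval (ψ z).ofLp g)) ∈
      vanishingToOrder (EuclideanSpace ℂ (Fin n)) 2 :=
    zeroNearOrigin_le_vanishingToOrder 2 (h.mono fun z hz => sub_eq_zero.2 hz)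
  have h6 : ⇑(S (l j) - ∑ k, a k • l k) ∈ vanishingToOrder (EuclideanSpace ℂ (Fin n)) 2 := by
    convert Submodule.sub_mem _ (Submodule.add_mem _ (Submodule.add_mem _ h3 h4) h5)
      (Submodule.add_mem _ h1 h2) using 1
    ext z
    simp [LinearMap.funLeft_apply, mul_sub, Finset.sum_sub_distrib, S]
    ring
  have h7 := hasFDerivAt_of_mem_vanishingToOrder_two h6
  have h8 : LinearMap.toContinuousLinearMap (S (l j) - ∑ k, a k • l k) = 0 :=
    (LinearMap.toContinuousLinearMap (S (l j) - ∑ k, a k • l k)).hasFDerivAt.unique h7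
  exact sub_eq_zero.1 (LinearMap.toContinuousLinearMap.map_eq_zero_iff.1 h8)

/-- Local coordinates consisting of generalized eigenfunctions of composition with `F`, with linear
parts triangularizing the transpose of `dF₀`. -/
theorem exists_spectral_coordinates (hn : 1 ≤ n)
    {F : EuclideanSpace ℂ (Fin n) → EuclideanSpace ℂ (Fin n)} (hF0 : F 0 = 0)
    (hFd : ∀ᶠ z in 𝓝 0, DifferentiableAt ℂ F z)
    (heig : ∀ μ ∈ spectrum ℂ (fderiv ℂ F 0), 0 < ‖μ‖ ∧ ‖μ‖ < 1) :
    ∃ (l : Fin n → Module.Dual ℂ (EuclideanSpace ℂ (Fin n))) (μ : Fin n → ℂ)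
      (ψ : Fin n → EuclideanSpace ℂ (Fin n) → ℂ) (α C : ℝ) (m : ℕ),
      LinearIndependent ℂ l ∧
      (∀ j, (fderiv ℂ F 0 : EuclideanSpace ℂ (Fin n) →ₗ[ℂ] EuclideanSpace ℂ (Fin n)).dualMap (l j) -
        μ j • l j ∈ Submodule.span ℂ (l '' Iio j)) ∧
      (∀ j k, j ≤ k → ‖μ k‖ ≤ ‖μ j‖) ∧ (∀ j, 0 < ‖μ j‖ ∧ ‖μ j‖ < 1) ∧
      0 < α ∧ 0 < C ∧ IsAttractingAtRate F α C ∧ (∀ j, α ^ m < ‖μ j‖) ∧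
      (∀ j, ψ j - ⇑(l j) ∈ vanishingToOrder (EuclideanSpace ℂ (Fin n)) 2) ∧
      ∀ j, IsGenEigenvectorMod (compositionOperator F) (zeroNearOrigin _) (μ j) (ψ j) := by
  have : Nonempty (Fin n) := ⟨⟨0, hn⟩⟩
  obtain ⟨α, C, hα, hα1, hC, hF⟩ := exists_attracting_nhds hF0 hFd.self_of_nhds.hasFDerivAt
    fun μ hμ => (heig μ hμ).2
  obtain ⟨l, μ, hli, hgen, htri, hanti, hev⟩ := exists_triangularizing_family
    (fderiv ℂ F 0 : EuclideanSpace ℂ (Fin n) →ₗ[ℂ] EuclideanSpace ℂ (Fin n)).dualMap n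
    (by rw [Subspace.dual_finrank_eq, finrank_euclideanSpace, Fintype.card_fin])
  have hμ : ∀ j, 0 < ‖μ j‖ ∧ ‖μ j‖ < 1 := fun j =>
    heig _ (mem_spectrum_of_hasEigenvalue_dualMap _ (hev j))
  obtain ⟨m, hm, hαm⟩ : ∃ m, 2 ≤ m ∧ ∀ j, α ^ m < ‖μ j‖ :=
    ((eventually_ge_atTop 2).and (eventually_all.2 fun j =>
      (tendsto_pow_atTop_nhds_zero_of_lt_one hα.le hα1).eventually_lt_const (hμ j).1)).exists
  have hψ : ∀ j, ∃ ψ : EuclideanSpace ℂ (Fin n) → ℂ,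
      ψ - ⇑(l j) ∈ vanishingToOrder (EuclideanSpace ℂ (Fin n)) 2 ∧
      IsGenEigenvectorMod (compositionOperator F) (zeroNearOrigin _) (μ j) ψ := by
    intro j
    refine IsAttractingAtRate.exists_isGenEigenvectorMod hα hC hF hF0 hFd hm (hαm j)
      (Eventually.of_forall fun z => (LinearMap.toContinuousLinearMap (l j)).differentiableAt) ?_
    obtain ⟨N, hN⟩ := (Module.End.mem_maxGenEigenspace _ _ _).1 (hgen j)
    exact ⟨N, aeval_compositionOperator_mem_of_dualMap_pow_eq_zero hF0 hFd (μ j) N (l j) hN⟩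
  choose ψ hψl hψ using hψ
  exact ⟨l, μ, ψ, α, C, m, hli, htri, hanti, hμ, hα, hC, hF, hαm, hψl, hψ⟩

end NormalForm

/-- Normal form at an attracting fixed point (Rosay–Rudin): a local biholomorphism F fixing 0
whose derivative dF₀ has all eigenvalues of modulus in (0,1) is locally conjugate to a
lower-triangular polynomial automorphism G(z) = Az + (0, g₂(z), …, gₙ(z)), where g_j is a
polynomial in z₁,…,z_{j−1} without constant or linear terms. -/
theorem rosay_rudin_normal_form (n : ℕ) (hn : 1 ≤ n)
    (U : Set (EuclideanSpace ℂ (Fin n))) (hUopen : IsOpen U) (hU0 : (0 : EuclideanSpace ℂ (Fin n)) ∈ U)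
    (F : EuclideanSpace ℂ (Fin n) → EuclideanSpace ℂ (Fin n))
    (hFhol : DifferentiableOn ℂ F U) (hFinj : Set.InjOn F U)
    (hFimage : IsOpen (F '' U))
    (hFinv : ∃ Finv : EuclideanSpace ℂ (Fin n) → EuclideanSpace ℂ (Fin n),
      DifferentiableOn ℂ Finv (F '' U) ∧ ∀ z ∈ U, Finv (F z) = z)
    (hF0 : F 0 = 0)
    (heig : ∀ μ ∈ spectrum ℂ (fderiv ℂ F 0), 0 < ‖μ‖ ∧ ‖μ‖ < 1) :
    ∃ (V : Set (EuclideanSpace ℂ (Fin n)))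
      (ψ : EuclideanSpace ℂ (Fin n) → EuclideanSpace ℂ (Fin n))
      (A : Matrix (Fin n) (Fin n) ℂ)
      (g : Fin n → MvPolynomial (Fin n) ℂ)
      (G : EuclideanSpace ℂ (Fin n) → EuclideanSpace ℂ (Fin n)),
      IsOpen V ∧ (0 : EuclideanSpace ℂ (Fin n)) ∈ V ∧ V ⊆ U ∧ F '' V ⊆ U ∧
      ψ 0 = 0 ∧ Set.InjOn ψ V ∧ DifferentiableOn ℂ ψ V ∧ IsOpen (ψ '' V) ∧
      (∃ ψinv : EuclideanSpace ℂ (Fin n) → EuclideanSpace ℂ (Fin n),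
        DifferentiableOn ℂ ψinv (ψ '' V) ∧ ∀ z ∈ V, ψinv (ψ z) = z) ∧
      -- A is invertible and lower-triangular
      IsUnit A.det ∧ (∀ i j : Fin n, i < j → A i j = 0) ∧
      -- the first component of the nonlinear part vanishes
      (∀ j : Fin n, (j : ℕ) = 0 → g j = 0) ∧
      -- g_j depends only on the variables z₁,…,z_{j−1}
      (∀ j : Fin n, ∀ z w : Fin n → ℂ, (∀ k : Fin n, k < j → z k = w k) →
        MvPolynomial.eval z (g j) = MvPolynomial.eval w (g j)) ∧
      -- g_j has no constant or linear terms
      (∀ j : Fin n, ∀ d ∈ (g j).support, 2 ≤ d.sum fun _ e => e) ∧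
      -- G(z) = Az + (0, g₂(z), …, gₙ(z))
      (∀ (z : EuclideanSpace ℂ (Fin n)) (j : Fin n),
        G z j = (∑ k : Fin n, A j k * z k) + MvPolynomial.eval (fun k => z k) (g j)) ∧
      IsHolomorphicAutomorphism G ∧
      (∀ z ∈ V, ψ (F z) = G (ψ z)) := by
  have hFd : ∀ᶠ z in nhds 0, DifferentiableAt ℂ F z := by
    filter_upwards [hUopen.eventually_mem hU0] with z hz
    exact hFhol.differentiableAt (hUopen.mem_nhds hz)
  obtain ⟨l, μ, ψ, α, C, m, hli, htri, hanti, hμ, hα, hC, hF, hαm, hψl, hψ⟩ :=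
    exists_spectral_coordinates hn hF0 hFd heig
  have hψhol : ∀ j, ψ j ∈ holomorphicNearOrigin (EuclideanSpace ℂ (Fin n)) := fun j => by
    have hlj : ⇑(l j) ∈ holomorphicNearOrigin (EuclideanSpace ℂ (Fin n)) :=
      Filter.Eventually.of_forall fun z =>
        (LinearMap.toContinuousLinearMap (l j)).differentiableAt
    simpa using Submodule.add_mem _ (hψl j).1 hlj
  have hψ0 : ∀ j, ψ j 0 = 0 := fun j => by
    simpa using apply_zero_of_mem_vanishingToOrder two_ne_zero (hψl j)
  have hψ' : ∀ j, HasFDerivAt (ψ j) (LinearMap.toContinuousLinearMap (l j)) 0 := fun j => by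
    have h := (hasFDerivAt_of_mem_vanishingToOrder_two (hψl j)).add
      (LinearMap.toContinuousLinearMap (l j)).hasFDerivAt
    rw [zero_add] at h
    exact h.congr_of_eventuallyEq (Filter.Eventually.of_forall fun z => by simp)
  have hΨd := eventually_differentiableAt_toLp hψhol
  obtain ⟨e, he, he0s, hed, hesd⟩ := exists_openPartialHomeomorph_of_bijective hΨd
    (injective_fderiv_toLp hψhol hli hψ')
  set Ψ : EuclideanSpace ℂ (Fin n) → EuclideanSpace ℂ (Fin n) :=
    fun z => WithLp.toLp 2 fun j => ψ j z
  have hΨ0 : Ψ 0 = 0 := by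
    ext j
    exact hψ0 j
  have hp : ∀ j, ∃ p : MvPolynomial (Fin n) ℂ, (∀ d ∈ p.support, ∏ i, μ i ^ d i = μ j) ∧
      ∀ᶠ z in nhds 0, ψ j (F z) = MvPolynomial.eval (fun i => ψ i z) p := fun j =>
    IsAttractingAtRate.exists_resonant_mvPolynomial hα hC hF hF0 hFd hψ e
      (fun z j => by rw [he]) (by rw [he, hΨ0]) he0s (by rwa [he]) hesd (hαm j)
      (compositionOperator_mem_holomorphicNearOrigin hF0 hFd _ (hψhol j))
      ((hψ j).apply (compositionOperator_mem_zeroNearOrigin hF0 hFd.self_of_nhds.continuousAt))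
  choose p hpres hpeq using hp
  have hp0 : ∀ j, MvPolynomial.coeff 0 (p j) = 0 := by
    intro j
    by_contra h
    have := hpres j 0 (MvPolynomial.mem_support_iff.2 h)
    simp only [Finsupp.coe_zero, Pi.zero_apply, pow_zero, Finset.prod_const_one] at this
    have h1 := (hμ j).2
    rw [← this, norm_one] at h1
    exact lt_irrefl _ h1
  choose g hg hpg using fun j => exists_eval_eq_linear_add (p j) (hp0 j)
  set A : Matrix (Fin n) (Fin n) ℂ := fun j k => MvPolynomial.coeff (Finsupp.single k 1) (p j)
  have hconj : ∀ j, ∀ᶠ z in nhds 0,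
      Ψ (F z) j = ∑ k, A j k * Ψ z k + MvPolynomial.eval (Ψ z).ofLp (g j) := fun j =>
    (hpeq j).mono fun z hz => hz.trans (hpg j _)
  have hA : ∀ j, A j j = μ j ∧ ∀ k, j < k → A j k = 0 := fun j =>
    coeff_of_sub_smul_mem_span hli (A j) (μ j) j (by
      rw [← dualMap_eq_sum_of_eventually_eq hF0 hFd hΨ0 hΨd hψl (fun d hd => (hg j d hd).1) _ j
        (hconj j)]
      exact htri j)
  have hvar : ∀ j, ∀ d ∈ (g j).support, ∀ k, d k ≠ 0 → k < j := by
    intro j d hd k hk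
    by_contra! h
    have := lt_norm_of_resonant (fun i => (hμ i).1) (fun i => (hμ i).2) (hg j d hd).1 hk
    rw [hpres j d (hg j d hd).2] at this
    exact (hanti j k h).not_gt this
  have hdep : ∀ j : Fin n, ∀ z w : Fin n → ℂ, (∀ k : Fin n, k < j → z k = w k) →
      MvPolynomial.eval z (g j) = MvPolynomial.eval w (g j) := by
    intro j z w h
    rw [MvPolynomial.eval_eq', MvPolynomial.eval_eq']
    refine Finset.sum_congr rfl fun d hd => congrArg _ (Finset.prod_congr rfl fun k _ => ?_)
    by_cases hk : d k = 0
    · rw [hk, pow_zero, pow_zero]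
    · rw [h k (hvar j d hd k hk)]
  let G : EuclideanSpace ℂ (Fin n) → EuclideanSpace ℂ (Fin n) := fun z =>
    WithLp.toLp 2 fun j => ∑ k, A j k * z k + MvPolynomial.eval z.ofLp (g j)
  obtain ⟨V, hV, hVo, hV0⟩ := eventually_nhds_iff.1 ((Filter.eventually_all.2 hconj).and
    ((e.open_source.eventually_mem he0s).and ((hUopen.eventually_mem hU0).and
      (hFd.self_of_nhds.continuousAt.eventually_mem
        (hUopen.mem_nhds (hF0.symm ▸ hU0 : F 0 ∈ U))))))
  have hVe : V ⊆ e.source := fun z hz => (hV z hz).2.1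
  have hVΨ : Ψ '' V ⊆ e.target := by
    rw [← he]
    exact (Set.image_mono hVe).trans e.image_source_eq_target.subset
  refine ⟨V, Ψ, A, g, G, hVo, hV0, fun z hz => (hV z hz).2.2.1, ?_, hΨ0, ?_, hed.mono hVe, ?_,
    ⟨e.symm, hesd.mono hVΨ, fun z hz => ?_⟩, ?_, fun i j hij => (hA i).2 j hij, ?_, hdep,
    fun j d hd => (hg j d hd).1, fun z j => rfl, ?_, fun z hz => ?_⟩
  · rintro _ ⟨z, hz, rfl⟩
    exact (hV z hz).2.2.2
  · rw [← he]
    exact e.injOn.mono hVe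
  · rw [← he]
    exact e.isOpen_image_of_subset_source hVo hVe
  · rw [← he]
    exact e.left_inv (hVe hz)
  · rw [Matrix.det_of_isLowerTriangular A fun i j hij => (hA i).2 j hij, isUnit_iff_ne_zero,
      Finset.prod_ne_zero_iff]
    intro j _
    rw [(hA j).1]
    exact norm_pos_iff.1 (hμ j).1
  · intro j hj
    rw [← MvPolynomial.support_eq_empty, Finset.eq_empty_iff_forall_notMem]
    intro d hd
    have hne : d ≠ 0 := by
      rintro rfl
      simpa using (hg j 0 hd).1
    obtain ⟨k, hk⟩ := Finsupp.ne_iff.1 hne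
    have := hvar j d hd k hk
    omega
  · refine isHolomorphicAutomorphism_of_triangular μ (fun j => norm_pos_iff.1 (hμ j).1)
      (fun j z => ∑ k ∈ Finset.Iio j, A j k * z k + MvPolynomial.eval z.ofLp (g j))
      (fun j => ?_) (fun j z w h => ?_) G fun z j => ?_
    · refine Differentiable.fun_add (Differentiable.fun_sum fun k _ => ?_)
        (differentiable_mvPolynomial_eval (g j))
      exact (differentiable_euclidean.1 differentiable_id k).const_mul _
    · rw [hdep j z.ofLp w.ofLp h]
      congr 1
      exact Finset.sum_congr rfl fun k hk => by rw [h k (Finset.mem_Iio.1 hk)]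
    · change ∑ k, A j k * z k + _ = _
      rw [← add_assoc, ← (hA j).1, ← Finset.sum_subset (Finset.subset_univ (Finset.Iic j)),
        ← Finset.Iio_insert, Finset.sum_insert (by simp)]
      intro k _ hk
      rw [(hA j).2 k (by simpa using hk), zero_mul]
  · ext j
    exact (hV z hz).1 j
end
end

section
/- Let n ≥ 2, let K ⊆ ℂⁿ be a compact polynomially convex set, and let L ⊆ ℂⁿ \ K be a finite set. Then there exists a Fatou–Bieberbach domain Ω with K ⊆ Ω ⊆ ℂⁿ \ L; that is, there exists an injective entire map F : ℂⁿ → ℂⁿ whose derivative is invertible at every point, such that K ⊆ F(ℂⁿ) and F(ℂⁿ) ∩ L = ∅. -/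
noncomputable section

/-- The polynomial hull of a set K ⊆ ℂⁿ. -/
def polyHull {n : ℕ} (K : Set (EuclideanSpace ℂ (Fin n))) : Set (EuclideanSpace ℂ (Fin n)) :=
  {z | ∀ p : MvPolynomial (Fin n) ℂ, ∀ c : ℝ,
    (∀ w ∈ K, ‖MvPolynomial.eval (fun i => w i) p‖ ≤ c) →
      ‖MvPolynomial.eval (fun i => z i) p‖ ≤ c}

/-- A compact set is polynomially convex if it equals its polynomial hull. -/
def IsPolynomiallyConvex {n : ℕ} (K : Set (EuclideanSpace ℂ (Fin n))) : Prop :=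
  polyHull K = K

open Set Filter Topology Metric

section NearId

variable {E : Type*} [NormedAddCommGroup E]

/-- `φ` and its inverse move the points of `S` by at most `ε`. -/
def NearId (φ : Equiv.Perm E) (S : Set E) (ε : ℝ) : Prop :=
  ∀ z ∈ S, ‖φ z - z‖ ≤ ε ∧ ‖φ⁻¹ z - z‖ ≤ ε

lemma NearId.one (S : Set E) {ε : ℝ} (hε : 0 ≤ ε) : NearId (1 : Equiv.Perm E) S ε := by
  intro z _
  simpa using hε

lemma NearId.mono {φ : Equiv.Perm E} {S T : Set E} {ε η : ℝ} (h : NearId φ T ε) (hST : S ⊆ T)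
    (hεη : ε ≤ η) : NearId φ S η :=
  fun z hz => ⟨(h z (hST hz)).1.trans hεη, (h z (hST hz)).2.trans hεη⟩

lemma NearId.mul {φ ψ : Equiv.Perm E} {S T : Set E} {ε : ℝ} (hε : 0 ≤ ε)
    (hφ : NearId φ T ε) (hψ : NearId ψ T ε) (hST : ∀ z ∈ S, ∀ w, ‖w - z‖ ≤ ε → w ∈ T) :
    NearId (φ * ψ) S (2 * ε) := by
  have key : ∀ α β : E → E, (∀ z ∈ T, ‖α z - z‖ ≤ ε) → (∀ z ∈ T, ‖β z - z‖ ≤ ε) →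
      ∀ z ∈ S, ‖α (β z) - z‖ ≤ 2 * ε := by
    intro α β hα hβ z hz
    have hzT : z ∈ T := hST z hz z (by simpa using hε)
    have h1 := hβ z hzT
    have h2 := hα _ (hST z hz _ h1)
    calc ‖α (β z) - z‖ = ‖(α (β z) - β z) + (β z - z)‖ := by congr 1; abel
      _ ≤ 2 * ε := (norm_add_le _ _).trans (by linarith)
  intro z hz
  refine ⟨key φ ψ (fun z hz => (hφ z hz).1) (fun z hz => (hψ z hz).1) z hz, ?_⟩
  rw [mul_inv_rev]
  exact key _ _ (fun z hz => (hψ z hz).2) (fun z hz => (hφ z hz).2) z hz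

lemma mem_cthickening_add {δ δ' : ℝ} (hδ : 0 ≤ δ) (hδ' : 0 ≤ δ') {K : Set E} {z w : E}
    (hz : z ∈ cthickening δ K) (hw : ‖w - z‖ ≤ δ') : w ∈ cthickening (δ' + δ) K :=
  cthickening_cthickening_subset hδ' hδ K
    (mem_cthickening_of_dist_le w z δ' _ hz (by rwa [dist_eq_norm]))

end NearId

section Automorphisms

variable {E : Type*} [NormedAddCommGroup E] [NormedSpace ℂ E]

variable (E) in
/-- The group of holomorphic automorphisms of `E`. -/
def holAut : Subgroup (Equiv.Perm E) where
  carrier := {φ | Differentiable ℂ φ ∧ Differentiable ℂ (φ⁻¹ : Equiv.Perm E)}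
  mul_mem' := by
    intro φ ψ hφ hψ
    exact ⟨hφ.1.comp hψ.1, by rw [mul_inv_rev]; exact hψ.2.comp hφ.2⟩
  one_mem' := ⟨differentiable_id, differentiable_id⟩
  inv_mem' := by
    intro φ hφ
    exact ⟨hφ.2, by rw [inv_inv]; exact hφ.1⟩

lemma addRight_mem_holAut (v : E) : Equiv.addRight v ∈ holAut E :=
  ⟨differentiable_id.add_const v, differentiable_id.add_const (-v)⟩

/-- The shear `z ↦ z + f (a z) v`, where the functional `a` kills `v`. -/
def shear (a : E →L[ℂ] ℂ) (v : E) (hav : a v = 0) (f : ℂ → ℂ) : Equiv.Perm E where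
  toFun z := z + f (a z) • v
  invFun z := z - f (a z) • v
  left_inv z := by simp [hav]
  right_inv z := by simp [hav]

lemma shear_apply (a : E →L[ℂ] ℂ) (v : E) (hav : a v = 0) (f : ℂ → ℂ) (z : E) :
    shear a v hav f z = z + f (a z) • v := rfl

lemma shear_inv_apply (a : E →L[ℂ] ℂ) (v : E) (hav : a v = 0) (f : ℂ → ℂ) (z : E) :
    (shear a v hav f)⁻¹ z = z - f (a z) • v := rfl

lemma shear_mem_holAut (a : E →L[ℂ] ℂ) (v : E) (hav : a v = 0) {f : ℂ → ℂ}
    (hf : Differentiable ℂ f) : shear a v hav f ∈ holAut E := by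
  have h : Differentiable ℂ fun z => f (a z) • v := (hf.comp a.differentiable).smul_const v
  exact ⟨differentiable_id.add h, differentiable_id.sub h⟩

end Automorphisms

section VectorFields

variable {E : Type*} [NormedAddCommGroup E] [NormedSpace ℂ E]

/-- The family `S t` agrees with `z ↦ z + t V z` up to second order in `t`, uniformly on
bounded sets. -/
def IsFirstOrder (S : ℂ → E → E) (V : E → E) : Prop :=
  ∀ ρ : ℝ, ∃ C t₀ : ℝ, 0 ≤ C ∧ 0 < t₀ ∧ ∀ t : ℂ, ‖t‖ ≤ t₀ → ∀ z : E, ‖z‖ ≤ ρ →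
    ‖S t z - z - t • V z‖ ≤ C * ‖t‖ ^ 2

lemma IsFirstOrder.comp [FiniteDimensional ℂ E] {S T : ℂ → E → E} {V W : E → E}
    (hS : IsFirstOrder S V)
    (hT : IsFirstOrder T W) (hV : LocallyLipschitz V) (hW : Continuous W) :
    IsFirstOrder (fun t z => S t (T t z)) (fun z => V z + W z) := by
  have : ProperSpace E := FiniteDimensional.proper_rclike ℂ E
  intro ρ
  obtain ⟨C₁, t₁, hC₁, ht₁, hS⟩ := hS (ρ + 1)
  obtain ⟨C₂, t₂, hC₂, ht₂, hT⟩ := hT ρ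
  obtain ⟨M, hM⟩ := (isCompact_closedBall (0 : E) ρ).exists_bound_of_continuousOn hW.continuousOn
  obtain ⟨L, hL⟩ := (hV.locallyLipschitzOn (s := closedBall 0 (ρ + 1))
    ).exists_lipschitzOnWith_of_compact (isCompact_closedBall (0 : E) (ρ + 1))
  set M' : ℝ := max M 0 + C₂ with hM'
  have hM'0 : 0 ≤ M' := by positivity
  refine ⟨C₁ + C₂ + L * M', min (min t₁ t₂) (min 1 (M' + 1)⁻¹), by positivity, by positivity, ?_⟩
  intro t ht z hz
  simp only [le_min_iff] at ht
  obtain ⟨⟨h1, h2⟩, h3, h4⟩ := ht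
  have hTz := hT t h2 z hz
  have hWz : ‖W z‖ ≤ max M 0 := (hM z (by simpa using hz)).trans (le_max_left _ _)
  have hd : ‖T t z - z‖ ≤ ‖t‖ * M' := by
    calc ‖T t z - z‖ = ‖(T t z - z - t • W z) + t • W z‖ := by congr 1; abel
      _ ≤ C₂ * ‖t‖ ^ 2 + ‖t‖ * max M 0 := by
        refine (norm_add_le _ _).trans (add_le_add hTz ?_)
        rw [norm_smul]; gcongr
      _ ≤ C₂ * ‖t‖ + ‖t‖ * max M 0 := by
        gcongr
        nlinarith [norm_nonneg t]
      _ = ‖t‖ * M' := by rw [hM']; ring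
  have hd1 : ‖t‖ * M' ≤ 1 := by
    calc ‖t‖ * M' ≤ (M' + 1)⁻¹ * (M' + 1) := by gcongr; linarith
      _ = 1 := inv_mul_cancel₀ (by positivity)
  have hTb : ‖T t z‖ ≤ ρ + 1 := by
    calc ‖T t z‖ = ‖(T t z - z) + z‖ := by congr 1; abel
      _ ≤ ρ + 1 := (norm_add_le _ _).trans (by linarith)
  have hVd : ‖V (T t z) - V z‖ ≤ L * (‖t‖ * M') := by
    have := hL.dist_le_mul (T t z) (by simpa using hTb) z
      (by simp; linarith)
    rw [dist_eq_norm, dist_eq_norm] at this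
    exact this.trans (by gcongr)
  calc ‖S t (T t z) - z - t • (V z + W z)‖
      = ‖(S t (T t z) - T t z - t • V (T t z)) + (T t z - z - t • W z)
          + t • (V (T t z) - V z)‖ := by
        congr 1; simp only [smul_add, smul_sub]; abel
    _ ≤ C₁ * ‖t‖ ^ 2 + C₂ * ‖t‖ ^ 2 + ‖t‖ * (L * (‖t‖ * M')) := by
        refine (norm_add₃_le).trans (add_le_add (add_le_add (hS t h1 _ hTb) hTz) ?_)
        rw [norm_smul]; gcongr
    _ = (C₁ + C₂ + L * M') * ‖t‖ ^ 2 := by ring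

/-- `V` is the initial velocity of a family of automorphisms. -/
def IsAutVelocity (V : E → E) : Prop :=
  LocallyLipschitz V ∧ ∃ S : ℂ → Equiv.Perm E, (∀ t, S t ∈ holAut E) ∧
    IsFirstOrder (fun t => S t) V ∧ IsFirstOrder (fun t => ⇑(S t)⁻¹) (-V)

lemma IsAutVelocity.add [FiniteDimensional ℂ E] {V W : E → E} (hV : IsAutVelocity V)
    (hW : IsAutVelocity W) : IsAutVelocity (V + W) := by
  obtain ⟨hVl, S, hS, hS1, hS2⟩ := hV
  obtain ⟨hWl, T, hT, hT1, hT2⟩ := hW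
  refine ⟨hVl.add hWl, fun t => S t * T t, fun t => mul_mem (hS t) (hT t),
    hS1.comp hT1 hVl hWl.continuous, ?_⟩
  have := hT2.comp hS2 hWl.neg hVl.neg.continuous
  rw [neg_add_rev]
  simp only [mul_inv_rev]
  exact this

lemma isAutVelocity_shear (a : E →L[ℂ] ℂ) (v : E) (hav : a v = 0) {f : ℂ → ℂ}
    (hf : ContDiff ℂ 1 f) : IsAutVelocity fun z => f (a z) • v := by
  refine ⟨?_, fun t => shear a v hav (fun w => t * f w), fun t => shear_mem_holAut a v hav
    ((hf.differentiable one_ne_zero).const_mul t), fun ρ => ⟨0, 1, le_rfl, one_pos, ?_⟩,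
    fun ρ => ⟨0, 1, le_rfl, one_pos, ?_⟩⟩
  · exact ContDiff.locallyLipschitz (𝕂 := ℂ) ((hf.comp a.contDiff).smul contDiff_const)
  · intro t _ z _
    simp [shear_apply, mul_smul]
  · intro t _ z _
    simp [shear_inv_apply, mul_smul]

end VectorFields

section ExponentialSums

variable {E : Type*} [NormedAddCommGroup E] [NormedSpace ℂ E]

/-- Finite linear combinations of exponentials of linear functionals. -/
inductive IsExpSum : (E → ℂ) → Prop
  | exp (c : ℂ) (a : E →L[ℂ] ℂ) : IsExpSum fun z => c * Complex.exp (a z)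
  | add {f g : E → ℂ} : IsExpSum f → IsExpSum g → IsExpSum (f + g)

namespace IsExpSum

lemma const (c : ℂ) : IsExpSum fun _ : E => c := by
  simpa using IsExpSum.exp (E := E) c 0

lemma mul {f g : E → ℂ} (hf : IsExpSum f) (hg : IsExpSum g) : IsExpSum (f * g) := by
  induction hf with
  | exp c a =>
    induction hg with
    | exp d b =>
      convert IsExpSum.exp (c * d) (a + b) using 1
      ext z
      simp [Complex.exp_add]
      ring
    | add _ _ h₁ h₂ => rw [mul_add]; exact h₁.add h₂
  | add _ _ h₁ h₂ => rw [add_mul]; exact h₁.add h₂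

lemma const_mul (c : ℂ) {f : E → ℂ} (hf : IsExpSum f) : IsExpSum fun z => c * f z :=
  (const c).mul hf

lemma pow {f : E → ℂ} (hf : IsExpSum f) (n : ℕ) : IsExpSum (f ^ n) := by
  induction n with
  | zero => simpa using! const (E := E) 1
  | succ n ih => rw [pow_succ]; exact ih.mul hf

lemma differentiable {f : E → ℂ} (hf : IsExpSum f) : Differentiable ℂ f := by
  induction hf with
  | exp c a => fun_prop
  | add _ _ h₁ h₂ => exact h₁.add h₂

lemma contDiff {f : E → ℂ} (hf : IsExpSum f) : ContDiff ℂ 1 f := by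
  induction hf with
  | exp c a => fun_prop
  | add _ _ h₁ h₂ => exact h₁.add h₂

lemma mvPolynomial_eval {σ : Type*} {x : σ → E → ℂ} (hx : ∀ i, IsExpSum (x i))
    (p : MvPolynomial σ ℂ) : IsExpSum fun z => MvPolynomial.eval (fun i => x i z) p := by
  induction p using MvPolynomial.induction_on with
  | C c => simpa using const c
  | add p q hp hq => simpa using! hp.add hq
  | mul_X p i hp => simpa using! hp.mul (hx i)

end IsExpSum

/-- The vector field `z ↦ (∂_y h) x - (∂_x h) y`, the Hamiltonian field of `h` in the plane
spanned by `x` and `y`. -/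
def hamiltonianField (x y : E) (h : E → ℂ) (z : E) : E :=
  fderiv ℂ h z y • x - fderiv ℂ h z x • y

lemma IsExpSum.isAutVelocity_hamiltonianField [FiniteDimensional ℂ E] (x y : E) {h : E → ℂ}
    (hh : IsExpSum h) :
    IsAutVelocity (hamiltonianField x y h) := by
  induction hh with
  | exp c a =>
    have hd : ∀ z, fderiv ℂ (fun z => c * Complex.exp (a z)) z = (c * Complex.exp (a z)) • a := by
      intro z
      refine HasFDerivAt.fderiv ?_
      rw [← smul_smul]
      exact (a.hasFDerivAt (x := z)).cexp.const_mul c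
    have hav : a (a y • x - a x • y) = 0 := by simp [mul_comm]
    convert isAutVelocity_shear a _ hav (f := fun w => c * Complex.exp w) (by fun_prop) using 1
    ext z
    simp [hamiltonianField, hd, smul_sub, mul_smul]
  | @add f g hf hg h₁ h₂ =>
    convert h₁.add h₂ using 1
    ext z
    simp only [hamiltonianField, fderiv_add (hf.differentiable z) (hg.differentiable z),
      add_apply, add_smul, Pi.add_apply]
    abel

/-- Points outside `K` can be separated from `K` by exponential sums. -/
def IsExpConvex (K : Set E) : Prop :=
  ∀ q ∉ K, ∀ η > 0, ∃ h : E → ℂ, IsExpSum h ∧ h q = 1 ∧ ∀ z ∈ K, ‖h z‖ ≤ η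

lemma IsExpConvex.inter {K K' : Set E} (hK : IsExpConvex K) (hK' : IsExpConvex K') :
    IsExpConvex (K ∩ K') := by
  intro q hq η hη
  by_cases h : q ∈ K
  · obtain ⟨f, hf, hf1, hf2⟩ := hK' q (fun h' => hq ⟨h, h'⟩) η hη
    exact ⟨f, hf, hf1, fun z hz => hf2 z hz.2⟩
  · obtain ⟨f, hf, hf1, hf2⟩ := hK q h η hη
    exact ⟨f, hf, hf1, fun z hz => hf2 z hz.1⟩

lemma exists_expSum_of_norm_lt {K : Set E} {q : E} {c : ℝ} {h : E → ℂ} (hh : IsExpSum h)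
    (hc : 0 ≤ c) (hK : ∀ z ∈ K, ‖h z‖ ≤ c) (hq : c < ‖h q‖) {η : ℝ} (hη : 0 < η) :
    ∃ f : E → ℂ, IsExpSum f ∧ f q = 1 ∧ ∀ z ∈ K, ‖f z‖ ≤ η := by
  have hpos : 0 < ‖h q‖ := hc.trans_lt hq
  obtain ⟨N, hN⟩ := exists_pow_lt_of_lt_one hη ((div_lt_one hpos).2 hq)
  refine ⟨(fun z => (h q)⁻¹ * h z) ^ N, (hh.const_mul _).pow N, ?_, fun z hz => ?_⟩
  · simp [norm_pos_iff.1 hpos]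
  · refine le_trans ?_ hN.le
    simp only [Pi.pow_apply, norm_pow, norm_mul, norm_inv]
    rw [inv_mul_eq_div]
    gcongr
    exact hK z hz

lemma isExpConvex_sublevel {h : E → ℂ} (hh : IsExpSum h) {c : ℝ} (hc : 0 ≤ c) :
    IsExpConvex {z | ‖h z‖ ≤ c} := fun _ hq _ hη =>
  exists_expSum_of_norm_lt hh hc (fun _ hz => hz) (not_le.1 hq) hη

lemma isExpConvex_closedBall {r : ℝ} (hr : 0 ≤ r) : IsExpConvex (closedBall (0 : E) r) := by
  intro q hq η hη
  have hq' : r < ‖q‖ := by simpa using hq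
  obtain ⟨b, hb, hbq⟩ := exists_dual_vector ℂ q (hr.trans_lt hq').ne'
  refine exists_expSum_of_norm_lt (IsExpSum.exp 1 b) (Real.exp_pos r).le (fun z hz => ?_) ?_ hη
  · rw [one_mul, Complex.norm_exp, Real.exp_le_exp]
    calc (b z).re ≤ ‖b z‖ := Complex.re_le_norm _
      _ ≤ ‖b‖ * ‖z‖ := b.le_opNorm z
      _ ≤ r := by rw [hb, one_mul]; simpa using hz
  · rw [one_mul, Complex.norm_exp, Real.exp_lt_exp, hbq]
    simpa using hq'

lemma IsExpConvex.insert {K : Set E} (hK : IsCompact K) (hKc : IsExpConvex K) (a : E) :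
    IsExpConvex (insert a K) := by
  intro q hq η hη
  simp only [mem_insert_iff, not_or] at hq
  have hqa : ‖q - a‖ ≠ 0 := norm_ne_zero_iff.2 (sub_ne_zero.2 hq.1)
  obtain ⟨b, -, hb⟩ := exists_dual_vector ℂ (q - a) hqa
  set b' : E →L[ℂ] ℂ := ((‖q - a‖ : ℂ)⁻¹) • b with hb'
  have hb1 : b' q = b' a + 1 := by
    have : b' (q - a) = 1 := by
      simp only [hb', smul_apply, hb, smul_eq_mul]
      exact inv_mul_cancel₀ (by exact_mod_cast hqa)
    rw [map_sub] at this
    rw [← this]; ring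
  set l : E → ℂ := fun z => (Complex.exp (b' q) - Complex.exp (b' a))⁻¹ *
    (Complex.exp (b' z) + -Complex.exp (b' a)) with hl
  have hle : IsExpSum l := by
    refine IsExpSum.const_mul _ ?_
    have := (IsExpSum.exp 1 b').add (IsExpSum.const (E := E) (-Complex.exp (b' a)))
    simpa using! this
  have hne : Complex.exp (b' q) - Complex.exp (b' a) ≠ 0 := by
    rw [hb1, Complex.exp_add, ← mul_sub_one]
    refine mul_ne_zero (Complex.exp_ne_zero _) (sub_ne_zero.2 fun h => ?_)
    have := congrArg norm h
    rw [Complex.norm_exp] at this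
    simp at this
  have hlq : l q = 1 := by
    simp only [hl, ← sub_eq_add_neg]
    exact inv_mul_cancel₀ hne
  have hla : l a = 0 := by simp [hl]
  obtain ⟨M, hM⟩ := hK.exists_bound_of_continuousOn hle.differentiable.continuous.continuousOn
  obtain ⟨h, hh, hh1, hh2⟩ := hKc q hq.2 (η / (|M| + 1)) (by positivity)
  refine ⟨h * l, hh.mul hle, by simp [hh1, hlq], ?_⟩
  rintro z (rfl | hz)
  · simpa [hla] using hη.le
  · calc ‖(h * l) z‖ = ‖h z‖ * ‖l z‖ := norm_mul _ _
      _ ≤ η / (|M| + 1) * (|M| + 1) := by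
        refine mul_le_mul (hh2 z hz) ?_ (norm_nonneg _) (by positivity)
        exact (hM z hz).trans ((le_abs_self M).trans (by linarith))
      _ = η := by field_simp

lemma IsExpConvex.union_finite {K : Set E} (hK : IsCompact K) (hKc : IsExpConvex K) {L : Set E}
    (hL : L.Finite) : IsExpConvex (K ∪ L) := by
  induction L, hL using Set.Finite.induction_on with
  | empty => simpa using hKc
  | @insert a L _ hL ih =>
    rw [union_insert]
    exact ih.insert (hK.union hL.isCompact) a

lemma IsExpConvex.exists_compact_neighborhood [FiniteDimensional ℂ E] {K : Set E}
    (hK : IsCompact K) (hKc : IsExpConvex K) {L : Set E} (hL : L.Finite) (hKL : L ⊆ Kᶜ) :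
    ∃ K', IsCompact K' ∧ IsExpConvex K' ∧ K ⊆ interior K' ∧ L ⊆ K'ᶜ := by
  have : ProperSpace E := FiniteDimensional.proper_rclike ℂ E
  induction L, hL using Set.Finite.induction_on with
  | empty =>
    obtain ⟨r, hr, hKr⟩ := hK.isBounded.subset_ball_lt 0 0
    exact ⟨closedBall 0 r, isCompact_closedBall 0 r, isExpConvex_closedBall hr.le,
      hKr.trans ball_subset_interior_closedBall, empty_subset _⟩
  | @insert a L _ hL ih =>
    obtain ⟨K', hK', hK'c, hKK', hLK'⟩ := ih ((subset_insert _ _).trans hKL)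
    obtain ⟨h, hh, hha, hhK⟩ := hKc a (hKL (mem_insert _ _)) (1 / 4) (by norm_num)
    have hcont : Continuous fun z => ‖h z‖ := hh.differentiable.continuous.norm
    refine ⟨K' ∩ {z | ‖h z‖ ≤ 1 / 2}, hK'.inter_right (isClosed_le hcont continuous_const),
      hK'c.inter (isExpConvex_sublevel hh (by norm_num)), ?_, ?_⟩
    · rw [interior_inter]
      refine subset_inter hKK' (Subset.trans ?_ (interior_maximal (t := {z | ‖h z‖ < 1 / 2})
        (fun z (hz : ‖h z‖ < 1 / 2) => hz.le) (isOpen_lt hcont continuous_const)))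
      intro z hz
      exact (hhK z hz).trans_lt (by norm_num)
    · rintro z (rfl | hz) hz'
      · have := hz'.2
        simp only [mem_ofPred_eq, hha] at this
        norm_num at this
      · exact hLK' hz hz'.1

end ExponentialSums

section PolynomialConvexity

lemma isExpSum_mul_dslope {n : ℕ} {ε : ℂ} (hε : ε ≠ 0) (i : Fin n) :
    IsExpSum fun z : EuclideanSpace ℂ (Fin n) => z i * dslope Complex.exp 0 (ε * z i) := by
  have h := (IsExpSum.exp ε⁻¹ (ε • EuclideanSpace.proj i : EuclideanSpace ℂ (Fin n) →L[ℂ] ℂ)).add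
    (IsExpSum.const (-ε⁻¹))
  convert h using 1
  ext z
  by_cases hz : z i = 0
  · simp [hz]
  · rw [dslope_of_ne _ (mul_ne_zero hε hz), slope_def_field]
    simp
    field_simp
    ring

lemma IsPolynomiallyConvex.isExpConvex {n : ℕ} {K : Set (EuclideanSpace ℂ (Fin n))}
    (hK : IsCompact K) (hKp : IsPolynomiallyConvex K) : IsExpConvex K := by
  intro q hq η hη
  rcases K.eq_empty_or_nonempty with rfl | ⟨w₀, hw₀⟩
  · exact ⟨_, IsExpSum.const 1, rfl, by simp⟩
  rw [← hKp] at hq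
  simp only [polyHull, mem_ofPred_eq, not_forall, not_le] at hq
  obtain ⟨p, c, hpK, hpq⟩ := hq
  have hc : 0 ≤ c := (norm_nonneg _).trans (hpK w₀ hw₀)
  obtain ⟨c', hcc', hc'⟩ := exists_between hpq
  set Q : ℂ → EuclideanSpace ℂ (Fin n) → ℂ := fun ε z =>
    MvPolynomial.eval (fun i => z i * dslope Complex.exp 0 (ε * z i)) p with hQ
  have hds : Continuous (dslope Complex.exp 0) := continuous_iff_continuousAt.2 fun w => by
    by_cases hw : w = 0
    · rw [hw, continuousAt_dslope_same]
      exact Complex.differentiable_exp 0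
    · rw [continuousAt_dslope_of_ne hw]
      exact Complex.continuous_exp.continuousAt
  have hQc : Continuous fun x : ℂ × EuclideanSpace ℂ (Fin n) => Q x.1 x.2 := by
    refine (MvPolynomial.continuous_eval p).comp (continuous_pi fun i => ?_)
    have : Continuous fun x : ℂ × EuclideanSpace ℂ (Fin n) => x.2 i := by fun_prop
    exact this.mul (hds.comp (continuous_fst.mul this))
  have hQ0 : ∀ z, Q 0 z = MvPolynomial.eval (fun i => z i) p := by
    intro z
    simp [hQ]
  have h1 : ∀ᶠ ε in 𝓝 (0 : ℂ), ∀ z ∈ K, ‖Q ε z‖ < c' := by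
    refine hK.eventually_forall_of_forall_eventually fun z hz => ?_
    refine (hQc.norm.continuousAt (x := ((0 : ℂ), z))).eventually_lt continuousAt_const ?_
    simpa only [hQ0] using (hpK z hz).trans_lt hcc'
  have h2 : ∀ᶠ ε in 𝓝 (0 : ℂ), c' < ‖Q ε q‖ := by
    refine continuousAt_const.eventually_lt
      (f := fun _ => c') (g := fun ε => ‖Q ε q‖) (x₀ := (0 : ℂ)) ?_ ?_
    · exact (hQc.comp (continuous_id.prodMk continuous_const)).norm.continuousAt
    · simpa only [hQ0] using hc'
  obtain ⟨ε, ⟨h1, h2⟩, hε⟩ := (((h1.and h2).filter_mono nhdsWithin_le_nhds).and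
    (self_mem_nhdsWithin (a := (0 : ℂ)) (s := {0}ᶜ))).exists
  exact exists_expSum_of_norm_lt
    (IsExpSum.mvPolynomial_eval (fun i => isExpSum_mul_dslope hε i) p) (hc.trans hcc'.le)
    (fun z hz => (h1 z hz).le) h2 hη

end PolynomialConvexity

section Cutoff

variable {E : Type*} [NormedAddCommGroup E] [NormedSpace ℂ E]

/-- The cubic with superattracting fixed points `0` and `1`. -/
def smoothstep (w : ℂ) : ℂ := w ^ 2 * (3 - 2 * w)

lemma one_sub_smoothstep (w : ℂ) : 1 - smoothstep w = smoothstep (1 - w) := by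
  simp only [smoothstep]; ring

lemma norm_smoothstep_le {w : ℂ} (hw : ‖w‖ ≤ 1 / 10) : ‖smoothstep w‖ ≤ 2 / 3 * ‖w‖ := by
  have h : ‖(3 - 2 * w : ℂ)‖ ≤ 4 := by
    refine (norm_sub_le _ _).trans ?_
    simp only [norm_mul, Complex.norm_ofNat]
    linarith
  rw [smoothstep, norm_mul, norm_pow, sq]
  calc ‖w‖ * ‖w‖ * ‖(3 - 2 * w : ℂ)‖ ≤ 1 / 10 * ‖w‖ * 4 := by gcongr
    _ ≤ 2 / 3 * ‖w‖ := by linarith [norm_nonneg w]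

lemma norm_deriv_smoothstep_le {w : ℂ} (hw : ‖w‖ ≤ 1 / 10) : ‖6 * w * (1 - w)‖ ≤ 2 / 3 := by
  have h : ‖1 - w‖ ≤ 11 / 10 := by
    refine (norm_sub_le _ _).trans ?_
    rw [norm_one]
    linarith
  simp only [norm_mul, Complex.norm_ofNat]
  calc 6 * ‖w‖ * ‖1 - w‖ ≤ 6 * (1 / 10) * (11 / 10) := by gcongr
    _ ≤ 2 / 3 := by norm_num

lemma hasDerivAt_smoothstep (w : ℂ) : HasDerivAt smoothstep (6 * w * (1 - w)) w := by
  have h := ((hasDerivAt_id w).pow 2).mul (((hasDerivAt_id w).const_mul 2).const_sub 3)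
  refine HasDerivAt.congr_deriv (f := smoothstep) h ?_
  simp only [id, Pi.pow_apply, Nat.cast_ofNat, Nat.add_one_sub_one]
  ring

lemma IsExpSum.smoothstep_iterate {h : E → ℂ} (hh : IsExpSum h) (N : ℕ) :
    IsExpSum fun z => smoothstep^[N] (h z) := by
  induction N with
  | zero => exact hh
  | succ N ih =>
    simp only [Function.iterate_succ_apply']
    have := (ih.pow 2).mul ((IsExpSum.const 3).add (ih.const_mul (-2)))
    convert this using 1
    ext z
    simp only [smoothstep, Pi.mul_apply, Pi.pow_apply, Pi.add_apply]
    ring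

lemma fderiv_smoothstep_iterate_succ {h : E → ℂ} (hh : IsExpSum h) (N : ℕ) (z : E) :
    fderiv ℂ (fun z => smoothstep^[N + 1] (h z)) z =
      (6 * smoothstep^[N] (h z) * (1 - smoothstep^[N] (h z))) •
        fderiv ℂ (fun z => smoothstep^[N] (h z)) z := by
  simp only [Function.iterate_succ_apply']
  exact ((hasDerivAt_smoothstep _).comp_hasFDerivAt z
    ((hh.smoothstep_iterate N).differentiable z).hasFDerivAt).fderiv

lemma smoothstep_iterate_bounds_zero {h : E → ℂ} (hh : IsExpSum h) {z : E} (hz : ‖h z‖ ≤ 1 / 10)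
    (N : ℕ) :
    ‖smoothstep^[N] (h z)‖ ≤ (2 / 3) ^ N * (1 / 10) ∧
      ‖fderiv ℂ (fun z => smoothstep^[N] (h z)) z‖ ≤ (2 / 3) ^ N * ‖fderiv ℂ h z‖ := by
  induction N with
  | zero => simpa using hz
  | succ N ih =>
    have hs : ‖smoothstep^[N] (h z)‖ ≤ 1 / 10 :=
      ih.1.trans (mul_le_of_le_one_left (by norm_num) (pow_le_one₀ (by norm_num) (by norm_num)))
    rw [fderiv_smoothstep_iterate_succ hh, Function.iterate_succ_apply', norm_smul, pow_succ']
    refine ⟨(norm_smoothstep_le hs).trans (by linarith [ih.1]), ?_⟩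
    rw [mul_assoc (2 / 3 : ℝ)]
    exact mul_le_mul (norm_deriv_smoothstep_le hs) ih.2 (norm_nonneg _) (by norm_num)

lemma smoothstep_iterate_bounds_one {h : E → ℂ} (hh : IsExpSum h) {z : E}
    (hz : ‖1 - h z‖ ≤ 1 / 10) (N : ℕ) :
    ‖1 - smoothstep^[N] (h z)‖ ≤ (2 / 3) ^ N * (1 / 10) ∧
      ‖fderiv ℂ (fun z => smoothstep^[N] (h z)) z‖ ≤ (2 / 3) ^ N * ‖fderiv ℂ h z‖ := by
  induction N with
  | zero => simpa using hz
  | succ N ih =>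
    have hs : ‖1 - smoothstep^[N] (h z)‖ ≤ 1 / 10 :=
      ih.1.trans (mul_le_of_le_one_left (by norm_num) (pow_le_one₀ (by norm_num) (by norm_num)))
    rw [fderiv_smoothstep_iterate_succ hh, Function.iterate_succ_apply', norm_smul, pow_succ',
      one_sub_smoothstep]
    refine ⟨(norm_smoothstep_le hs).trans (by linarith [ih.1]), ?_⟩
    rw [mul_assoc (2 / 3 : ℝ)]
    refine mul_le_mul ?_ ih.2 (norm_nonneg _) (by norm_num)
    have := norm_deriv_smoothstep_le hs
    rwa [sub_sub_cancel, mul_right_comm] at this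

lemma exists_cutoff [FiniteDimensional ℂ E] {K : Set E} (hK : IsCompact K) (hKc : IsExpConvex K)
    {q : E} (hq : q ∉ K) :
    ∃ r > 0, ∃ δ > 0, ∀ η > 0, ∃ χ : E → ℂ, IsExpSum χ ∧
      (∀ z ∈ cthickening δ K, ‖χ z‖ ≤ η ∧ ‖fderiv ℂ χ z‖ ≤ η) ∧
      ∀ z ∈ closedBall q r, ‖1 - χ z‖ ≤ η ∧ ‖fderiv ℂ χ z‖ ≤ η := by
  have : ProperSpace E := FiniteDimensional.proper_rclike ℂ E
  obtain ⟨h, hh, hhq, hhK⟩ := hKc q hq (1 / 20) (by norm_num)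
  have hcont : Continuous h := hh.differentiable.continuous
  obtain ⟨δ, hδ, hKδ⟩ := hK.exists_cthickening_subset_open
    (isOpen_lt hcont.norm continuous_const : IsOpen {z | ‖h z‖ < 1 / 10})
    (fun z hz => show ‖h z‖ < 1 / 10 from (hhK z hz).trans_lt (by norm_num))
  obtain ⟨r, hr, hqr⟩ := nhds_basis_closedBall.mem_iff.1
    ((isOpen_lt (continuous_const.sub hcont).norm continuous_const :
      IsOpen {z | ‖1 - h z‖ < 1 / 10}).mem_nhds (show ‖1 - h q‖ < 1 / 10 by simp [hhq]))
  have hc' : Continuous (fderiv ℂ h) := hh.contDiff.continuous_fderiv one_ne_zero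
  obtain ⟨M, hM⟩ := (hK.cthickening (r := δ)).union (isCompact_closedBall q r)
    |>.exists_bound_of_continuousOn hc'.continuousOn
  refine ⟨r, hr, δ, hδ, fun η hη => ?_⟩
  obtain ⟨N, hN⟩ := exists_pow_lt_of_lt_one (show 0 < η / (|M| + 1) by positivity)
    (show (2 / 3 : ℝ) < 1 by norm_num)
  have hN' : (2 / 3 : ℝ) ^ N * (|M| + 1) ≤ η := ((lt_div_iff₀ (by positivity)).1 hN).le
  have hp : (0 : ℝ) ≤ (2 / 3) ^ N := by positivity
  have hb : ∀ x : ℝ, x ≤ |M| + 1 → (2 / 3 : ℝ) ^ N * x ≤ η := fun x hx =>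
    (mul_le_mul_of_nonneg_left hx hp).trans hN'
  have hM' : ∀ z ∈ cthickening δ K ∪ closedBall q r, ‖fderiv ℂ h z‖ ≤ |M| + 1 := fun z hz =>
    (hM z hz).trans ((le_abs_self M).trans (by linarith))
  have h10 : (1 / 10 : ℝ) ≤ |M| + 1 := by linarith [abs_nonneg M]
  refine ⟨_, hh.smoothstep_iterate N, fun z hz => ?_, fun z hz => ?_⟩
  · have := smoothstep_iterate_bounds_zero hh (le_of_lt (hKδ hz)) N
    exact ⟨this.1.trans (hb _ h10), this.2.trans (hb _ (hM' z (Or.inl hz)))⟩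
  · have := smoothstep_iterate_bounds_one hh (le_of_lt (hqr hz)) N
    exact ⟨this.1.trans (hb _ h10), this.2.trans (hb _ (hM' z (Or.inr hz)))⟩

lemma exists_functional_apply_eq_zero [FiniteDimensional ℂ E] (hE : 1 < Module.finrank ℂ E)
    (u : E) : ∃ (b : E →L[ℂ] ℂ) (y : E), b u = 0 ∧ b y = 1 := by
  have hlt : Submodule.span ℂ {u} < ⊤ := by
    refine lt_top_iff_ne_top.2 fun h => ?_
    have := finrank_span_le_card (R := ℂ) ({u} : Set E)
    rw [h, finrank_top, toFinset_singleton, Finset.card_singleton] at this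
    omega
  obtain ⟨f, hf, hfu⟩ := Submodule.exists_le_ker_of_lt_top _ hlt
  obtain ⟨y, hy⟩ := DFunLike.ne_iff.1 hf
  refine ⟨f.toContinuousLinearMap, (f y)⁻¹ • y, ?_, ?_⟩
  · exact hfu (Submodule.mem_span_singleton_self u)
  · simpa using inv_mul_cancel₀ hy

lemma exists_isAutVelocity [FiniteDimensional ℂ E] (hE : 1 < Module.finrank ℂ E) {K : Set E}
    (hK : IsCompact K) (hKc : IsExpConvex K) {q : E} (hq : q ∉ K) :
    ∃ r > 0, ∃ δ > 0, ∀ u : E, ∀ η > 0, ∃ V : E → E, IsAutVelocity V ∧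
      (∀ z ∈ cthickening δ K, ‖V z‖ ≤ η) ∧ ∀ z ∈ closedBall q r, ‖V z - u‖ ≤ η := by
  have : ProperSpace E := FiniteDimensional.proper_rclike ℂ E
  obtain ⟨r, hr, δ, hδ, hχ⟩ := exists_cutoff hK hKc hq
  refine ⟨r, hr, δ, hδ, fun u η hη => ?_⟩
  obtain ⟨b, y, hbu, hby⟩ := exists_functional_apply_eq_zero hE u
  have hev : ∀ᶠ ε in 𝓝 (0 : ℂ), ∀ z ∈ closedBall q r,
      ‖Complex.exp (ε * (b z - b q)) - 1‖ * ‖u‖ < η / 2 := by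
    refine (isCompact_closedBall q r).eventually_forall_of_forall_eventually fun z hz => ?_
    refine ContinuousAt.eventually_lt (f := fun x : ℂ × E =>
      ‖Complex.exp (x.1 * (b x.2 - b q)) - 1‖ * ‖u‖) ?_ continuousAt_const ?_
    · fun_prop
    · simpa using half_pos hη
  obtain ⟨ε, hεu, hε⟩ := ((hev.filter_mono nhdsWithin_le_nhds).and
    (self_mem_nhdsWithin (a := (0 : ℂ)) (s := {0}ᶜ))).exists
  set e : E → ℂ := fun z => Complex.exp (ε * (b z - b q)) with he
  set l : E → ℂ := fun z => ε⁻¹ * e z with hl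
  have hle : IsExpSum l := by
    convert IsExpSum.exp (ε⁻¹ * Complex.exp (-(ε * b q))) (ε • b) using 1
    ext z
    simp only [hl, he, mul_assoc, ← Complex.exp_add, smul_apply, smul_eq_mul]
    ring_nf
  have hdl : ∀ z, fderiv ℂ l z = e z • b := by
    intro z
    refine HasFDerivAt.fderiv ?_
    have h1 : HasFDerivAt (fun z => ε * (b z - b q)) (ε • b) z :=
      ((b.hasFDerivAt (x := z)).sub_const (b q)).const_mul ε
    have h2 := h1.cexp.const_mul ε⁻¹
    rwa [smul_comm, inv_smul_smul₀ hε] at h2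
  have hec : Continuous e := by fun_prop
  obtain ⟨B, hB⟩ := (hK.cthickening (r := δ)).union (isCompact_closedBall q r)
    |>.exists_bound_of_continuousOn hec.continuousOn
  obtain ⟨B', hB'⟩ := (hK.cthickening (r := δ)).union (isCompact_closedBall q r)
    |>.exists_bound_of_continuousOn hle.differentiable.continuous.continuousOn
  set D : ℝ := |B| * ‖u‖ + |B'| * (2 * (‖y‖ * ‖u‖)) with hD
  have hD0 : 0 ≤ D := by positivity
  set η' : ℝ := η / (2 * (D + 1)) with hη'
  have hη'0 : 0 < η' := by positivity
  have hη'D : η' * D ≤ η / 2 := by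
    rw [hη', div_mul_eq_mul_div, div_le_iff₀ (by positivity)]
    nlinarith
  obtain ⟨χ, hχe, hχK, hχq⟩ := hχ η' hη'0
  have hV : ∀ z, hamiltonianField u y (χ * l) z = (χ z * e z) • u +
      l z • (fderiv ℂ χ z y • u - fderiv ℂ χ z u • y) := by
    intro z
    rw [hamiltonianField, fderiv_mul (hχe.differentiable z) (hle.differentiable z), hdl]
    simp only [add_apply, smul_apply, smul_eq_mul, hbu, hby, mul_zero, mul_one, zero_add,
      add_smul, smul_sub, mul_smul]
    abel
  have hrest : ∀ z ∈ cthickening δ K ∪ closedBall q r, ‖fderiv ℂ χ z‖ ≤ η' →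
      ‖l z • (fderiv ℂ χ z y • u - fderiv ℂ χ z u • y)‖ ≤ η' * (|B'| * (2 * (‖y‖ * ‖u‖))) := by
    intro z hz hχz
    have h1 : ‖fderiv ℂ χ z y • u‖ ≤ η' * ‖y‖ * ‖u‖ := by
      rw [norm_smul]
      gcongr
      exact (ContinuousLinearMap.le_opNorm _ _).trans (by gcongr)
    have h2 : ‖fderiv ℂ χ z u • y‖ ≤ η' * ‖u‖ * ‖y‖ := by
      rw [norm_smul]
      gcongr
      exact (ContinuousLinearMap.le_opNorm _ _).trans (by gcongr)
    rw [norm_smul]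
    calc ‖l z‖ * ‖fderiv ℂ χ z y • u - fderiv ℂ χ z u • y‖
        ≤ |B'| * (η' * ‖y‖ * ‖u‖ + η' * ‖u‖ * ‖y‖) := by
          gcongr
          · exact (hB' z hz).trans (le_abs_self _)
          · exact (norm_sub_le _ _).trans (add_le_add h1 h2)
      _ = η' * (|B'| * (2 * (‖y‖ * ‖u‖))) := by ring
  have hmain : ∀ z ∈ cthickening δ K ∪ closedBall q r, ∀ w : ℂ, ‖w‖ ≤ η' →
      ‖(w * e z) • u‖ ≤ η' * (|B| * ‖u‖) := by
    intro z hz w hw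
    rw [norm_smul, norm_mul, mul_assoc]
    gcongr
    exact (hB z hz).trans (le_abs_self _)
  refine ⟨_, (hχe.mul hle).isAutVelocity_hamiltonianField u y, fun z hz => ?_, fun z hz => ?_⟩
  · have hz' : z ∈ cthickening δ K ∪ closedBall q r := Or.inl hz
    rw [hV]
    refine (norm_add_le _ _).trans ?_
    have h1 := hmain z hz' _ (hχK z hz).1
    have h2 := hrest z hz' (hχK z hz).2
    rw [hD, mul_add] at hη'D
    linarith
  · have hz' : z ∈ cthickening δ K ∪ closedBall q r := Or.inr hz
    have h1 := hmain z hz' _ (hχq z hz).1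
    have h2 := hrest z hz' (hχq z hz).2
    have h3 : ‖(e z - 1) • u‖ ≤ η / 2 := by rw [norm_smul]; exact (hεu z hz).le
    rw [hD, mul_add] at hη'D
    calc ‖hamiltonianField u y (χ * l) z - u‖
        = ‖(e z - 1) • u - ((1 - χ z) * e z) • u +
            l z • (fderiv ℂ χ z y • u - fderiv ℂ χ z u • y)‖ := by
          rw [hV]; congr 1; rw [← sub_smul]
          have : e z - 1 - (1 - χ z) * e z = χ z * e z - 1 := by ring
          rw [this, sub_smul, one_smul]; abel
      _ ≤ η := by
          refine (norm_add_le _ _).trans ?_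
          have := norm_sub_le ((e z - 1) • u) (((1 - χ z) * e z) • u)
          linarith

end Cutoff

section Pushing

variable {E : Type*} [NormedAddCommGroup E] [NormedSpace ℂ E]

lemma norm_iterate_sub_le {f : E → E} {A : Set E} {z₀ w : E} {N : ℕ} (hN : 0 < N) {e : ℝ}
    (he : 0 ≤ e) (hf : ∀ z ∈ A, ‖f z - z - (N : ℂ)⁻¹ • w‖ ≤ e / N)
    (hA : ∀ x, ‖x - z₀‖ ≤ ‖w‖ + e → x ∈ A) {k : ℕ} (hk : k ≤ N) :
    ‖f^[k] z₀ - z₀ - ((k : ℂ) / N) • w‖ ≤ k / N * e := by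
  have hN' : (0 : ℝ) < N := by exact_mod_cast hN
  induction k with
  | zero => simp
  | succ k ih =>
    have ih := ih (by omega)
    have hk1 : (k : ℝ) / N ≤ 1 := by
      rw [div_le_one hN']
      exact_mod_cast (by omega : k ≤ N)
    have hkA : f^[k] z₀ ∈ A := by
      refine hA _ ?_
      calc ‖f^[k] z₀ - z₀‖
          = ‖(f^[k] z₀ - z₀ - ((k : ℂ) / N) • w) + ((k : ℂ) / N) • w‖ := by congr 1; abel
        _ ≤ k / N * e + k / N * ‖w‖ := by
          refine (norm_add_le _ _).trans (add_le_add ih ?_)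
          rw [norm_smul]
          simp
        _ ≤ 1 * e + 1 * ‖w‖ := by gcongr
        _ = ‖w‖ + e := by ring
    rw [Function.iterate_succ_apply']
    calc ‖f (f^[k] z₀) - z₀ - (((k + 1 : ℕ) : ℂ) / N) • w‖
        = ‖(f (f^[k] z₀) - f^[k] z₀ - (N : ℂ)⁻¹ • w) +
            (f^[k] z₀ - z₀ - ((k : ℂ) / N) • w)‖ := by
          congr 1
          push_cast
          rw [add_div, add_smul, one_div]
          abel
      _ ≤ e / N + k / N * e := (norm_add_le _ _).trans (add_le_add (hf _ hkA) ih)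
      _ = ((k + 1 : ℕ) : ℝ) / N * e := by push_cast; ring

lemma norm_iterate_sub_le_of_forall_norm_le {f : E → E} {A : Set E} {z₀ w : E} {N : ℕ}
    (hN : 0 < N) {e : ℝ} (he : 0 ≤ e) (hf : ∀ z ∈ A, ‖f z - z - (N : ℂ)⁻¹ • w‖ ≤ e / N)
    (hA : ∀ x, ‖x - z₀‖ ≤ ‖w‖ + e → x ∈ A) : ‖f^[N] z₀ - z₀ - w‖ ≤ e := by
  have hN' : (N : ℝ) ≠ 0 := by exact_mod_cast hN.ne'
  have hN'' : (N : ℂ) ≠ 0 := by exact_mod_cast hN.ne'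
  simpa [div_self hN', div_self hN''] using norm_iterate_sub_le hN he hf hA le_rfl

lemma IsFirstOrder.eventually_norm_step_le {S : ℂ → E → E} {V : E → E} (h : IsFirstOrder S V)
    {B : Set E} (hB : Bornology.IsBounded B) {η : ℝ} (hη : 0 < η) :
    ∀ᶠ N : ℕ in atTop, ∀ z ∈ B, ∀ w, ‖V z - w‖ ≤ η →
      ‖S (N : ℂ)⁻¹ z - z - (N : ℂ)⁻¹ • w‖ ≤ 2 * η / N := by
  obtain ⟨ρ, hρ⟩ := hB.exists_norm_le
  obtain ⟨C, t₀, hC, ht₀, h⟩ := h ρ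
  have ht : Tendsto (fun N : ℕ => (N : ℝ)⁻¹) atTop (𝓝 0) := tendsto_inv_atTop_nhds_zero_nat
  have h1 := ht.eventually_lt_const ht₀
  have h2 := (ht.const_mul C).eventually_lt_const (by simpa using hη : C * 0 < η)
  filter_upwards [h1, h2] with N h1 h2 z hz w hw
  have hn : ‖(N : ℂ)⁻¹‖ = (N : ℝ)⁻¹ := by simp
  have := h (N : ℂ)⁻¹ (by rw [hn]; exact h1.le) z (hρ z hz)
  rw [hn] at this
  calc ‖S (N : ℂ)⁻¹ z - z - (N : ℂ)⁻¹ • w‖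
      = ‖(S (N : ℂ)⁻¹ z - z - (N : ℂ)⁻¹ • V z) + (N : ℂ)⁻¹ • (V z - w)‖ := by
        congr 1; rw [smul_sub]; abel
    _ ≤ C * (N : ℝ)⁻¹ ^ 2 + (N : ℝ)⁻¹ * η := by
        refine (norm_add_le _ _).trans (add_le_add this ?_)
        rw [norm_smul, hn]
        gcongr
    _ = (C * (N : ℝ)⁻¹) * (N : ℝ)⁻¹ + (N : ℝ)⁻¹ * η := by ring
    _ ≤ η * (N : ℝ)⁻¹ + (N : ℝ)⁻¹ * η := by gcongr
    _ = 2 * η / N := by ring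

lemma exists_nearId_lt_norm_of_apply_eq {K : Set E} {x y : E} {R δ : ℝ} (hδ : 0 < δ)
    (hxy : ∀ ε > 0, ∃ φ ∈ holAut E, NearId φ (cthickening δ K) ε ∧ φ x = y)
    (hy : ∃ δ > 0, ∀ ε > 0, ∃ φ ∈ holAut E, NearId φ (cthickening δ K) ε ∧ R < ‖φ y‖) :
    ∃ δ > 0, ∀ ε > 0, ∃ φ ∈ holAut E, NearId φ (cthickening δ K) ε ∧ R < ‖φ x‖ := by
  obtain ⟨δ', hδ', hy⟩ := hy
  set d := min δ δ' with hd
  have hd0 : 0 < d := lt_min hδ hδ'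
  refine ⟨d / 2, by positivity, fun ε hε => ?_⟩
  obtain ⟨φ, hφ, hφK, hφx⟩ := hxy (min (ε / 2) (d / 2)) (by positivity)
  obtain ⟨ψ, hψ, hψK, hψy⟩ := hy (min (ε / 2) (d / 2)) (by positivity)
  refine ⟨ψ * φ, mul_mem hψ hφ, ?_, by simpa [hφx] using hψy⟩
  refine ((hψK.mono (cthickening_mono (min_le_right _ _) K) le_rfl).mul (by positivity)
    (hφK.mono (cthickening_mono (min_le_left _ _) K) le_rfl) fun z hz w hw => ?_).mono subset_rfl
    (by linarith [min_le_left (ε / 2) (d / 2)])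
  exact cthickening_mono (by linarith) K (mem_cthickening_add (by positivity) (by positivity)
      hz (hw.trans (min_le_right _ _)))

variable [FiniteDimensional ℂ E]

lemma exists_nearId_apply_eq (hE : 1 < Module.finrank ℂ E) {K : Set E}
    (hK : IsCompact K) (hKc : IsExpConvex K) {q : E} (hq : q ∉ K) :
    ∃ r > 0, ∃ δ > 0, ∀ x ∈ ball q r, ∀ y ∈ ball q r, ∀ ε > 0,
      ∃ φ ∈ holAut E, NearId φ (cthickening δ K) ε ∧ φ x = y := by
  obtain ⟨r, hr, δ, hδ, hV⟩ := exists_isAutVelocity hE hK hKc hq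
  refine ⟨r / 4, by positivity, δ / 4, by positivity, fun x hx y hy ε hε => ?_⟩
  rw [mem_ball, dist_eq_norm] at hx hy
  set η : ℝ := min (min (ε / 4) (r / 8)) (δ / 8) with hη
  have hη0 : 0 < η := by positivity
  have hηε : η ≤ ε / 4 := (min_le_left _ _).trans (min_le_left _ _)
  have hηr : η ≤ r / 8 := (min_le_left _ _).trans (min_le_right _ _)
  have hηδ : η ≤ δ / 8 := min_le_right _ _
  obtain ⟨V, ⟨-, S, hS, hS1, hS2⟩, hVK, hVq⟩ := hV (y - x) η hη0
  have hB : Bornology.IsBounded (cthickening δ K ∪ closedBall q r) :=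
    hK.isBounded.cthickening.union isBounded_closedBall
  obtain ⟨N, ⟨h1, h2⟩, hN⟩ := (((hS1.eventually_norm_step_le hB hη0).and
    (hS2.eventually_norm_step_le hB hη0)).and (eventually_gt_atTop 0)).exists
  set σ : Equiv.Perm E := S (N : ℂ)⁻¹ with hσ
  have hσm : σ ^ N ∈ holAut E := pow_mem (hS _) N
  have hinv : (σ ^ N)⁻¹ = σ⁻¹ ^ N := (inv_pow σ N).symm
  have hσK : NearId (σ ^ N) (cthickening (δ / 2) K) (2 * η) := by
    intro z hz
    have hA : ∀ x, ‖x - z‖ ≤ ‖(0 : E)‖ + 2 * η → x ∈ cthickening δ K := by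
      intro x hx
      rw [norm_zero, zero_add] at hx
      exact cthickening_mono (by linarith) K (mem_cthickening_add (by positivity) (by positivity)
        hz hx)
    rw [hinv, ← Equiv.Perm.iterate_eq_pow, ← Equiv.Perm.iterate_eq_pow]
    constructor
    · have := norm_iterate_sub_le_of_forall_norm_le (f := σ) hN (by positivity)
        (fun z hz => h1 z (Or.inl hz) 0 (by simpa using hVK z hz)) hA
      simpa using this
    · have := norm_iterate_sub_le_of_forall_norm_le (f := ⇑σ⁻¹) hN (by positivity)
        (fun z hz => h2 z (Or.inl hz) 0 (by simpa using hVK z hz)) hA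
      simpa using this
  have hσx : ‖(σ ^ N) x - y‖ ≤ 2 * η := by
    rw [← Equiv.Perm.iterate_eq_pow]
    have := norm_iterate_sub_le_of_forall_norm_le (f := σ) (A := closedBall q r) (z₀ := x)
      (w := y - x) hN (by positivity : 0 ≤ 2 * η)
      (fun z hz => h1 z (Or.inr hz) _ (hVq z hz)) ?_
    · simpa [sub_sub] using this
    · intro z hz
      have hyx : ‖y - x‖ ≤ r / 4 + r / 4 := by
        calc ‖y - x‖ = ‖(y - q) - (x - q)‖ := by congr 1; abel
          _ ≤ r / 4 + r / 4 := (norm_sub_le _ _).trans (add_le_add hy.le hx.le)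
      rw [mem_closedBall, dist_eq_norm]
      calc ‖z - q‖ = ‖(z - x) + (x - q)‖ := by congr 1; abel
        _ ≤ r := by
          refine (norm_add_le _ _).trans ?_
          linarith
  have htr : NearId (Equiv.addRight (y - (σ ^ N) x)) (cthickening (δ / 2) K) (2 * η) := by
    intro z _
    rw [norm_sub_rev] at hσx
    constructor
    · simpa using hσx
    · have : (Equiv.addRight (y - (σ ^ N) x))⁻¹ z = z + -(y - (σ ^ N) x) := rfl
      rw [this, add_sub_cancel_left, norm_neg]
      exact hσx
  refine ⟨Equiv.addRight (y - (σ ^ N) x) * σ ^ N, mul_mem (addRight_mem_holAut _) hσm, ?_, ?_⟩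
  · refine (htr.mul (by positivity) hσK fun z hz w hw => ?_).mono subset_rfl
      (by linarith : 2 * (2 * η) ≤ ε)
    exact cthickening_mono (by linarith) K (mem_cthickening_add (by positivity) (by positivity)
      hz hw)
  · simp

lemma exists_nearId_lt_norm (hE : 1 < Module.finrank ℂ E) {K : Set E}
    (hK : IsCompact K) (hKc : IsExpConvex K) {q : E} (hq : q ∉ K) (R : ℝ) :
    ∃ δ > 0, ∀ ε > 0, ∃ φ ∈ holAut E, NearId φ (cthickening δ K) ε ∧ R < ‖φ q‖ := by
  have : Nontrivial E := Module.nontrivial_of_finrank_pos (R := ℂ) (by omega)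
  set P : E → Prop := fun q =>
    ∃ δ > 0, ∀ ε > 0, ∃ φ ∈ holAut E, NearId φ (cthickening δ K) ε ∧ R < ‖φ q‖ with hP
  by_contra hPq
  set B : Set E := {x | x ∉ K ∧ ¬ P x} with hB
  have hfar : ∀ x, R < ‖x‖ → P x := fun x hx =>
    ⟨1, one_pos, fun ε hε => ⟨1, one_mem _, NearId.one _ hε.le, hx⟩⟩
  have hloc : ∀ x ∉ K, ∃ s > 0, ∀ y ∈ ball x s, P x ↔ P y := by
    intro x hx
    obtain ⟨r, hr, δ, hδ, h⟩ := exists_nearId_apply_eq hE hK hKc hx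
    refine ⟨r, hr, fun y hy => ?_⟩
    have hx' := mem_ball_self (x := x) hr
    exact ⟨exists_nearId_lt_norm_of_apply_eq hδ (h y hy x hx'),
      exists_nearId_lt_norm_of_apply_eq hδ (h x hx' y hy)⟩
  have hBo : IsOpen B := by
    refine isOpen_iff_mem_nhds.2 fun x hx => ?_
    obtain ⟨s, hs, h⟩ := hloc x hx.1
    filter_upwards [ball_mem_nhds x hs, hK.isClosed.isOpen_compl.mem_nhds hx.1] with y hy hyK
    exact ⟨hyK, fun hy' => hx.2 ((h y hy).2 hy')⟩
  have hfr : frontier B ⊆ K := by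
    intro x hx
    rw [hBo.frontier_eq] at hx
    by_contra hxK
    obtain ⟨s, hs, h⟩ := hloc x hxK
    obtain ⟨y, hyB, hy⟩ := Metric.mem_closure_iff.1 hx.1 s hs
    refine hx.2 ⟨hxK, fun hPx => hyB.2 ((h y ?_).1 hPx)⟩
    rwa [mem_ball, dist_comm]
  have hBb : Bornology.IsBounded B := by
    refine isBounded_closedBall.subset (s := B) (t := closedBall 0 R) fun x hx => ?_
    rw [mem_closedBall, dist_zero_right]
    by_contra! hxR
    exact hx.2 (hfar x hxR)
  obtain ⟨h, hh, hhq, hhK⟩ := hKc q hq (1 / 2) (by norm_num)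
  have := Complex.norm_le_of_forall_mem_frontier_norm_le hBb hh.differentiable.diffContOnCl
    (fun z hz => hhK z (hfr hz)) (subset_closure (show q ∈ B from ⟨hq, hPq⟩))
  rw [hhq, norm_one] at this
  norm_num at this

lemma exists_nearId_forall_lt_norm (hE : 1 < Module.finrank ℂ E) {L : Set E} (hL : L.Finite)
    {K : Set E} (hK : IsCompact K) (hKc : IsExpConvex K) (hLK : L ⊆ Kᶜ) (R : ℝ)
    {ε : ℝ} (hε : 0 < ε) : ∃ φ ∈ holAut E, NearId φ K ε ∧ ∀ q ∈ L, R < ‖φ q‖ := by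
  induction L, hL using Set.Finite.induction_on generalizing K R ε with
  | empty => exact ⟨1, one_mem _, NearId.one _ hε.le, by simp⟩
  | @insert q L hqL hL ih =>
    obtain ⟨K', hK', hK'c, hKK', hLK'⟩ :=
      hKc.exists_compact_neighborhood hK (hL.insert q) hLK
    obtain ⟨d, hd, hKd⟩ := hK.exists_cthickening_subset_open isOpen_interior hKK'
    have hqK' : q ∉ K' := hLK' (mem_insert _ _)
    obtain ⟨s, hs, hqs⟩ := Metric.isOpen_iff.1 hK'.isClosed.isOpen_compl q hqK'
    set ε₁ := min (ε / 2) (min d (s / 2)) with hε₁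
    have hε₁0 : 0 < ε₁ := by positivity
    have hε₁ε : ε₁ ≤ ε / 2 := min_le_left _ _
    have hε₁d : ε₁ ≤ d := (min_le_right _ _).trans (min_le_left _ _)
    have hε₁s : ε₁ ≤ s / 2 := (min_le_right _ _).trans (min_le_right _ _)
    obtain ⟨φ, hφ, hφK, hφL⟩ := ih (hK'.insert q) (hK'c.insert hK' q) (fun x hx => by
      rw [mem_compl_iff, mem_insert_iff, not_or]
      exact ⟨fun h => hqL (h ▸ hx), hLK' (mem_insert_of_mem _ hx)⟩) (R + 1) hε₁0
    have hφq : φ q ∉ K' := by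
      refine hqs ?_
      rw [mem_ball, dist_eq_norm]
      linarith [(hφK q (mem_insert _ _)).1]
    have hφqL : φ q ∉ K' ∪ φ '' L := by
      rintro (h | ⟨x, hx, hxq⟩)
      · exact hφq h
      · exact hqL (φ.injective hxq ▸ hx)
    obtain ⟨δ, hδ, hψ⟩ := exists_nearId_lt_norm hE (hK'.union (hL.image φ).isCompact)
      (hK'c.union_finite hK' (hL.image φ)) hφqL R
    obtain ⟨ψ, hψ, hψK, hψq⟩ := hψ (min ε₁ 1) (by positivity)
    have hψK := hψK.mono (self_subset_cthickening _) le_rfl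
    refine ⟨ψ * φ, mul_mem hψ hφ, ?_, ?_⟩
    · refine ((hψK.mono subset_union_left (min_le_left _ _)).mul hε₁0.le
        (hφK.mono (subset_insert _ _) le_rfl) fun z hz w hw => ?_).mono subset_rfl
        (by linarith)
      exact interior_subset (hKd (mem_cthickening_of_dist_le w z d K hz
        (by rw [dist_eq_norm]; linarith)))
    · rintro x (rfl | hx)
      · exact hψq
      · have h1 := hφL x hx
        have h2 := (hψK (φ x) (Or.inr (mem_image_of_mem φ hx))).1
        have h3 := norm_sub_norm_le (φ x) (ψ (φ x))
        rw [norm_sub_rev] at h3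
        rw [Equiv.Perm.mul_apply]
        linarith [min_le_right ε₁ 1]

end Pushing

section Limit

variable {E G : Type*} [NormedAddCommGroup E] [NormedAddCommGroup G]

lemma exists_tendstoLocallyUniformly_of_geometric [CompleteSpace G] {f : ℕ → E → G}
    (h : ∀ R : ℝ, ∃ (M : ℕ) (C : ℝ), ∀ m ≥ M, ∀ z : E, ‖z‖ ≤ R →
      ‖f (m + 1) z - f m z‖ ≤ C * (1 / 2) ^ m) :
    ∃ g : E → G, TendstoLocallyUniformly f g atTop := by
  choose M C hMC using h
  have hgeo : ∀ R z, ‖z‖ ≤ R → ∀ n, dist (f (n + M R) z) (f (n + 1 + M R) z) ≤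
      C R * (1 / 2) ^ M R * (1 / 2) ^ n := by
    intro R z hz n
    rw [dist_comm, dist_eq_norm, add_right_comm, mul_assoc, ← pow_add, add_comm (M R)]
    exact hMC R (n + M R) (Nat.le_add_left _ _) z hz
  have hlim : ∀ z, ∃ y, Tendsto (fun m => f m z) atTop (𝓝 y) := by
    intro z
    obtain ⟨y, hy⟩ := cauchySeq_tendsto_of_complete
      (cauchySeq_of_le_geometric _ _ (by norm_num) (hgeo ‖z‖ z le_rfl))
    exact ⟨y, (tendsto_add_atTop_iff_nat (M ‖z‖)).1 hy⟩
  choose g hg using hlim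
  refine ⟨g, Metric.tendstoLocallyUniformly_iff.2 fun ε hε x => ?_⟩
  set R := ‖x‖ + 1 with hR
  refine ⟨ball x 1, ball_mem_nhds x one_pos, ?_⟩
  have h0 : Tendsto (fun n : ℕ => C R * (1 / 2) ^ M R * (1 / 2) ^ n / (1 - 1 / 2)) atTop (𝓝 0) := by
    have := (tendsto_pow_atTop_nhds_zero_of_lt_one (r := (1 / 2 : ℝ)) (by norm_num)
      (by norm_num)).const_mul (C R * (1 / 2) ^ M R) |>.div_const (1 - 1 / 2)
    simpa using this
  obtain ⟨N, hN⟩ := eventually_atTop.1 (h0.eventually_lt_const hε)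
  filter_upwards [eventually_ge_atTop (N + M R)] with m hm y hy
  have hyR : ‖y‖ ≤ R := by
    rw [mem_ball, dist_eq_norm] at hy
    calc ‖y‖ = ‖x + (y - x)‖ := by congr 1; abel
      _ ≤ R := (norm_add_le _ _).trans (by linarith)
  obtain ⟨n, rfl⟩ := Nat.exists_eq_add_of_le' (Nat.le_of_add_left_le hm)
  rw [dist_comm]
  exact (dist_le_of_le_geometric_of_tendsto _ _ (by norm_num) (hgeo R y hyR)
    ((tendsto_add_atTop_iff_nat (M R)).2 (hg y)) n).trans_lt (hN n (by omega))

lemma norm_apply_inv_apply_sub_le {Φ : ℕ → Equiv.Perm E} {ρ : ℝ}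
    (hΦ : ∀ m : ℕ, NearId (Φ (m + 1) * (Φ m)⁻¹) (closedBall 0 (ρ + m)) ((1 / 2) ^ (m + 2)))
    {k m : ℕ} (hkm : k ≤ m) {z : E} (hz : ‖z‖ ≤ ρ + k - 1 / 2 + (1 / 2) ^ (m + 1)) :
    ‖Φ k ((Φ m)⁻¹ z) - z‖ ≤ (1 / 2) ^ (k + 1) - (1 / 2) ^ (m + 1) := by
  induction m, hkm using Nat.le_induction generalizing z with
  | base => simp
  | succ m hkm ih =>
    have hkm' : (k : ℝ) ≤ m := by exact_mod_cast hkm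
    have hp : (1 / 2 : ℝ) ^ (m + 1 + 1) ≤ 1 / 2 := by
      simpa using pow_le_pow_of_le_one (by norm_num : (0 : ℝ) ≤ 1 / 2) (by norm_num)
        (by omega : 1 ≤ m + 1 + 1)
    have hpp : (1 / 2 : ℝ) ^ (m + 1) = (1 / 2) ^ (m + 1 + 1) + (1 / 2) ^ (m + 1 + 1) := by
      rw [pow_succ _ (m + 1)]; ring
    have h1 := (hΦ m z (by rw [mem_closedBall, dist_zero_right]; linarith)).2
    set y := (Φ (m + 1) * (Φ m)⁻¹)⁻¹ z with hy
    have hyz : (Φ (m + 1))⁻¹ z = (Φ m)⁻¹ y := by simp [hy]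
    have hyn : ‖y‖ ≤ ‖z‖ + (1 / 2) ^ (m + 1 + 1) := by
      calc ‖y‖ = ‖z + (y - z)‖ := by congr 1; abel
        _ ≤ _ := (norm_add_le _ _).trans (by gcongr)
    have h2 := ih (z := y) (by linarith)
    rw [hyz]
    calc ‖Φ k ((Φ m)⁻¹ y) - z‖ = ‖(Φ k ((Φ m)⁻¹ y) - y) + (y - z)‖ := by congr 1; abel
      _ ≤ (1 / 2) ^ (k + 1) - (1 / 2) ^ (m + 1 + 1) :=
        (norm_add_le _ _).trans (by linarith)

variable [NormedSpace ℂ E] [NormedSpace ℂ G]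

lemma norm_fderiv_le_three_mul {f : E → G} (hf : Differentiable ℂ f) {z : E} {C : ℝ} (hC : 0 < C)
    (h : ∀ w, ‖w - z‖ ≤ 1 → ‖f w‖ ≤ C) : ‖fderiv ℂ f z‖ ≤ 3 * C := by
  have hm : MapsTo f (ball z 1) (closedBall (f z) (3 * C)) := by
    intro w hw
    rw [mem_ball, dist_eq_norm] at hw
    rw [mem_closedBall, dist_eq_norm]
    have h1 := h w hw.le
    have h2 := h z (by simp)
    exact (norm_sub_le _ _).trans (by linarith)
  simpa using Complex.norm_fderiv_le_div_of_mapsTo_ball hf.differentiableOn hm one_pos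

lemma exists_differentiable_tendstoLocallyUniformly [CompleteSpace G] {f : ℕ → E → G} {ρ : ℝ}
    (hf : ∀ m, Differentiable ℂ (f m))
    (h : ∀ (m : ℕ) z, ‖z‖ ≤ ρ + m → ‖f (m + 1) z - f m z‖ ≤ (1 / 2) ^ m) :
    ∃ g : E → G, Differentiable ℂ g ∧ TendstoLocallyUniformly f g atTop := by
  obtain ⟨g, hg⟩ := exists_tendstoLocallyUniformly_of_geometric (f := f) fun R => by
    obtain ⟨M, hM⟩ := exists_nat_ge (R - ρ)
    refine ⟨M, 1, fun m hm z hz => ?_⟩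
    have : (M : ℝ) ≤ m := by exact_mod_cast hm
    rw [one_mul]
    exact h m z (by linarith)
  obtain ⟨g', hg'⟩ := exists_tendstoLocallyUniformly_of_geometric (f := fun m => fderiv ℂ (f m))
    fun R => by
      obtain ⟨M, hM⟩ := exists_nat_ge (R + 1 - ρ)
      refine ⟨M, 3, fun m hm z hz => ?_⟩
      have hMm : (M : ℝ) ≤ m := by exact_mod_cast hm
      rw [← fderiv_sub (hf _ z) (hf _ z)]
      refine norm_fderiv_le_three_mul ((hf _).sub (hf _)) (by positivity) fun w hw => h m w ?_
      calc ‖w‖ = ‖z + (w - z)‖ := by congr 1; abel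
        _ ≤ ρ + m := (norm_add_le _ _).trans (by linarith)
  refine ⟨g, fun z => ?_, hg⟩
  refine (hasFDerivAt_of_tendstoLocallyUniformlyOn isOpen_univ
    (tendstoLocallyUniformlyOn_univ.2 hg') (fun m x _ => (hf m x).hasFDerivAt) (fun x _ => ?_)
    (mem_univ z)).differentiableAt
  exact (tendstoLocallyUniformlyOn_univ.2 hg).tendsto_at (mem_univ x)

/-- An entire map which, after composition with suitable automorphisms, is close to the identity
on arbitrarily large balls is an injective local biholomorphism. -/
lemma injective_and_fderiv_of_near_id {F : E → E} (hF : Differentiable ℂ F)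
    (h : ∀ R : ℝ, ∃ Φ : E → E, Differentiable ℂ Φ ∧ ∀ z, ‖z‖ ≤ R → ‖Φ (F z) - z‖ ≤ 1 / 8) :
    Function.Injective F ∧ ∀ z, Function.Injective (fderiv ℂ F z) := by
  have key : ∀ R : ℝ, ∃ Φ : E → E, Differentiable ℂ Φ ∧
      ∀ z, ‖z‖ ≤ R → ‖fderiv ℂ (fun z => Φ (F z) - z) z‖ ≤ 3 / 8 := by
    intro R
    obtain ⟨Φ, hΦ, hR⟩ := h (R + 1)
    refine ⟨Φ, hΦ, fun z hz => ?_⟩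
    refine (norm_fderiv_le_three_mul ((hΦ.comp hF).sub differentiable_id) (C := 1 / 8)
      (by norm_num) fun w hw => hR w ?_).trans (by norm_num)
    calc ‖w‖ = ‖z + (w - z)‖ := by congr 1; abel
      _ ≤ R + 1 := (norm_add_le _ _).trans (add_le_add hz hw)
  constructor
  · intro x y hxy
    obtain ⟨Φ, hΦ, hR⟩ := key (max ‖x‖ ‖y‖)
    have := (convex_closedBall (0 : E) (max ‖x‖ ‖y‖)).norm_image_sub_le_of_norm_fderiv_le
      (𝕜 := ℂ) (f := fun z => Φ (F z) - z) (x := x) (y := y)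
      (fun z _ => ((hΦ.comp hF).sub differentiable_id) z)
      (fun z hz => hR z (by simpa using hz)) (by simp) (by simp)
    simp only [hxy, sub_sub_sub_cancel_left] at this
    rw [norm_sub_rev] at this
    have h0 : ‖y - x‖ ≤ 0 := by linarith [norm_nonneg (y - x)]
    exact (sub_eq_zero.1 (norm_le_zero_iff.1 h0)).symm
  · intro z
    refine (injective_iff_map_eq_zero _).2 fun v hv => ?_
    obtain ⟨Φ, hΦ, hR⟩ := key ‖z‖
    have hd : HasFDerivAt (fun z => Φ (F z) - z)
        ((fderiv ℂ Φ (F z)).comp (fderiv ℂ F z) - ContinuousLinearMap.id ℂ E) z :=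
      ((hΦ (F z)).hasFDerivAt.comp z (hF z).hasFDerivAt).sub (hasFDerivAt_id z)
    have h1 := hR z le_rfl
    rw [hd.fderiv] at h1
    have h2 := ContinuousLinearMap.le_of_opNorm_le _ h1 v
    simp only [sub_apply, ContinuousLinearMap.comp_apply, hv, map_zero, zero_sub, norm_neg,
      ContinuousLinearMap.id_apply] at h2
    exact norm_le_zero_iff.1 (by linarith [norm_nonneg v])

variable [FiniteDimensional ℂ E]

lemma exists_holAut_step (hE : 1 < Module.finrank ℂ E) {L : Set E} (hL : L.Finite)
    {Φ : Equiv.Perm E} (hΦ : Φ ∈ holAut E) {r : ℝ} (hr : 0 ≤ r) (hΦL : ∀ q ∈ L, r < ‖Φ q‖)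
    {η : ℝ} (hη : 0 < η) (R : ℝ) :
    ∃ Φ' ∈ holAut E, (∀ q ∈ L, R < ‖Φ' q‖) ∧ NearId (Φ' * Φ⁻¹) (closedBall 0 r) η ∧
      ∀ z, ‖z‖ ≤ r → ‖Φ'⁻¹ z - Φ⁻¹ z‖ ≤ η := by
  have : ProperSpace E := FiniteDimensional.proper_rclike ℂ E
  have hu := (isCompact_closedBall (0 : E) (r + 1)).uniformContinuousOn_of_continuous
    hΦ.2.continuous.continuousOn
  obtain ⟨d, hd, hu⟩ := Metric.uniformContinuousOn_iff_le.1 hu η hη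
  obtain ⟨φ, hφ, hφr, hφL⟩ := exists_nearId_forall_lt_norm hE (hL.image Φ)
    (isCompact_closedBall (0 : E) r) (isExpConvex_closedBall hr) (by
      rintro _ ⟨q, hq, rfl⟩
      simpa using hΦL q hq) R (show 0 < min η (min d 1) by positivity)
  refine ⟨φ * Φ, mul_mem hφ hΦ, fun q hq => hφL _ (mem_image_of_mem Φ hq), ?_, fun z hz => ?_⟩
  · rw [mul_inv_cancel_right]
    exact hφr.mono subset_rfl (min_le_left _ _)
  · have h1 := (hφr z (by simpa using hz)).2
    have h2 : ‖φ⁻¹ z - z‖ ≤ d := h1.trans ((min_le_right _ _).trans (min_le_left _ _))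
    have h3 : ‖φ⁻¹ z - z‖ ≤ 1 := h1.trans ((min_le_right _ _).trans (min_le_right _ _))
    rw [mul_inv_rev, Equiv.Perm.mul_apply, ← dist_eq_norm]
    refine hu _ ?_ _ ?_ (by rwa [dist_eq_norm])
    · rw [mem_closedBall, dist_zero_right]
      calc ‖φ⁻¹ z‖ = ‖z + (φ⁻¹ z - z)‖ := by congr 1; abel
        _ ≤ r + 1 := (norm_add_le _ _).trans (add_le_add hz h3)
    · rw [mem_closedBall, dist_zero_right]
      linarith

lemma exists_holAut_seq (hE : 1 < Module.finrank ℂ E) {L : Set E} (hL : L.Finite)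
    {Φ₀ : Equiv.Perm E} (hΦ₀ : Φ₀ ∈ holAut E) {ρ : ℝ} (hρ : 0 ≤ ρ) (hΦL : ∀ q ∈ L, ρ < ‖Φ₀ q‖) :
    ∃ Φ : ℕ → Equiv.Perm E, Φ 0 = Φ₀ ∧ ∀ m : ℕ, Φ m ∈ holAut E ∧ (∀ q ∈ L, ρ + m < ‖Φ m q‖) ∧
      NearId (Φ (m + 1) * (Φ m)⁻¹) (closedBall 0 (ρ + m)) ((1 / 2) ^ (m + 2)) ∧
      ∀ z, ‖z‖ ≤ ρ + m → ‖(Φ (m + 1))⁻¹ z - (Φ m)⁻¹ z‖ ≤ (1 / 2) ^ m := by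
  have step : ∀ (m : ℕ) (Φ : Equiv.Perm E), (Φ ∈ holAut E ∧ ∀ q ∈ L, ρ + m < ‖Φ q‖) →
      ∃ Φ' : Equiv.Perm E, (Φ' ∈ holAut E ∧ ∀ q ∈ L, ρ + (m + 1 : ℕ) < ‖Φ' q‖) ∧
        NearId (Φ' * Φ⁻¹) (closedBall 0 (ρ + m)) ((1 / 2) ^ (m + 2)) ∧
        ∀ z, ‖z‖ ≤ ρ + m → ‖Φ'⁻¹ z - Φ⁻¹ z‖ ≤ (1 / 2) ^ m := by
    intro m Φ hΦ
    obtain ⟨Φ', h1, h2, h3, h4⟩ := exists_holAut_step hE hL hΦ.1 (by positivity) hΦ.2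
      (show (0 : ℝ) < (1 / 2) ^ (m + 2) by positivity) (ρ + (m + 1 : ℕ))
    exact ⟨Φ', ⟨h1, h2⟩, h3, fun z hz => (h4 z hz).trans
      (pow_le_pow_of_le_one (by norm_num) (by norm_num) (by omega))⟩
  choose! next hnext using step
  set Φ : ℕ → Equiv.Perm E := fun m => Nat.rec Φ₀ next m with hΦ
  have hT : ∀ m : ℕ, Φ m ∈ holAut E ∧ ∀ q ∈ L, ρ + m < ‖Φ m q‖ := by
    intro m
    induction m with
    | zero => exact ⟨hΦ₀, by simpa [hΦ] using hΦL⟩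
    | succ m ih => exact (hnext m _ ih).1
  exact ⟨Φ, rfl, fun m => ⟨(hT m).1, (hT m).2, (hnext m _ (hT m)).2⟩⟩

lemma exists_continuousLinearEquiv_of_injective {A : E →L[ℂ] E} (hA : Function.Injective A) :
    ∃ B : E ≃L[ℂ] E, A = (B : E →L[ℂ] E) :=
  ⟨(LinearEquiv.ofInjectiveEndo (A : E →ₗ[ℂ] E) hA).toContinuousLinearEquiv, by ext; rfl⟩

/-- A compact set convex with respect to exponential sums is contained in a Fatou–Bieberbach
domain that avoids a given finite subset of its complement. -/
theorem IsExpConvex.exists_fatouBieberbach (hE : 1 < Module.finrank ℂ E) {K : Set E}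
    (hK : IsCompact K) (hKc : IsExpConvex K) {L : Set E} (hL : L.Finite) (hLK : L ⊆ Kᶜ) :
    ∃ F : E → E, Differentiable ℂ F ∧ Function.Injective F ∧
      (∀ z, ∃ A : E ≃L[ℂ] E, fderiv ℂ F z = (A : E →L[ℂ] E)) ∧
      K ⊆ range F ∧ range F ∩ L = ∅ := by
  have : CompleteSpace E := FiniteDimensional.complete ℂ E
  obtain ⟨ρ, hρ, hKρ⟩ := hK.isBounded.subset_closedBall_lt 0 0
  obtain ⟨Φ₀, hΦ₀, hΦ₀K, hΦ₀L⟩ := exists_nearId_forall_lt_norm hE hL hK hKc hLK (ρ + 3) one_pos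
  obtain ⟨Φ, hΦ0, hΦ⟩ := exists_holAut_seq hE hL hΦ₀ (by positivity : 0 ≤ ρ + 3) hΦ₀L
  obtain ⟨F, hF, hlim⟩ := exists_differentiable_tendstoLocallyUniformly
    (f := fun m => ⇑(Φ m)⁻¹) (ρ := ρ + 3) (fun m => (hΦ m).1.2) (fun m => (hΦ m).2.2.2)
  have hpt : ∀ z, Tendsto (fun m => (Φ m)⁻¹ z) atTop (𝓝 (F z)) := fun z =>
    (tendstoLocallyUniformlyOn_univ.2 hlim).tendsto_at (mem_univ z)
  have hnear : ∀ (k : ℕ) (z : E), ‖z‖ ≤ ρ + 3 + k - 1 / 2 →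
      ‖Φ k (F z) - z‖ ≤ (1 / 2) ^ (k + 1) := by
    intro k z hz
    have hc := ((hΦ k).1.1.continuous.tendsto (F z)).comp (hpt z)
    refine le_of_tendsto (hc.sub_const z).norm ?_
    filter_upwards [eventually_ge_atTop k] with m hm
    have hp : (0 : ℝ) ≤ (1 / 2) ^ (m + 1) := by positivity
    exact (norm_apply_inv_apply_sub_le (fun m => (hΦ m).2.2.1) hm (by linarith)).trans
      (by linarith)
  obtain ⟨hinj, hdinj⟩ := injective_and_fderiv_of_near_id hF fun R => by
    obtain ⟨M, hM⟩ := exists_nat_ge R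
    refine ⟨Φ (M + 2), (hΦ _).1.1, fun z hz => (hnear (M + 2) z ?_).trans ?_⟩
    · push_cast
      linarith
    · refine (pow_le_pow_of_le_one (by norm_num) (by norm_num) (by omega : 3 ≤ M + 2 + 1)).trans
        (by norm_num)
  refine ⟨F, hF, hinj, fun z => exists_continuousLinearEquiv_of_injective (hdinj z), ?_, ?_⟩
  · intro p hp
    have hb : ∀ m : ℕ, ‖Φ m p‖ ≤ ρ + 2 - (1 / 2) ^ (m + 1) ∧
        dist (Φ m p) (Φ (m + 1) p) ≤ (1 / 4) * (1 / 2) ^ m := by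
      have hd : ∀ m : ℕ, ‖Φ m p‖ ≤ ρ + 2 - (1 / 2) ^ (m + 1) →
          ‖Φ (m + 1) p - Φ m p‖ ≤ (1 / 2) ^ (m + 2) := by
        intro m hm
        have hp : (0 : ℝ) ≤ (1 / 2) ^ (m + 1) := by positivity
        have := ((hΦ m).2.2.1 (Φ m p) (by
          rw [mem_closedBall, dist_zero_right]
          linarith [Nat.cast_nonneg (α := ℝ) m])).1
        simpa using this
      have hn : ∀ m : ℕ, ‖Φ m p‖ ≤ ρ + 2 - (1 / 2) ^ (m + 1) := by
        intro m
        induction m with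
        | zero =>
          have h1 := (hΦ₀K p hp).1
          have h2 : ‖p‖ ≤ ρ := by simpa using hKρ hp
          rw [hΦ0]
          calc ‖Φ₀ p‖ = ‖p + (Φ₀ p - p)‖ := by congr 1; abel
            _ ≤ ρ + 2 - (1 / 2) ^ (0 + 1) := (norm_add_le _ _).trans (by norm_num; linarith)
        | succ m ih =>
          calc ‖Φ (m + 1) p‖ = ‖Φ m p + (Φ (m + 1) p - Φ m p)‖ := by congr 1; abel
            _ ≤ (ρ + 2 - (1 / 2) ^ (m + 1)) + (1 / 2) ^ (m + 2) :=
              (norm_add_le _ _).trans (add_le_add ih (hd m ih))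
            _ = ρ + 2 - (1 / 2) ^ (m + 1 + 1) := by ring
      intro m
      refine ⟨hn m, ?_⟩
      rw [dist_comm, dist_eq_norm]
      exact (hd m (hn m)).trans_eq (by ring)
    obtain ⟨x, hx⟩ := cauchySeq_tendsto_of_complete
      (cauchySeq_of_le_geometric _ _ (by norm_num) fun m => (hb m).2)
    refine ⟨x, tendsto_nhds_unique (hlim.tendsto_comp hF.continuous.continuousAt hx) ?_⟩
    simp
  · refine eq_empty_of_forall_notMem ?_
    rintro _ ⟨⟨z, rfl⟩, hzL⟩
    obtain ⟨k, hk⟩ := exists_nat_ge ‖z‖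
    have h1 := hnear k z (by linarith)
    have h2 := (hΦ k).2.1 _ hzL
    have h3 : (1 / 2 : ℝ) ^ (k + 1) ≤ 1 := pow_le_one₀ (by norm_num) (by norm_num)
    have h4 := norm_sub_norm_le (Φ k (F z)) z
    linarith

end Limit

/-- Fatou–Bieberbach domains containing K and avoiding a finite set L: given a compact
polynomially convex set K ⊆ ℂⁿ (n ≥ 2) and a finite set L ⊆ ℂⁿ \ K, there is an injective
entire map F : ℂⁿ → ℂⁿ with everywhere-invertible derivative such that K ⊆ F(ℂⁿ) and
F(ℂⁿ) ∩ L = ∅. -/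
theorem fatou_bieberbach_containing_K_avoiding_finite_set (n : ℕ) (hn : 2 ≤ n)
    (K : Set (EuclideanSpace ℂ (Fin n))) (hK : IsCompact K) (hKpc : IsPolynomiallyConvex K)
    (L : Set (EuclideanSpace ℂ (Fin n))) (hL : L.Finite) (hLK : L ⊆ Kᶜ) :
    ∃ F : EuclideanSpace ℂ (Fin n) → EuclideanSpace ℂ (Fin n),
      Differentiable ℂ F ∧ Function.Injective F ∧
      (∀ z, ∃ A : EuclideanSpace ℂ (Fin n) ≃L[ℂ] EuclideanSpace ℂ (Fin n),
        fderiv ℂ F z = (A : EuclideanSpace ℂ (Fin n) →L[ℂ] EuclideanSpace ℂ (Fin n))) ∧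
      K ⊆ Set.range F ∧ Set.range F ∩ L = ∅ := by
  exact (hKpc.isExpConvex hK).exists_fatouBieberbach
    (by rw [finrank_euclideanSpace_fin]; omega) hK hL hLK
end
end
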